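/- For every real δ with 0 < δ < 1, there exist constants μ > 0, C ≥ 1, c > 0 and c' > 0, and a strictly increasing sequence (n_i) of integers with n_i ≥ 2 satisfying log n_{i+1} ≤ C · log n_i for all i, such that for every i there exist a natural number d ≤ c' · log n_i, finite sets A, B of vectors in (Fin d → Bool) with |A| = |B| = n_i, a set E ⊆ A × B with |E| ≥ c · n_i^{1.5−δ}, and a positive integer β such that: every pair (a, b) ∈ E has Hamming distance exactly β; every pair (a, b) ∈ (A × B) \ E has Hamming distance strictly greater than β; and any two distinct vectors both in A or both in B have Hamming distance strictly greater than (1 + μ) · β. -/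

import Mathlib

/-- The one-hot encoding of a word, read on the coordinates in `T`. -/
noncomputable def oneHot {ι K : Type*} [DecidableEq K] [Fintype K] (T : Finset ι) (w : ι → K) :
    Fin (Fintype.card (T × K)) → Bool :=
  fun i => decide (w ((Fintype.equivFin (T × K)).symm i).1 = ((Fintype.equivFin (T × K)).symm i).2)

theorem hammingDist_oneHot {ι K : Type*} [DecidableEq ι] [DecidableEq K] [Fintype K] (T : Finset ι)
    (v w : ι → K) :
    hammingDist (oneHot T v) (oneHot T w) = 2 * (T.filter fun i => v i ≠ w i).card := by
  classical
  unfold hammingDist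
  have h1 : (Finset.univ.filter fun i => oneHot T v i ≠ oneHot T w i).card
      = (Finset.univ.filter fun x : T × K => ¬ (v x.1 = x.2 ↔ w x.1 = x.2)).card := by
    refine Finset.card_bij (fun i _ => (Fintype.equivFin (T × K)).symm i) ?_ ?_ ?_
    · intro i hi
      simpa [oneHot] using hi
    · intro i _ j _ hij
      exact (Fintype.equivFin (T × K)).symm.injective hij
    · intro x hx
      refine ⟨Fintype.equivFin (T × K) x, ?_, by simp⟩
      simpa [oneHot] using hx
  rw [h1]
  have h3 : ∀ t : T, (Finset.univ.filter fun y : K => ¬ (v t = y ↔ w t = y)).card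
      = if v t ≠ w t then 2 else 0 := by
    intro t
    by_cases h : v t = w t
    · simp [h]
    · rw [if_pos h]
      have : (Finset.univ.filter fun y : K => ¬ (v t = y ↔ w t = y)) = {v t, w t} := by
        ext y
        simp only [Finset.mem_filter, Finset.mem_univ, true_and, Finset.mem_insert,
          Finset.mem_singleton]
        constructor
        · intro hy
          by_contra! hne
          exact hy ⟨fun e => absurd e.symm hne.1, fun e => absurd e.symm hne.2⟩
        · rintro (rfl | rfl)
          · simp [Ne.symm h]
          · simp [h]
      rw [this, Finset.card_pair h]
  rw [Finset.card_filter, Fintype.sum_prod_type]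
  simp only [← Finset.card_filter]
  rw [Finset.sum_congr rfl fun t _ => h3 t, Finset.sum_coe_sort T (fun t => if v t ≠ w t then 2 else 0),
    ← Finset.sum_filter, Finset.sum_const, smul_eq_mul, mul_comm]

/-- A linear code whose nonzero words have at most `h` zeros, and which contains many words with
exactly `h` zeros, all of them inside `T`, gives a gap realization in the Hamming metric. -/
theorem exists_gap_realization_of_code {ι K : Type*} [Field K] [Fintype K] [Fintype ι]
    [DecidableEq ι] [DecidableEq K]
    (W : Submodule K (ι → K)) (T : Finset ι) (h M : ℕ)
    (hW : ∀ w ∈ W, w ≠ 0 → (Finset.univ.filter fun i => w i = 0).card ≤ h)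
    (hT : h < T.card) (hU : 0 < (Tᶜ).card) (hM : 0 < M)
    (hcount : M ≤ {w | w ∈ W ∧ (T.filter fun i => w i = 0).card = h}.ncard) :
    ∃ (n D d : ℕ) (A B : Finset (Fin d → Bool)) (E : Finset ((Fin d → Bool) × (Fin d → Bool))),
      n ≤ Fintype.card K ^ (h + 1) ∧ M ≤ D * Fintype.card K ^ (Tᶜ).card ∧ D ≤ n ∧
      d = T.card * Fintype.card K ∧ A.card = n ∧ B.card = n ∧ E ⊆ A ×ˢ B ∧ E.card = n * D ∧
      (∀ ab ∈ E, hammingDist ab.1 ab.2 = 2 * (T.card - h)) ∧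
      (∀ a ∈ A, ∀ b ∈ B, (a, b) ∉ E → 2 * (T.card - h) < hammingDist a b) ∧
      (∀ a ∈ A, ∀ a' ∈ A, a ≠ a' → 2 * (T.card - h) + 2 * (Tᶜ).card ≤ hammingDist a a') ∧
      (∀ b ∈ B, ∀ b' ∈ B, b ≠ b' → 2 * (T.card - h) + 2 * (Tᶜ).card ≤ hammingDist b b') := by
  classical
  set U := Tᶜ with hUdef
  have hsplit : ∀ w : ι → K, (Finset.univ.filter fun i => w i = 0).card
      = (T.filter fun i => w i = 0).card + (U.filter fun i => w i = 0).card := by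
    intro w
    rw [← Finset.card_union_of_disjoint, ← Finset.filter_union, hUdef, Finset.union_compl]
    exact Finset.disjoint_filter_filter (disjoint_compl_right)
  set S : Finset (ι → K) := Finset.univ.filter
    (fun w => w ∈ W ∧ (T.filter fun i => w i = 0).card = h) with hS
  have hScard : M ≤ S.card := by
    rw [← Set.ncard_coe_finset]
    simpa [hS] using hcount
  obtain ⟨v, hv⟩ : ∃ v : U → K, M ≤ (S.filter fun w => (fun i : U => w i) = v).card *
      Fintype.card K ^ U.card := by
    by_contra! hlt
    have h1 := Finset.card_eq_sum_card_fiberwise (f := fun (w : ι → K) => (fun i : U => w i))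
      (s := S) (t := Finset.univ) (fun _ _ => Finset.mem_coe.2 (Finset.mem_univ _))
    have h2 : S.card * Fintype.card K ^ U.card < M * Fintype.card K ^ U.card := by
      rw [h1, Finset.sum_mul]
      refine (Finset.sum_lt_sum_of_nonempty Finset.univ_nonempty fun v _ => hlt v).trans_le ?_
      simp [mul_comm]
    exact absurd hScard (not_le.2 (lt_of_mul_lt_mul_right h2 (Nat.zero_le _)))
  set S' := S.filter fun w => (fun i : U => w i) = v with hS'
  have hS'pos : 0 < S'.card := by
    rcases Nat.eq_zero_or_pos S'.card with h0 | h0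
    · rw [h0, zero_mul] at hv; omega
    · exact h0
  obtain ⟨s, hs⟩ := Finset.card_pos.1 hS'pos
  simp only [hS', hS, Finset.mem_filter, Finset.mem_univ, true_and] at hs
  set C : Finset (ι → K) := Finset.univ.filter (fun w => w ∈ W ∧ ∀ i ∈ U, w i = 0) with hC
  set B : Finset (ι → K) := Finset.univ.filter (fun w => w ∈ W ∧ ∀ i : U, w i = v i) with hB
  have hsv : ∀ i : U, s i = v i := fun i => congrFun hs.2 i
  -- differences
  have hdist : ∀ x y : ι → K, (T.filter fun i => x i ≠ y i).card
      = T.card - (T.filter fun i => (x - y) i = 0).card := by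
    intro x y
    have := Finset.card_filter_add_card_filter_not (s := T) (fun i => (x - y) i = 0)
    simp only [Pi.sub_apply, sub_eq_zero] at this ⊢
    have h' : (T.filter fun i => ¬ x i = y i).card = (T.filter fun i => x i ≠ y i).card := rfl
    omega
  have hzero : ∀ w ∈ C, w ≠ 0 → (T.filter fun i => w i = 0).card + U.card ≤ h := by
    intro w hw hw0
    simp only [hC, Finset.mem_filter, Finset.mem_univ, true_and] at hw
    have := hW w hw.1 hw0
    rw [hsplit, Finset.filter_true_of_mem hw.2] at this
    exact this
  have hTle : ∀ w ∈ W, w ≠ 0 → (T.filter fun i => w i = 0).card ≤ h := by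
    intro w hw hw0
    have := hW w hw hw0
    rw [hsplit] at this; omega
  have hsame : ∀ x y : ι → K, x - y ∈ C → x ≠ y →
      2 * (T.card - h) + 2 * U.card ≤ hammingDist (oneHot T x) (oneHot T y) := by
    intro x y hxy hne
    rw [hammingDist_oneHot, hdist]
    have := hzero _ hxy (sub_ne_zero.2 hne)
    omega
  have hCC : ∀ x ∈ C, ∀ y ∈ C, x - y ∈ C := by
    intro x hx y hy
    simp only [hC, Finset.mem_filter, Finset.mem_univ, true_and] at hx hy ⊢
    exact ⟨W.sub_mem hx.1 hy.1, fun i hi => by simp [hx.2 i hi, hy.2 i hi]⟩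
  have hBB : ∀ x ∈ B, ∀ y ∈ B, x - y ∈ C := by
    intro x hx y hy
    simp only [hB, hC, Finset.mem_filter, Finset.mem_univ, true_and] at hx hy ⊢
    refine ⟨W.sub_mem hx.1 hy.1, fun i hi => ?_⟩
    rw [Pi.sub_apply, hx.2 ⟨i, hi⟩, hy.2 ⟨i, hi⟩, sub_self]
  have hBC : ∀ x ∈ C, ∀ y ∈ B, y - x ∈ B := by
    intro x hx y hy
    simp only [hB, hC, Finset.mem_filter, Finset.mem_univ, true_and] at hx hy ⊢
    refine ⟨W.sub_mem hy.1 hx.1, fun i => ?_⟩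
    rw [Pi.sub_apply, hx.2 i i.2, hy.2 i, sub_zero]
  have hBC' : ∀ x ∈ C, ∀ y ∈ B, x + y ∈ B := by
    intro x hx y hy
    simp only [hB, hC, Finset.mem_filter, Finset.mem_univ, true_and] at hx hy ⊢
    refine ⟨W.add_mem hx.1 hy.1, fun i => ?_⟩
    rw [Pi.add_apply, hx.2 i i.2, hy.2 i, zero_add]
  have hsB : s ∈ B := by
    simp only [hB, Finset.mem_filter, Finset.mem_univ, true_and]
    exact ⟨hs.1.1, hsv⟩
  have hcardBC : B.card = C.card := by
    refine Finset.card_bij (fun x _ => x - s) (fun x hx => hBB x hx s hsB) ?_ ?_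
    · intro x _ y _ hxy
      exact sub_left_injective hxy
    · intro x hx
      exact ⟨x + s, hBC' x hx s hsB, by simp⟩
  have hinj : ∀ x y : ι → K, x - y ∈ C → oneHot T x = oneHot T y → x = y := by
    intro x y hxy he
    by_contra hne
    have := hsame x y hxy hne
    rw [he, hammingDist_self] at this
    omega
  have hinjC : Set.InjOn (oneHot T) (C : Set (ι → K)) := fun x hx y hy =>
    hinj x y (hCC x hx y hy)
  have hinjB : Set.InjOn (oneHot T) (B : Set (ι → K)) := fun x hx y hy =>
    hinj x y (hBB x hx y hy)
  have hS'B : ∀ w, w ∈ S' ↔ w ∈ B ∧ (T.filter fun i => w i = 0).card = h := by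
    intro w
    simp only [hS', hS, hB, Finset.mem_filter, Finset.mem_univ, true_and, funext_iff]
    tauto
  have hBne : ∀ w ∈ B, (T.filter fun i => w i = 0).card ≤ h := by
    intro w hw
    by_cases hw0 : w = 0
    · subst hw0
      exfalso
      have hsC : s - 0 ∈ C := hBB s hsB 0 hw
      rw [sub_zero] at hsC
      have hs0 : s ≠ 0 := by
        rintro rfl
        have := hs.1.2
        simp at this; omega
      have h1 := hzero s hsC hs0
      have := hs.1.2
      omega
    · simp only [hB, Finset.mem_filter, Finset.mem_univ, true_and] at hw
      exact hTle w hw.1 hw0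
  obtain ⟨F, -, hF⟩ := Finset.exists_subset_card_eq (s := T) (n := h + 1) hT
  have hCcard : C.card ≤ Fintype.card K ^ (h + 1) := by
    have h1 : C.card ≤ (Finset.univ : Finset (F → K)).card := by
      refine Finset.card_le_card_of_injOn (fun w => fun i : F => w i) (by simp) ?_
      intro x hx y hy hxy
      by_contra hne
      have hxyC := hCC x hx y hy
      simp only [hC, Finset.mem_filter, Finset.mem_univ, true_and] at hxyC
      have h2 := hW _ hxyC.1 (sub_ne_zero.2 hne)
      have h3 : F ⊆ Finset.univ.filter fun i => (x - y) i = 0 := by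
        intro i hi
        have := congrFun hxy ⟨i, hi⟩
        simpa [sub_eq_zero] using this
      have := Finset.card_le_card h3
      omega
    simpa [hF] using h1
  have hmapS' : ∀ c ∈ C, ((B.filter fun b => (T.filter fun i => (b - c) i = 0).card = h)).card
      = S'.card := by
    intro c hc
    refine Finset.card_bij (fun x _ => x - c) ?_ ?_ ?_
    · intro x hx
      rw [Finset.mem_filter] at hx
      exact (hS'B _).2 ⟨hBC c hc x hx.1, hx.2⟩
    · intro x _ y _ hxy
      exact sub_left_injective hxy
    · intro x hx
      rw [hS'B] at hx
      refine ⟨x + c, ?_, by simp⟩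
      rw [Finset.mem_filter, add_sub_cancel_right, add_comm]
      exact ⟨hBC' c hc x hx.1, hx.2⟩
  set E0 : Finset ((ι → K) × (ι → K)) := (C ×ˢ B).filter
    (fun ab => (T.filter fun i => (ab.2 - ab.1) i = 0).card = h) with hE0
  have hE0card : E0.card = C.card * S'.card := by
    rw [hE0, Finset.card_filter, Finset.sum_product]
    simp only [← Finset.card_filter]
    rw [Finset.sum_congr rfl hmapS', Finset.sum_const, smul_eq_mul]
  have hinjE : Set.InjOn (Prod.map (oneHot T) (oneHot T)) (E0 : Set ((ι → K) × (ι → K))) := by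
    intro x hx y hy hxy
    simp only [hE0, Finset.coe_filter, Finset.mem_product, Set.mem_ofPred_eq] at hx hy
    exact Prod.ext (hinjC hx.1.1 hy.1.1 (congrArg Prod.fst hxy))
      (hinjB hx.1.2 hy.1.2 (congrArg Prod.snd hxy))
  have hcross : ∀ a b : ι → K, hammingDist (oneHot T a) (oneHot T b)
      = 2 * (T.card - (T.filter fun i => (b - a) i = 0).card) := by
    intro a b
    rw [hammingDist_comm, hammingDist_oneHot, hdist]
  refine ⟨C.card, S'.card, _, C.image (oneHot T), B.image (oneHot T),
    E0.image (Prod.map (oneHot T) (oneHot T)), hCcard, hv, ?_, ?_,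
    Finset.card_image_of_injOn hinjC, ?_, ?_, ?_, ?_, ?_, ?_, ?_⟩
  · rw [← hcardBC]
    exact Finset.card_le_card fun w hw => ((hS'B w).1 hw).1
  · simp
  · rw [Finset.card_image_of_injOn hinjB, hcardBC]
  · intro x hx
    obtain ⟨y, hy, rfl⟩ := Finset.mem_image.1 hx
    simp only [hE0, Finset.mem_filter, Finset.mem_product] at hy
    exact Finset.mem_product.2 ⟨Finset.mem_image_of_mem _ hy.1.1, Finset.mem_image_of_mem _ hy.1.2⟩
  · rw [Finset.card_image_of_injOn hinjE, hE0card]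
  · intro x hx
    obtain ⟨y, hy, rfl⟩ := Finset.mem_image.1 hx
    simp only [hE0, Finset.mem_filter, Finset.mem_product] at hy
    rw [Prod.map_fst, Prod.map_snd, hcross, hy.2]
  · intro a ha b hb hab
    obtain ⟨x, hx, rfl⟩ := Finset.mem_image.1 ha
    obtain ⟨y, hy, rfl⟩ := Finset.mem_image.1 hb
    rw [hcross]
    have h1 := hBne _ (hBC x hx y hy)
    have h2 : (T.filter fun i => (y - x) i = 0).card ≠ h := by
      intro h2
      refine hab (Finset.mem_image.2 ⟨(x, y), ?_, rfl⟩)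
      simp only [hE0, Finset.mem_filter, Finset.mem_product]
      exact ⟨⟨hx, hy⟩, h2⟩
    omega
  · intro a ha b hb hab
    obtain ⟨x, hx, rfl⟩ := Finset.mem_image.1 ha
    obtain ⟨y, hy, rfl⟩ := Finset.mem_image.1 hb
    exact hsame x y (hCC x hx y hy) fun h => hab (by rw [h])
  · intro a ha b hb hab
    obtain ⟨x, hx, rfl⟩ := Finset.mem_image.1 ha
    obtain ⟨y, hy, rfl⟩ := Finset.mem_image.1 hb
    exact hsame x y (hBB x hx y hy) fun h => hab (by rw [h])

/-- The quotient `I / P I` is one-dimensional when the residue field at `P` is the base field. -/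
theorem exists_linearMap_ker_eq_mul {K O : Type*} [Field K] [CommRing O] [IsDedekindDomain O]
    [Algebra K O] {P I : Ideal O} (hP : P.IsPrime) (hP0 : P ≠ ⊥) (hI : I ≠ ⊥)
    (hres : ∀ f : O, ∃ c : K, f - algebraMap K O c ∈ P) :
    ∃ φ : ↥(I.restrictScalars K) →ₗ[K] K, ∀ f, φ f = 0 ↔ (f : O) ∈ P * I := by
  have hPI : P * I ≠ I := fun h => hP.ne_top (by
    have : P * I = (1 : Ideal O) * I := by rw [one_mul]; exact h
    exact (mul_right_cancel₀ hI this).trans Ideal.one_eq_top)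
  obtain ⟨t, htI, ht⟩ : ∃ t ∈ I, t ∉ P * I := by
    by_contra! h
    exact hPI (le_antisymm Ideal.mul_le_right h)
  have hex : ∀ f ∈ I, ∃ c : K, f - algebraMap K O c * t ∈ P * I := by
    intro f hf
    have hle : P * I ⊔ Ideal.span {t} ≤ I :=
      sup_le Ideal.mul_le_right ((Ideal.span_singleton_le_iff_mem _).2 htI)
    obtain ⟨J, hJ⟩ := Ideal.dvd_iff_le.2 hle
    have hPJ : P ≤ J := by
      have : I * J ∣ I * P := by
        rw [← hJ, Ideal.dvd_iff_le, mul_comm I P]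
        exact le_sup_left
      exact Ideal.dvd_iff_le.1 ((mul_dvd_mul_iff_left hI).1 this)
    have hmax : P.IsMaximal := hP.isMaximal hP0
    have htop : P * I ⊔ Ideal.span {t} = I := by
      by_cases hJt : J = ⊤
      · rw [hJ, hJt, Ideal.mul_top]
      · exfalso
        rw [← hmax.eq_of_le hJt hPJ, mul_comm I P] at hJ
        exact ht (hJ.le (Ideal.mem_sup_right (Ideal.mem_span_singleton_self t)))
    rw [← htop] at hf
    obtain ⟨q, hq, s, hs, rfl⟩ := Submodule.mem_sup.1 hf
    obtain ⟨a, rfl⟩ := Ideal.mem_span_singleton'.1 hs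
    obtain ⟨c, hc⟩ := hres a
    refine ⟨c, ?_⟩
    have : q + a * t - algebraMap K O c * t = q + (a - algebraMap K O c) * t := by ring
    rw [this]
    exact Ideal.add_mem _ hq (Ideal.mul_mem_mul hc htI)
  have huniq : ∀ c : K, algebraMap K O c * t ∈ P * I → c = 0 := by
    intro c hc
    by_contra hc0
    apply ht
    have := Ideal.mul_mem_left _ (algebraMap K O c⁻¹) hc
    rwa [← mul_assoc, ← map_mul, inv_mul_cancel₀ hc0, map_one, one_mul] at this
  have huniq' : ∀ (f : O) (c c' : K), f - algebraMap K O c * t ∈ P * I →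
      f - algebraMap K O c' * t ∈ P * I → c = c' := by
    intro f c c' h h'
    have := Ideal.sub_mem _ h' h
    have e : f - algebraMap K O c' * t - (f - algebraMap K O c * t)
        = algebraMap K O (c - c') * t := by rw [map_sub]; ring
    rw [e] at this
    exact sub_eq_zero.1 (huniq _ this)
  choose! φ hφ using hex
  refine ⟨{ toFun := fun f => φ f, map_add' := ?_, map_smul' := ?_ }, ?_⟩
  · intro f g
    refine huniq' (f + g) _ _ (hφ _ (I.add_mem f.2 g.2)) ?_
    have := Ideal.add_mem _ (hφ f f.2) (hφ g g.2)
    convert this using 1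
    rw [map_add]; ring
  · intro c f
    refine huniq' (c • (f : O)) _ _ (hφ _ ?_) ?_
    · exact (I.restrictScalars K).smul_mem c f.2
    · have := Ideal.mul_mem_left _ (algebraMap K O c) (hφ f f.2)
      convert this using 1
      rw [Algebra.smul_def, smul_eq_mul, RingHom.id_apply, map_mul]; ring
  · intro f
    constructor
    · intro h
      have := hφ f f.2
      change φ f = 0 at h
      rw [h] at this
      simpa using this
    · intro h
      refine huniq' (f : O) _ _ (hφ f f.2) ?_
      simpa using h

theorem exists_code_of_divisors {K O ι : Type*} [Field K] [Fintype K] [DecidableEq K] [CommRing O]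
    [IsDedekindDomain O] [Algebra K O] [Fintype ι] [DecidableEq ι]
    (δ : Ideal O → ℕ) (hmul : ∀ I J, I ≠ ⊥ → J ≠ ⊥ → δ (I * J) = δ I + δ J)
    (hadd : ∀ f g : O, f ≠ 0 → g ≠ 0 → f + g ≠ 0 →
      δ (Ideal.span {f + g}) ≤ max (δ (Ideal.span {f})) (δ (Ideal.span {g})))
    (P : ι → Ideal O) (hPinj : Function.Injective P) (hP : ∀ i, (P i).IsPrime)
    (hP0 : ∀ i, P i ≠ ⊥) (hP1 : ∀ i, δ (P i) = 1)
    (hres : ∀ i, ∀ f : O, ∃ c : K, f - algebraMap K O c ∈ P i)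
    (V : Submodule K O) (h r R : ℕ) (hV : h < Module.finrank K V)
    (hVδ : ∀ f ∈ V, f ≠ 0 → δ (Ideal.span {f}) ≤ h + r)
    (hfin : {I | I ≠ ⊥ ∧ δ I ≤ r}.Finite) (hR : {I | I ≠ ⊥ ∧ δ I ≤ r}.ncard ≤ R)
    (T : Finset ι) :
    ∃ W : Submodule K (ι → K),
      (∀ w ∈ W, w ≠ 0 → (Finset.univ.filter fun i => w i = 0).card ≤ h) ∧
      T.card.choose h ≤ R * {w | w ∈ W ∧ (T.filter fun i => w i = 0).card = h}.ncard := by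
  classical
  have h1 : δ ⊤ = 0 := by
    have := hmul ⊤ ⊤ top_ne_bot top_ne_bot
    rw [Ideal.mul_top] at this; omega
  have hprod : ∀ s : Finset ι, ∏ i ∈ s, P i ≠ ⊥ ∧ δ (∏ i ∈ s, P i) = s.card := by
    intro s
    induction s using Finset.induction_on with
    | empty => simpa using h1
    | insert a s ha ih =>
      rw [Finset.prod_insert ha]
      refine ⟨mul_ne_zero (hP0 a) ih.1, ?_⟩
      rw [hmul _ _ (hP0 a) ih.1, hP1, ih.2, Finset.card_insert_of_notMem ha, add_comm]
  have hprodvd : ∀ (s : Finset ι) (J : Ideal O), (∀ i ∈ s, P i ∣ J) → ∏ i ∈ s, P i ∣ J := by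
    intro s J hJ
    refine Finset.prod_dvd_of_coprime ?_ hJ
    intro i _ k _ hik
    have hi := (hP i).isMaximal (hP0 i)
    have hk := (hP k).isMaximal (hP0 k)
    exact Ideal.isCoprime_of_isMaximal fun e => hik (hPinj e)
  -- the evaluation code of a nonzero ideal
  have key : ∀ I : Ideal O, I ≠ ⊥ → ∃ W : Submodule K (ι → K),
      (∀ w ∈ W, w ≠ 0 → (Finset.univ.filter fun i => w i = 0).card ≤ h) ∧
      ∀ f ∈ I, f ≠ 0 → δ (Ideal.span {f}) ≤ δ I + h → ∃ w ∈ W, (∀ i, w i = 0 ↔ f ∈ P i * I) ∧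
        (Finset.univ.filter fun i => w i = 0).card ≤ h := by
    intro I hI
    choose φ hφ using fun i => exists_linearMap_ker_eq_mul (K := K) (hP i) (hP0 i) hI (hres i)
    let W0 : Submodule K ↥(I.restrictScalars K) :=
      { carrier := {f | (f : O) ≠ 0 → δ (Ideal.span {(f : O)}) ≤ δ I + h}
        zero_mem' := fun h => absurd rfl h
        add_mem' := by
          intro f g hf hg hfg
          by_cases hf0 : (f : O) = 0
          · have : ((f + g : ↥(I.restrictScalars K)) : O) = g := by simp [hf0]
            rw [this] at hfg ⊢
            exact hg hfg
          by_cases hg0 : (g : O) = 0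
          · have : ((f + g : ↥(I.restrictScalars K)) : O) = f := by simp [hg0]
            rw [this] at hfg ⊢
            exact hf hfg
          exact (hadd f g hf0 hg0 hfg).trans (max_le (hf hf0) (hg hg0))
        smul_mem' := by
          intro c f hf hcf
          have hc : c ≠ 0 := by rintro rfl; simp at hcf
          have hf0 : (f : O) ≠ 0 := by
            intro h; apply hcf; simp [h]
          have hu : IsUnit (algebraMap K O c) := (IsUnit.mk0 c hc).map _
          have : Ideal.span {((c • f : ↥(I.restrictScalars K)) : O)} = Ideal.span {(f : O)} := by
            rw [Submodule.coe_smul, Algebra.smul_def]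
            exact Ideal.span_singleton_mul_left_unit hu _
          rw [this]
          exact hf hf0 }
    have hzeros : ∀ f ∈ W0, f ≠ 0 → (Finset.univ.filter fun i => φ i f = 0).card ≤ h := by
      intro f hf hf0
      have hf0' : (f : O) ≠ 0 := fun h => hf0 (Subtype.ext h)
      obtain ⟨J, hJ⟩ : I ∣ Ideal.span {(f : O)} :=
        Ideal.dvd_iff_le.2 ((Ideal.span_singleton_le_iff_mem _).2 f.2)
      have hJ0 : J ≠ ⊥ := by
        rintro rfl
        rw [Ideal.mul_bot, Ideal.span_singleton_eq_bot] at hJ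
        exact hf0' hJ
      obtain ⟨L, hL⟩ := hprodvd (Finset.univ.filter fun i => φ i f = 0) J (by
        intro i hi
        have := (hφ i f).1 (Finset.mem_filter.1 hi).2
        have : I * P i ∣ I * J := by
          rw [← hJ, Ideal.dvd_iff_le, mul_comm]
          exact (Ideal.span_singleton_le_iff_mem _).2 this
        exact (mul_dvd_mul_iff_left hI).1 this)
      have hL0 : L ≠ ⊥ := by rintro rfl; rw [Ideal.mul_bot] at hL; exact hJ0 hL
      have h2 := hf hf0'
      rw [hJ, hmul _ _ hI hJ0, hL, hmul _ _ (hprod _).1 hL0, (hprod _).2] at h2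
      omega
    refine ⟨W0.map (LinearMap.pi φ), ?_, ?_⟩
    · rintro _ ⟨f, hf, rfl⟩ hw
      exact hzeros f hf (by rintro rfl; exact hw (map_zero _))
    · intro f hfI hf0 hδ
      refine ⟨LinearMap.pi φ ⟨f, hfI⟩, ⟨⟨f, hfI⟩, fun _ => hδ, rfl⟩, fun i => hφ i ⟨f, hfI⟩,
        hzeros ⟨f, hfI⟩ (fun _ => hδ) (fun h => hf0 (congrArg Subtype.val h))⟩
  -- functions vanishing on a prescribed set
  have hvan : ∀ H : Finset ι, H.card = h → ∃ (f : O) (I : Ideal O), f ≠ 0 ∧ I ≠ ⊥ ∧ δ I ≤ r ∧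
      Ideal.span {f} = (∏ i ∈ H, P i) * I := by
    intro H hH
    have hbot : (1 : Ideal O) ≠ ⊥ := one_ne_zero
    choose φ hφ using fun i => exists_linearMap_ker_eq_mul (K := K) (hP i) (hP0 i) hbot (hres i)
    let L : V →ₗ[K] (H → K) := LinearMap.pi fun i =>
      (φ i).comp (LinearMap.codRestrict _ V.subtype fun f => by simp)
    have hker : LinearMap.ker L ≠ ⊥ := by
      intro hker
      have := LinearMap.finrank_le_finrank_of_injective (LinearMap.ker_eq_bot.1 hker)
      rw [Module.finrank_fintype_fun_eq_card, Fintype.card_coe] at this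
      omega
    obtain ⟨⟨f, hfV⟩, hf, hf0⟩ := (Submodule.ne_bot_iff _).1 hker
    have hf0' : f ≠ 0 := fun e => hf0 (Subtype.ext e)
    obtain ⟨I, hI⟩ := hprodvd H (Ideal.span {f}) (by
      intro i hi
      have h2 := congrFun (LinearMap.mem_ker.1 hf) ⟨i, hi⟩
      have h3 := (hφ i _).1 h2
      rw [mul_one] at h3
      exact Ideal.dvd_iff_le.2 ((Ideal.span_singleton_le_iff_mem _).2 h3))
    have hI0 : I ≠ ⊥ := by
      rintro rfl
      rw [Ideal.mul_bot, Ideal.span_singleton_eq_bot] at hI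
      exact hf0' hI
    refine ⟨f, I, hf0', hI0, ?_, hI⟩
    have := hVδ f hfV hf0'
    rw [hI, hmul _ _ (hprod _).1 hI0, (hprod _).2, hH] at this
    omega
  choose! f I hf0 hI0 hIr hfI using hvan
  choose! W hW1 hW2 using key
  set S := T.powersetCard h with hS
  have hmemS : ∀ H ∈ S, H ⊆ T ∧ H.card = h := fun H hH => Finset.mem_powersetCard.1 hH
  have hfib : ∀ J : Ideal O, J ≠ ⊥ → (S.filter fun H => I H = J).card ≤
      {w | w ∈ W J ∧ (T.filter fun i => w i = 0).card = h}.ncard := by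
    intro J hJ
    have hex : ∀ H ∈ S.filter (fun H => I H = J), ∃ w ∈ W J,
        Finset.univ.filter (fun i => w i = 0) = H := by
      intro H hH
      obtain ⟨hHS, hHJ⟩ := Finset.mem_filter.1 hH
      obtain ⟨hHT, hHh⟩ := hmemS H hHS
      have hspan := hfI H hHh
      rw [hHJ] at hspan
      have hmem : f H ∈ J := (Ideal.span_singleton_le_iff_mem _).1
        (Ideal.dvd_iff_le.1 ⟨_, by rw [hspan, mul_comm]⟩)
      obtain ⟨w, hw, hwz, hwh⟩ := hW2 J hJ (f H) hmem (hf0 H hHh) (by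
        rw [hspan, hmul _ _ (hprod _).1 hJ, (hprod _).2, hHh, add_comm])
      refine ⟨w, hw, (Finset.eq_of_subset_of_card_le ?_ (hwh.trans_eq hHh.symm)).symm⟩
      intro i hi
      rw [Finset.mem_filter, hwz]
      refine ⟨Finset.mem_univ _, (Ideal.span_singleton_le_iff_mem _).1 ?_⟩
      rw [hspan, ← Ideal.dvd_iff_le]
      exact mul_dvd_mul_right (Finset.dvd_prod_of_mem P hi) J
    choose! w hw hwz using hex
    rw [← Set.ncard_coe_finset]
    refine Set.ncard_le_ncard_of_injOn w ?_ ?_ (Set.toFinite _)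
    · intro H hH
      refine ⟨hw H hH, ?_⟩
      obtain ⟨hHT, hHh⟩ := hmemS H (Finset.mem_filter.1 hH).1
      have h3 := hwz H hH
      have : T.filter (fun i => w H i = 0) = H := by
        ext i
        rw [Finset.mem_filter]
        constructor
        · intro hi; rw [← h3, Finset.mem_filter]; exact ⟨Finset.mem_univ _, hi.2⟩
        · intro hi
          refine ⟨hHT hi, ?_⟩
          rw [← h3, Finset.mem_filter] at hi
          exact hi.2
      rw [this, hHh]
    · intro H hH H' hH' he
      rw [← hwz H hH, ← hwz H' hH', he]
  rcases S.eq_empty_or_nonempty with hSe | hSne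
  · refine ⟨⊥, fun w hw hw0 => absurd ((Submodule.mem_bot K).1 hw) hw0, ?_⟩
    have := congrArg Finset.card hSe
    rw [hS, Finset.card_powersetCard, Finset.card_empty] at this
    rw [this]; exact Nat.zero_le _
  · obtain ⟨H0, hH0, hmax⟩ := Finset.exists_max_image S
      (fun H => (S.filter fun H' => I H' = I H).card) hSne
    have hJ := hI0 H0 (hmemS _ hH0).2
    refine ⟨W (I H0), hW1 _ hJ, ?_⟩
    have h4 := Finset.card_le_mul_card_image (f := I) S
      (S.filter fun H' => I H' = I H0).card (by
        intro J hJ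
        obtain ⟨H, hH, rfl⟩ := Finset.mem_image.1 hJ
        exact hmax H hH)
    rw [hS, Finset.card_powersetCard, ← hS, mul_comm] at h4
    refine h4.trans (Nat.mul_le_mul ?_ (hfib _ hJ))
    refine le_trans ?_ hR
    rw [← Set.ncard_coe_finset]
    refine Set.ncard_le_ncard ?_ hfin
    intro J hJ
    obtain ⟨H, hH, rfl⟩ := Finset.mem_image.1 (Finset.mem_coe.1 hJ)
    exact ⟨hI0 _ (hmemS _ hH).2, hIr _ (hmemS _ hH).2⟩

open Polynomial in
/-- The degree of an ideal of a finite torsion-free extension of `F[X]`, that is, the dimension of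
the quotient: the degree of a generator of the relative norm. -/
noncomputable def idealDegree (F : Type*) [Field F] {O : Type*} [CommRing O] [IsDedekindDomain O]
    [Algebra F[X] O] [Module.Finite F[X] O] [Module.IsTorsionFree F[X] O] (I : Ideal O) : ℕ :=
  (Submodule.IsPrincipal.generator (Ideal.relNorm F[X] I)).natDegree

section IdealDegree

open Polynomial

variable {F : Type*} [Field F] {O : Type*} [CommRing O] [IsDedekindDomain O]
    [Algebra F[X] O] [Module.Finite F[X] O] [Module.IsTorsionFree F[X] O]

theorem idealDegree_eq_natDegree {I : Ideal O} {a : F[X]}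
    (h : Ideal.relNorm F[X] I = Ideal.span {a}) : idealDegree F I = a.natDegree := by
  have h1 : Associated (Submodule.IsPrincipal.generator (Ideal.relNorm F[X] I)) a := by
    rw [← Ideal.span_singleton_eq_span_singleton, ← h]
    exact Ideal.span_singleton_generator _
  exact natDegree_eq_natDegree (degree_eq_degree_of_associated h1)

theorem exists_relNorm_eq_span (I : Ideal O) :
    ∃ a : F[X], Ideal.relNorm F[X] I = Ideal.span {a} :=
  ⟨_, (Ideal.span_singleton_generator (Ideal.relNorm F[X] I)).symm⟩

theorem idealDegree_mul (I J : Ideal O) (hI : I ≠ ⊥) (hJ : J ≠ ⊥) :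
    idealDegree F (I * J) = idealDegree F I + idealDegree F J := by
  obtain ⟨a, ha⟩ := exists_relNorm_eq_span (F := F) I
  obtain ⟨b, hb⟩ := exists_relNorm_eq_span (F := F) J
  have ha0 : a ≠ 0 := by
    rintro rfl
    rw [Ideal.span_singleton_eq_bot.2 rfl, Ideal.relNorm_eq_bot_iff] at ha
    exact hI ha
  have hb0 : b ≠ 0 := by
    rintro rfl
    rw [Ideal.span_singleton_eq_bot.2 rfl, Ideal.relNorm_eq_bot_iff] at hb
    exact hJ hb
  rw [idealDegree_eq_natDegree ha, idealDegree_eq_natDegree hb,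
    idealDegree_eq_natDegree (a := a * b) (by
      rw [map_mul, ha, hb, Ideal.span_singleton_mul_span_singleton]), natDegree_mul ha0 hb0]

theorem idealDegree_top : idealDegree F (⊤ : Ideal O) = 0 := by
  rw [idealDegree_eq_natDegree (a := 1) (by rw [Ideal.relNorm_top, Ideal.span_singleton_one]),
    natDegree_one]

theorem idealDegree_span_singleton (f : O) :
    idealDegree F (Ideal.span {f}) = (Algebra.intNorm F[X] O f).natDegree :=
  idealDegree_eq_natDegree (Ideal.relNorm_singleton _ _)

theorem idealDegree_map (g : F[X]) :
    idealDegree F (Ideal.span {algebraMap F[X] O g}) = Module.finrank F[X] O * g.natDegree := by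
  rw [idealDegree_eq_natDegree (a := g ^ Module.finrank F[X] O), natDegree_pow]
  rw [← Set.image_singleton, ← Ideal.map_span, Ideal.relNorm_algebraMap,
    Ideal.span_singleton_pow]

/-- The monic generator of the contraction of an ideal. -/
noncomputable def underGen (F : Type*) [Field F] {O : Type*} [CommRing O] [Algebra F[X] O]
    (I : Ideal O) : F[X] :=
  Submodule.IsPrincipal.generator (I.comap (algebraMap F[X] O)) *
    C (Submodule.IsPrincipal.generator (I.comap (algebraMap F[X] O))).leadingCoeff⁻¹

omit [IsDedekindDomain O] [Module.Finite F[X] O] [Module.IsTorsionFree F[X] O] in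
theorem span_underGen (I : Ideal O) :
    Ideal.span {underGen F I} = I.comap (algebraMap F[X] O) := by
  rw [underGen]
  set g := Submodule.IsPrincipal.generator (I.comap (algebraMap F[X] O)) with hg
  have hgs : Ideal.span {g} = I.comap (algebraMap F[X] O) := Ideal.span_singleton_generator _
  by_cases h0 : g = 0
  · rw [← hgs, h0, zero_mul]
  · rw [Ideal.span_singleton_mul_right_unit, hgs]
    exact isUnit_C.2 (inv_ne_zero (leadingCoeff_ne_zero.2 h0)).isUnit

theorem natDegree_underGen_le {I : Ideal O} (hI : I ≠ ⊥) :
    (underGen F I).natDegree ≤ idealDegree F I := by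
  obtain ⟨a, ha⟩ := exists_relNorm_eq_span (F := F) I
  rw [idealDegree_eq_natDegree ha]
  have h := Ideal.relNorm_le_comap F[X] I
  rw [ha, ← span_underGen, Ideal.span_singleton_le_span_singleton] at h
  refine natDegree_le_of_dvd h ?_
  rintro rfl
  rw [Ideal.span_singleton_eq_bot.2 rfl, Ideal.relNorm_eq_bot_iff] at ha
  exact hI ha

theorem underGen_ne_zero {I : Ideal O} (hI : I ≠ ⊥) : underGen F I ≠ 0 := by
  intro h0
  have h := Ideal.relNorm_le_comap F[X] I
  rw [← span_underGen, h0, Ideal.span_singleton_eq_bot.2 rfl, le_bot_iff,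
    Ideal.relNorm_eq_bot_iff] at h
  exact hI h

theorem underGen_monic {I : Ideal O} (hI : I ≠ ⊥) : (underGen F I).Monic :=
  monic_mul_leadingCoeff_inv fun h => underGen_ne_zero (F := F) hI (by rw [underGen, h, zero_mul])

theorem underGen_prime {P : Ideal O} (hP : P.IsPrime) (hP0 : P ≠ ⊥) :
    Prime (underGen F P) := by
  rw [← Ideal.span_singleton_prime (underGen_ne_zero hP0), span_underGen]
  exact hP.comap _

theorem one_le_idealDegree {P : Ideal O} (hP : P.IsPrime) (hP0 : P ≠ ⊥) :
    1 ≤ idealDegree F P :=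
  le_trans (underGen_prime (F := F) hP hP0).irreducible.natDegree_pos (natDegree_underGen_le hP0)

theorem idealDegree_prod {ι : Type*} (s : Finset ι) (I : ι → Ideal O) (h : ∀ i ∈ s, I i ≠ ⊥) :
    idealDegree F (∏ i ∈ s, I i) = ∑ i ∈ s, idealDegree F (I i) := by
  classical
  induction s using Finset.induction_on with
  | empty => simpa using idealDegree_top
  | insert a s ha ih =>
    have h2 : ∏ i ∈ s, I i ≠ ⊥ :=
      Finset.prod_ne_zero_iff.2 fun i hi => h i (Finset.mem_insert_of_mem hi)
    rw [Finset.prod_insert ha, Finset.sum_insert ha,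
      idealDegree_mul _ _ (h a (Finset.mem_insert_self _ _)) h2,
      ih fun i hi => h i (Finset.mem_insert_of_mem hi)]

theorem idealDegree_multiset_prod (s : Multiset (Ideal O)) (h : ∀ I ∈ s, I ≠ ⊥) :
    idealDegree F s.prod = (s.map (idealDegree F)).sum := by
  induction s using Multiset.induction_on with
  | empty => simpa using idealDegree_top
  | cons a s ih =>
    have h2 : s.prod ≠ ⊥ :=
      Multiset.prod_ne_zero fun h0 => h _ (Multiset.mem_cons_of_mem h0) rfl
    rw [Multiset.prod_cons, Multiset.map_cons, Multiset.sum_cons,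
      idealDegree_mul _ _ (h a (Multiset.mem_cons_self _ _)) h2,
      ih fun I hI => h I (Multiset.mem_cons_of_mem hI)]

theorem prod_primes_dvd_of_dvd (s : Finset (Ideal O)) (hs : ∀ P ∈ s, P.IsPrime ∧ P ≠ ⊥)
    {J : Ideal O} (h : ∀ P ∈ s, P ∣ J) : ∏ P ∈ s, P ∣ J := by
  refine Finset.prod_dvd_of_coprime ?_ h
  intro P hP Q hQ hPQ
  have hi := (hs P hP).1.isMaximal (hs P hP).2
  have hk := (hs Q hQ).1.isMaximal (hs Q hQ).2
  exact Ideal.isCoprime_of_isMaximal hPQ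

/-- At most `[O : F[X]]` primes lie above a given one. -/
theorem card_primes_underGen_eq_le (π : F[X]) (s : Finset (Ideal O))
    (hs : ∀ P ∈ s, (P.IsPrime ∧ P ≠ ⊥) ∧ underGen F P = π) :
    s.card ≤ Module.finrank F[X] O := by
  rcases s.eq_empty_or_nonempty with rfl | ⟨P0, hP0⟩
  · simp
  have hπ : 0 < π.natDegree := by
    rw [← (hs P0 hP0).2]
    exact (underGen_prime (hs P0 hP0).1.1 (hs P0 hP0).1.2).irreducible.natDegree_pos
  have hπ0 : π ≠ 0 := by rintro rfl; simp at hπ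
  obtain ⟨J, hJ⟩ := prod_primes_dvd_of_dvd s (fun P hP => (hs P hP).1)
    (J := Ideal.span {algebraMap F[X] O π}) (by
      intro P hP
      rw [Ideal.dvd_iff_le, Ideal.span_singleton_le_iff_mem, ← Ideal.mem_comap,
        ← span_underGen, (hs P hP).2]
      exact Ideal.mem_span_singleton_self _)
  have hne : Ideal.span {algebraMap F[X] O π} ≠ ⊥ := by
    rw [Ne, Ideal.span_singleton_eq_bot]
    exact fun h => hπ0 (FaithfulSMul.algebraMap_injective F[X] O (by rw [h, map_zero]))
  have h1 : ∏ P ∈ s, P ≠ ⊥ := by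
    intro h; rw [h, Ideal.bot_mul] at hJ; exact hne hJ
  have h2 : J ≠ ⊥ := by
    intro h; rw [h, Ideal.mul_bot] at hJ; exact hne hJ
  have h3 := idealDegree_map (F := F) (O := O) π
  rw [hJ, idealDegree_mul _ _ h1 h2, idealDegree_prod _ _ fun P hP => (hs P hP).1.2] at h3
  have h4 : s.card * π.natDegree ≤ ∑ P ∈ s, idealDegree F P := by
    rw [← smul_eq_mul]
    refine Finset.card_nsmul_le_sum _ _ _ fun P hP => ?_
    rw [← (hs P hP).2]
    exact natDegree_underGen_le (hs P hP).1.2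
  exact Nat.le_of_mul_le_mul_right (by omega) hπ

theorem exists_index_injOn (hm : 0 < Module.finrank F[X] O) :
    ∃ idx : Ideal O → Fin (Module.finrank F[X] O), ∀ P Q : Ideal O, (P.IsPrime ∧ P ≠ ⊥) →
      (Q.IsPrime ∧ Q ≠ ⊥) → underGen F P = underGen F Q → idx P = idx Q → P = Q := by
  classical
  have : ∀ π : F[X], ∃ f : Ideal O → Fin (Module.finrank F[X] O),
      Set.InjOn f {P | (P.IsPrime ∧ P ≠ ⊥) ∧ underGen F P = π} := by
    intro π
    set A := {P : Ideal O | (P.IsPrime ∧ P ≠ ⊥) ∧ underGen F P = π}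
    have hfin : A.Finite := by
      by_contra hinf
      obtain ⟨t, ht, htc⟩ := Set.Infinite.exists_subset_card_eq hinf (Module.finrank F[X] O + 1)
      have := card_primes_underGen_eq_le π t fun P hP => ht hP
      omega
    have hcard : Fintype.card hfin.toFinset
        ≤ Fintype.card (Fin (Module.finrank F[X] O)) := by
      rw [Fintype.card_coe, Fintype.card_fin]
      exact card_primes_underGen_eq_le π _ fun P hP => hfin.mem_toFinset.1 hP
    obtain ⟨f⟩ := Function.Embedding.nonempty_of_card_le hcard
    refine ⟨fun P => if hP : P ∈ hfin.toFinset then f ⟨P, hP⟩ else ⟨0, hm⟩, ?_⟩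
    intro P hP Q hQ he
    have hP' := hfin.mem_toFinset.2 hP
    have hQ' := hfin.mem_toFinset.2 hQ
    simp only [dif_pos hP', dif_pos hQ'] at he
    exact congrArg Subtype.val (f.injective he)
  choose f hf using this
  refine ⟨fun P => f (underGen F P) P, fun P Q hP hQ h1 h2 => ?_⟩
  simp only [← h1] at h2
  exact hf (underGen F P) ⟨hP, rfl⟩ ⟨hQ, h1.symm⟩ h2

theorem exists_finset_monic_tuples [Fintype F] (m : ℕ) : ∀ r : ℕ, ∃ S : Finset (Fin m → F[X]),
    S.card ≤ Fintype.card F ^ r * 2 ^ (m + r) ∧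
    ∀ g : Fin m → F[X], (∀ i, (g i).Monic) → ∑ i, (g i).natDegree ≤ r → g ∈ S := by
  classical
  have hmonic : ∀ d : ℕ, ∃ S : Finset F[X], S.card ≤ Fintype.card F ^ d ∧
      ∀ g : F[X], g.Monic → g.natDegree = d → g ∈ S := by
    intro d
    refine ⟨(Finset.univ : Finset (Fin d → F)).image fun c => X ^ d + ∑ i : Fin d, C (c i) * X ^ (i : ℕ),
      Finset.card_image_le.trans (by simp), ?_⟩
    intro g hg hd
    refine Finset.mem_image.2 ⟨fun i => g.coeff i, Finset.mem_univ _, ?_⟩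
    conv_rhs => rw [hg.as_sum, hd]
    rw [Finset.sum_range]
  induction m with
  | zero =>
    intro r
    refine ⟨Finset.univ, ?_, fun _ _ _ => Finset.mem_univ _⟩
    rw [Finset.card_univ, Fintype.card_unique]
    exact Nat.one_le_iff_ne_zero.2 (by positivity)
  | succ m ih =>
    intro r
    choose M hM1 hM2 using hmonic
    choose S hS1 hS2 using ih
    refine ⟨(Finset.range (r + 1)).biUnion fun d =>
      Finset.image₂ (fun a g => (Fin.cons a g : Fin (m + 1) → F[X])) (M d) (S (r - d)), ?_, ?_⟩
    · refine Finset.card_biUnion_le.trans ?_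
      calc ∑ d ∈ Finset.range (r + 1), _ ≤ ∑ d ∈ Finset.range (r + 1),
            Fintype.card F ^ r * 2 ^ m * 2 ^ (r - d) := by
            refine Finset.sum_le_sum fun d hd => ?_
            have hdr : d ≤ r := Nat.lt_succ_iff.1 (Finset.mem_range.1 hd)
            refine (Finset.card_image₂_le _ _ _).trans ((Nat.mul_le_mul (hM1 d) (hS1 _)).trans_eq ?_)
            have : Fintype.card F ^ r = Fintype.card F ^ d * Fintype.card F ^ (r - d) := by
              rw [← pow_add, Nat.add_sub_cancel' hdr]
            rw [this, pow_add]; ring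
        _ = Fintype.card F ^ r * 2 ^ m * ∑ d ∈ Finset.range (r + 1), 2 ^ d := by
            rw [← Finset.mul_sum]
            congr 1
            have := Finset.sum_range_reflect (fun d => 2 ^ d) (r + 1)
            rw [← this]
            refine Finset.sum_congr rfl fun d _ => ?_
            congr 1
        _ ≤ Fintype.card F ^ r * 2 ^ m * 2 ^ (r + 1) := by
            gcongr
            rw [Nat.geomSum_eq (le_refl 2)]
            simp
        _ = _ := by ring
    · intro g hg hsum
      rw [Fin.sum_univ_succ] at hsum
      refine Finset.mem_biUnion.2 ⟨(g 0).natDegree, Finset.mem_range.2 (by omega), ?_⟩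
      refine Finset.mem_image₂.2 ⟨g 0, hM2 _ _ (hg 0) rfl, Fin.tail g,
        hS2 _ _ (fun i => hg i.succ) ?_, Fin.cons_self_tail g⟩
      simp only [Fin.tail]
      omega

/-- The number of ideals of bounded degree. -/
theorem card_ideals_idealDegree_le [Fintype F] (r : ℕ) :
    {I : Ideal O | I ≠ ⊥ ∧ idealDegree F I ≤ r}.Finite ∧
    {I : Ideal O | I ≠ ⊥ ∧ idealDegree F I ≤ r}.ncard ≤
      Fintype.card F ^ r * 2 ^ (Module.finrank F[X] O + r) := by
  classical
  have hm : 0 < Module.finrank F[X] O := Module.finrank_pos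
  obtain ⟨idx, hidx⟩ := exists_index_injOn (F := F) (O := O) hm
  obtain ⟨S, hS1, hS2⟩ := exists_finset_monic_tuples (F := F) (Module.finrank F[X] O) r
  let fac : Ideal O → Multiset (Ideal O) := UniqueFactorizationMonoid.normalizedFactors
  have hfac : ∀ I P, P ∈ fac I → P.IsPrime ∧ P ≠ ⊥ := by
    intro I P hP
    have h := UniqueFactorizationMonoid.prime_of_normalized_factor P hP
    exact ⟨Ideal.isPrime_of_prime h, h.ne_zero⟩
  let Φ : Ideal O → Fin (Module.finrank F[X] O) → F[X] := fun I i =>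
    (((fac I).filter fun P => idx P = i).map (underGen F)).prod
  have hmonic : ∀ I i, (Φ I i).Monic := fun I i =>
    monic_multiset_prod_of_monic _ _ fun P hP =>
      underGen_monic (hfac I P (Multiset.mem_of_mem_filter hP)).2
  have hdeg : ∀ I, I ≠ ⊥ → ∑ i, (Φ I i).natDegree ≤ idealDegree F I := by
    intro I hI
    have h1 : ∀ i, (Φ I i).natDegree
        = (((fac I).filter fun P => idx P = i).map fun P => (underGen F P).natDegree).sum := by
      intro i
      rw [natDegree_multiset_prod_of_monic, Multiset.map_map]
      · rfl
      · intro f hf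
        obtain ⟨P, hP, rfl⟩ := Multiset.mem_map.1 hf
        exact underGen_monic (hfac I P (Multiset.mem_of_mem_filter hP)).2
    have h2 : ∀ s : Multiset (Ideal O), ∑ i, ((s.filter fun P => idx P = i).map
        fun P => (underGen F P).natDegree).sum = (s.map fun P => (underGen F P).natDegree).sum := by
      intro s
      induction s using Multiset.induction_on with
      | empty => simp
      | cons a s ih =>
        simp only [Multiset.filter_cons, Multiset.map_add, Multiset.sum_add,
          Finset.sum_add_distrib, ih, Multiset.map_cons, Multiset.sum_cons]
        congr 1
        rw [Finset.sum_eq_single (idx a)]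
        · simp
        · intro b _ hb
          rw [if_neg (Ne.symm hb)]; simp
        · simp
    rw [Finset.sum_congr rfl fun i _ => h1 i, h2]
    have h3 : I = (fac I).prod := (Ideal.prod_normalizedFactors_eq_self hI).symm
    conv_rhs => rw [h3]
    rw [idealDegree_multiset_prod _ fun P hP => (hfac I P hP).2]
    exact Multiset.sum_map_le_sum_map _ _ fun P hP => natDegree_underGen_le (hfac I P hP).2
  have hnf : ∀ I i, UniqueFactorizationMonoid.normalizedFactors (Φ I i)
      = ((fac I).filter fun P => idx P = i).map (underGen F) := by
    intro I i
    rw [UniqueFactorizationMonoid.normalizedFactors_prod_eq]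
    · rw [Multiset.map_map]
      refine Multiset.map_congr rfl fun P hP => ?_
      have := hfac I P (Multiset.mem_of_mem_filter hP)
      exact (underGen_monic this.2).normalize_eq_self
    · intro f hf
      obtain ⟨P, hP, rfl⟩ := Multiset.mem_map.1 hf
      have := hfac I P (Multiset.mem_of_mem_filter hP)
      exact (underGen_prime this.1 this.2).irreducible
  have hcount : ∀ I P, P.IsPrime ∧ P ≠ ⊥ → (fac I).count P =
      (UniqueFactorizationMonoid.normalizedFactors (Φ I (idx P))).count (underGen F P) := by
    intro I P hP
    rw [hnf]
    by_cases hmem : P ∈ (fac I).filter fun Q => idx Q = idx P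
    · rw [Multiset.count_map_eq_count _ _ _ _ hmem, Multiset.count_filter_of_pos (p := fun Q => idx Q = idx P) rfl]
      intro Q hQ Q' hQ' he
      obtain ⟨h1, h2⟩ := Multiset.mem_filter.1 hQ
      obtain ⟨h3, h4⟩ := Multiset.mem_filter.1 hQ'
      exact hidx _ _ (hfac I _ h1) (hfac I _ h3) he (h2.trans h4.symm)
    · have h1 : P ∉ fac I := fun h => hmem (Multiset.mem_filter.2 ⟨h, rfl⟩)
      rw [Multiset.count_eq_zero_of_notMem h1, eq_comm, Multiset.count_eq_zero]
      intro h
      obtain ⟨Q, hQ, he⟩ := Multiset.mem_map.1 h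
      obtain ⟨h2, h3⟩ := Multiset.mem_filter.1 hQ
      rw [hidx _ _ (hfac I _ h2) hP he h3] at h2
      exact h1 h2
  have hinj : Set.InjOn Φ {I : Ideal O | I ≠ ⊥ ∧ idealDegree F I ≤ r} := by
    intro I hI J hJ he
    have : fac I = fac J := by
      ext P
      by_cases hP : P.IsPrime ∧ P ≠ ⊥
      · rw [hcount I P hP, hcount J P hP, he]
      · rw [Multiset.count_eq_zero_of_notMem fun h => hP (hfac _ _ h),
          Multiset.count_eq_zero_of_notMem fun h => hP (hfac _ _ h)]
    have h1 : (fac I).prod = I := Ideal.prod_normalizedFactors_eq_self hI.1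
    rw [← h1, this]
    exact Ideal.prod_normalizedFactors_eq_self hJ.1
  have hmaps : Set.MapsTo Φ {I : Ideal O | I ≠ ⊥ ∧ idealDegree F I ≤ r} S := fun I hI =>
    hS2 _ (hmonic I) ((hdeg I hI.1).trans hI.2)
  refine ⟨Set.Finite.of_injOn hmaps hinj S.finite_toSet, le_trans ?_ hS1⟩
  rw [← Set.ncard_coe_finset]
  exact Set.ncard_le_ncard_of_injOn Φ hmaps hinj S.finite_toSet

end IdealDegree

/-- A sequence of nonzero elements following the recursion `y ^ p + y = x ^ p / (x ^ (p - 1) + 1)`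
of the Garcia–Stichtenoth tower. -/
structure IsTower {Ω : Type*} [Field Ω] (p : ℕ) (x : ℕ → Ω) : Prop where
  step : ∀ i, x (i + 1) ^ p + x (i + 1) = x i ^ p / (x i ^ (p - 1) + 1)
  ne_zero : ∀ i, x i ≠ 0
  den_ne_zero : ∀ i, x i ^ (p - 1) + 1 ≠ 0

/-- The product of the powers `y (i + 1) ^ aᵢ`, `i < n`, where `aᵢ` are the base `p` digits
of `k`. -/
def digitMonomial {Ω : Type*} [Monoid Ω] (p : ℕ) (y : ℕ → Ω) : ℕ → ℕ → Ω
  | 0, _ => 1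
  | n + 1, k => digitMonomial p y n (k % p ^ n) * y (n + 1) ^ (k / p ^ n)

section Valuation

variable {Ω Γ : Type*} [Field Ω] [LinearOrderedCommGroupWithZero Γ] (v : Valuation Ω Γ) {p : ℕ}

theorem pow_add_self_eq_mul {R : Type*} [CommRing R] (hp : 1 ≤ p) (y : R) :
    y ^ p + y = y * (y ^ (p - 1) + 1) := by
  obtain ⟨q, rfl⟩ := Nat.exists_eq_add_of_le' hp
  simp only [Nat.add_sub_cancel]; ring

namespace Valuation

theorem map_pow_add_self_of_one_lt (hp : 2 ≤ p) {y : Ω} (hy : 1 < v y) :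
    v (y ^ p + y) = v y ^ p := by
  rw [v.map_add_eq_of_lt_left, map_pow]
  rw [map_pow]
  exact lt_self_pow₀ hy (by omega)

theorem map_pow_add_one_of_one_lt (hp : 2 ≤ p) {y : Ω} (hy : 1 < v y) :
    v (y ^ (p - 1) + 1) = v y ^ (p - 1) := by
  rw [v.map_add_eq_of_lt_left, map_pow]
  rw [map_pow, map_one]
  exact one_lt_pow₀ hy (by omega)

theorem map_div_pow_add_one_of_one_lt (hp : 2 ≤ p) {y : Ω} (hy : 1 < v y) :
    v (y ^ p / (y ^ (p - 1) + 1)) = v y := by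
  have h0 : v y ≠ 0 := (zero_lt_one.trans hy).ne'
  rw [map_div₀, v.map_pow_add_one_of_one_lt hp hy, map_pow, div_eq_iff (pow_ne_zero _ h0),
    ← pow_succ']
  congr 1; omega

theorem map_le_one_of_pow_add_self_le (hp : 2 ≤ p) {y : Ω} (hy : v (y ^ p + y) ≤ 1) :
    v y ≤ 1 := by
  by_contra! h
  rw [v.map_pow_add_self_of_one_lt hp h] at hy
  exact (one_lt_pow₀ h (by omega)).not_ge hy

theorem map_pow_of_one_lt_pow_add_self (hp : 2 ≤ p) {y c : Ω} (hc : 1 < v c)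
    (h : y ^ p + y = c) : v y ^ p = v c ∧ 1 < v y := by
  have hy : 1 < v y := by
    by_contra! hy
    rw [← h] at hc
    refine hc.not_ge (v.map_add_le ?_ hy)
    rw [map_pow]; exact pow_le_one' hy _
  exact ⟨by rw [← h, v.map_pow_add_self_of_one_lt hp hy], hy⟩

theorem map_pow_add_self_of_lt_one (hp : 2 ≤ p) {y : Ω} (hy : v y < 1) :
    v (y ^ p + y) = v y := by
  rcases eq_or_ne y 0 with rfl | h0
  · simp [show p ≠ 0 by omega]
  rw [v.map_add_eq_of_lt_right]
  rw [map_pow]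
  exact pow_lt_self_of_lt_one₀ (by simpa [zero_lt_iff] using h0) hy (by omega)

theorem map_pow_add_one_of_lt_one (hp : 2 ≤ p) {y : Ω} (hy : v y < 1) :
    v (y ^ (p - 1) + 1) = 1 := by
  rw [add_comm, v.map_one_add_of_lt]
  rw [map_pow]; exact pow_lt_one₀ zero_le hy (by omega)

end Valuation

namespace IsTower

variable {v} {x : ℕ → Ω}

theorem map_succ_of_one_lt (hx : IsTower p x) (hp : 2 ≤ p) {i : ℕ} (hi : 1 < v (x i)) :
    v (x (i + 1)) ^ p = v (x i) ∧ 1 < v (x (i + 1)) := by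
  have h := v.map_div_pow_add_one_of_one_lt hp hi
  have := v.map_pow_of_one_lt_pow_add_self hp (by rwa [h]) (hx.step i)
  rwa [h] at this

theorem map_add_of_one_lt (hx : IsTower p x) (hp : 2 ≤ p) {i : ℕ} (hi : 1 < v (x i)) (j : ℕ) :
    v (x (i + j)) ^ p ^ j = v (x i) ∧ 1 < v (x (i + j)) := by
  induction j with
  | zero => simpa using hi
  | succ j ih =>
    have := hx.map_succ_of_one_lt hp ih.2
    exact ⟨by rw [pow_succ', pow_mul, ← add_assoc, this.1, ih.1], this.2⟩

end IsTower

theorem map_digitMonomial_le {y : ℕ → Ω} {u w : ℕ → Γ} (hp : 1 ≤ p) {n : ℕ}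
    (hu : ∀ i < n, 1 ≤ u (i + 1))
    (hw : ∀ i < n, w (i + 1) * u (i + 1) ^ (p - 1) ≤ w i)
    (hy : ∀ i < n, v (y (i + 1)) ≤ u (i + 1)) {k : ℕ} (hk : k < p ^ n) :
    v (digitMonomial p y n k) * w n ≤ w 0 := by
  induction n generalizing k with
  | zero => simp [digitMonomial]
  | succ n ih =>
    have hpn : 0 < p ^ n := by positivity
    have hd : k / p ^ n ≤ p - 1 := by
      have : k / p ^ n < p := Nat.div_lt_of_lt_mul (by rwa [← pow_succ])
      omega
    refine le_trans ?_ (ih (fun i hi => hu i (by omega)) (fun i hi => hw i (by omega))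
      (fun i hi => hy i (by omega)) (Nat.mod_lt k hpn))
    rw [digitMonomial, map_mul, map_pow, mul_assoc]
    refine mul_le_mul_right ?_ _
    refine le_trans ?_ (hw n (by omega))
    rw [mul_comm]
    refine mul_le_mul_right ?_ _
    exact (pow_le_pow_left' (hy n (by omega)) _).trans (pow_le_pow_right₀ (hu n (by omega)) hd)

namespace IsTower

variable {v} {x : ℕ → Ω}

theorem map_digitMonomial_le_of_one_lt (hx : IsTower p x) (hp : 2 ≤ p) (h0 : 1 < v (x 0))
    {n k : ℕ} (hk : k < p ^ n) : v (digitMonomial p x n k) ≤ v (x 0) := by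
  have h := fun j => hx.map_add_of_one_lt hp h0 j
  simp only [zero_add] at h
  have := map_digitMonomial_le v (y := x) (u := fun i => v (x i)) (w := fun i => v (x i))
    (by omega : 1 ≤ p) (fun i _ => (h (i + 1)).2.le) (fun i _ => ?_) (fun i _ => le_rfl) hk
  · exact (le_mul_of_one_le_right' (h n).2.le).trans this
  · rw [← pow_succ', Nat.sub_add_cancel (by omega), (hx.map_succ_of_one_lt hp (h i).2).1]

/-- Behaviour at the places where `x i` specializes to a nonzero root of
`y ^ p + y`. -/
theorem map_succ_of_sub_lt_one [CharP Ω p] [Fact p.Prime]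
    (hx : IsTower p x) (hp : 2 ≤ p) {i : ℕ} {α : Ω}
    (hα : α ^ p + α = 0) (hα1 : v α = 1) (h : v (x i - α) < 1) :
    v (x i) = 1 ∧ v (x i ^ (p - 1) + 1) = v (x i - α) ∧ x i - α ≠ 0 ∧
      v (x (i + 1)) ^ p = (v (x i - α))⁻¹ ∧ 1 < v (x (i + 1)) := by
  have h1 : v (x i) = 1 := by
    have : x i = (x i - α) + α := by ring
    rw [this, v.map_add_eq_of_lt_right, hα1]
    rwa [hα1]
  have h2 : v (x i ^ (p - 1) + 1) = v (x i - α) := by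
    have e : x i ^ p + x i = (x i - α) ^ p + (x i - α) := by
      rw [sub_pow_char]; linear_combination hα
    have := v.map_pow_add_self_of_lt_one hp h
    rw [← e, pow_add_self_eq_mul (by omega), map_mul, h1, one_mul] at this
    exact this
  have h3 : x i - α ≠ 0 := by
    rw [← v.ne_zero_iff, ← h2, v.ne_zero_iff]
    exact hx.den_ne_zero i
  have h4 : v (x i ^ p / (x i ^ (p - 1) + 1)) = (v (x i - α))⁻¹ := by
    rw [map_div₀, map_pow, h1, h2, one_pow, one_div]
  have h5 := v.map_pow_of_one_lt_pow_add_self hp (by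
    rw [h4]; exact (one_lt_inv₀ (by simpa [zero_lt_iff] using h3)).2 h) (hx.step i)
  rw [h4] at h5
  exact ⟨h1, h2, h3, h5⟩

theorem map_digitMonomial_le_of_sub_lt_one [CharP Ω p] [Fact p.Prime]
    (hx : IsTower p x) (hp : 2 ≤ p) {α : Ω}
    (hα : α ^ p + α = 0) (hα1 : v α = 1) (h : v (x 0 - α) < 1) {n k : ℕ} (hk : k < p ^ n) :
    v (digitMonomial p x n k) ≤ (v (x 0 - α))⁻¹ := by
  obtain ⟨-, -, h3, h4, h5⟩ := hx.map_succ_of_sub_lt_one hp hα hα1 h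
  have h6 : ∀ j, v (x (j + 1)) ^ p = (if j = 0 then (v (x 0 - α))⁻¹ else v (x j)) ∧
      1 < v (x (j + 1)) := by
    intro j
    induction j with
    | zero => exact ⟨by simpa using h4, h5⟩
    | succ j ih => simpa using hx.map_succ_of_one_lt hp ih.2
  have := map_digitMonomial_le v (y := x) (u := fun i => v (x i))
    (w := fun i => if i = 0 then (v (x 0 - α))⁻¹ else v (x i))
    (by omega : 1 ≤ p) (fun i _ => (h6 i).2.le) (fun i _ => ?_) (fun i _ => le_rfl) hk
  · refine (le_mul_of_one_le_right' ?_).trans this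
    rcases n with _ | n
    · simpa using (one_le_inv₀ (by simpa [zero_lt_iff] using h3)).2 h.le
    · simpa using (h6 n).2.le
  · rw [← (h6 i).1]
    simp only [Nat.add_eq_zero_iff, one_ne_zero, and_false, if_false]
    rw [← pow_succ', Nat.sub_add_cancel (by omega)]

/-- Nothing happens at the places where `x 0` specializes neither to infinity nor to a root of
`y ^ p + y`. -/
theorem map_eq_one_of_map_eq_one (hx : IsTower p x) (hp : 2 ≤ p) (h0 : v (x 0) = 1)
    (h1 : v (x 0 ^ (p - 1) + 1) = 1) (i : ℕ) :
    v (x i) = 1 ∧ v (x i ^ (p - 1) + 1) = 1 := by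
  induction i with
  | zero => exact ⟨h0, h1⟩
  | succ i ih =>
    have h2 : v (x (i + 1) ^ p + x (i + 1)) = 1 := by
      rw [hx.step, map_div₀, map_pow, ih.1, ih.2]; simp
    have h3 := v.map_le_one_of_pow_add_self_le hp h2.le
    rw [pow_add_self_eq_mul (by omega), map_mul] at h2
    have h4 : v (x (i + 1) ^ (p - 1) + 1) ≤ 1 :=
      v.map_add_le (by rw [map_pow]; exact pow_le_one' h3 _) (by simp)
    have h5 : v (x (i + 1)) = 1 := by
      refine le_antisymm h3 ?_
      rw [← h2]; exact mul_le_of_le_one_right' h4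
    exact ⟨h5, by rwa [h5, one_mul] at h2⟩

theorem map_digitMonomial_le_one (hx : IsTower p x) (hp : 2 ≤ p) (h0 : v (x 0) = 1)
    (h1 : v (x 0 ^ (p - 1) + 1) = 1) {n k : ℕ} (hk : k < p ^ n) :
    v (digitMonomial p x n k) ≤ 1 := by
  simpa using map_digitMonomial_le v (y := x) (u := fun _ => 1) (w := fun _ => 1)
    (by omega : 1 ≤ p) (fun i _ => le_rfl) (fun i _ => by simp)
    (fun i _ => (hx.map_eq_one_of_map_eq_one hp h0 h1 (i + 1)).1.le) hk

/-- The places where `x 0` specializes to zero: as long as the `x i` specialize to zero their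
valuations are powers of that of `x 0`, and if `x t` is the first one that does not, it
specializes to a nonzero root of `y ^ p + y`. -/
theorem exists_pattern [CharP Ω p] [Fact p.Prime] (hx : IsTower p x) (hp : 2 ≤ p)
    {Z : Finset Ω} (hZ : ∀ y : Ω, y ^ p + y = ∏ ω ∈ Z, (y - ω)) (h0 : v (x 0) < 1) (n : ℕ) :
    (∀ i ≤ n, v (x i) = v (x 0) ^ p ^ i) ∨
      ∃ t, 1 ≤ t ∧ t ≤ n ∧ (∀ i < t, v (x i) = v (x 0) ^ p ^ i) ∧
        ∃ α ∈ Z, α ≠ 0 ∧ v (x t - α) = v (x 0) ^ p ^ t := by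
  induction n with
  | zero => left; intro i hi; simp [Nat.le_zero.1 hi]
  | succ n ih =>
    rcases ih with ih | ⟨t, h1, h2, h3⟩
    · have hxn : v (x n) < 1 := by
        rw [ih n le_rfl]; exact pow_lt_one₀ zero_le h0 (by positivity)
      have hs : v (x (n + 1) ^ p + x (n + 1)) = v (x 0) ^ p ^ (n + 1) := by
        rw [hx.step, map_div₀, map_pow, v.map_pow_add_one_of_lt_one hp hxn, div_one,
          ih n le_rfl, ← pow_mul, pow_succ]
      have hs1 : v (x (n + 1) ^ p + x (n + 1)) < 1 := by
        rw [hs]; exact pow_lt_one₀ zero_le h0 (by positivity)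
      obtain ⟨α, hα, hα1⟩ : ∃ α ∈ Z, v (x (n + 1) - α) < 1 := by
        by_contra! hcon
        rw [hZ, map_prod] at hs1
        exact hs1.not_ge (Finset.one_le_prod' hcon)
      have hα2 : α ^ p + α = 0 := by rw [hZ]; exact Finset.prod_eq_zero hα (sub_self α)
      have hs2 : v (x (n + 1) - α) = v (x 0) ^ p ^ (n + 1) := by
        rw [← hs, ← v.map_pow_add_self_of_lt_one hp hα1]
        congr 1
        rw [sub_pow_char]; linear_combination -hα2
      by_cases hα0 : α = 0
      · left; intro i hi
        rcases Nat.lt_or_eq_of_le hi with hi | rfl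
        · exact ih i (by omega)
        · simpa [hα0] using hs2
      · exact Or.inr ⟨n + 1, by omega, le_rfl, fun i hi => ih i (by omega), α, hα, hα0, hs2⟩
    · exact Or.inr ⟨t, h1, by omega, h3⟩

/-- At a place over zero of pattern `t`, the pole of `x (t + j)` is the one of
`α ^ (p + 1) / x (t - j)`. -/
theorem map_sub_div_le_one [CharP Ω p] [Fact p.Prime] (hx : IsTower p x) (hp : 3 ≤ p)
    {t : ℕ} {α : Ω} (hα : α ^ p + α = 0) (hα1 : v α = 1)
    (hsmall : ∀ i < t, v (x i) < 1) (ht : v (x t - α) < 1) {j : ℕ} (hj1 : 1 ≤ j) (hjt : j ≤ t) :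
    v (x (t + j) - α ^ (p + 1) / x (t - j)) ≤ 1 := by
  obtain ⟨hxt, hϖ, hne, -, hpole⟩ := hx.map_succ_of_sub_lt_one (by omega) hα hα1 ht
  have hp2 : 2 ≤ p := by omega
  have hpole' : ∀ j, 1 ≤ j → 1 < v (x (t + j)) := fun j hj => by
    have := (hx.map_add_of_one_lt hp2 hpole (j - 1)).2
    rwa [show t + 1 + (j - 1) = t + j by omega] at this
  set c := α ^ (p + 1) with hc
  have hα' : α ^ p = -α := by linear_combination hα
  have hc2 : c = -α ^ 2 := by rw [hc, pow_succ, hα']; ring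
  have hcp : c ^ p = c := by
    rw [hc, ← pow_mul, mul_comm, pow_mul, hα', neg_pow]
    rcases (Fact.out : p.Prime).eq_two_or_odd' with h | h
    · omega
    · rw [h.add_one.neg_one_pow, one_mul]
  have hvc : v c = 1 := by rw [hc, map_pow, hα1, one_pow]
  have key : ∀ j, j + 1 ≤ t → (x (t + (j + 1)) - c / x (t - (j + 1))) ^ p +
      (x (t + (j + 1)) - c / x (t - (j + 1))) = x (t + j) ^ p / (x (t + j) ^ (p - 1) + 1) -
        c / (x (t - j) ^ p + x (t - j)) := by
    intro j hj
    have h1 := hx.step (t + j)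
    have h2 := hx.step (t - (j + 1))
    rw [show t - (j + 1) + 1 = t - j by omega] at h2
    rw [← add_assoc] at *
    set z := x (t - (j + 1))
    have hz : z ≠ 0 := hx.ne_zero _
    have hz1 : z ^ (p - 1) + 1 ≠ 0 := hx.den_ne_zero _
    rw [sub_pow_char, h2, ← h1, div_pow, hcp]
    have e : c / (z ^ p / (z ^ (p - 1) + 1)) = c / z ^ p + c / z := by
      have : z ^ p = z ^ (p - 1) * z := by rw [← pow_succ]; congr 1; omega
      rw [this]
      field_simp
      ring
    rw [e]; ring
  induction j with
  | zero => omega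
  | succ j ih =>
    refine v.map_le_one_of_pow_add_self_le hp2 ?_
    rw [key j hjt]
    rcases Nat.eq_zero_or_pos j with rfl | hj
    · simp only [add_zero, Nat.sub_zero]
      have hxt0 : x t ≠ 0 := hx.ne_zero t
      have hd : x t ^ (p - 1) + 1 ≠ 0 := hx.den_ne_zero t
      have e : x t ^ p / (x t ^ (p - 1) + 1) - c / (x t ^ p + x t) =
          (x t * (x t - α) ^ p - α * (x t - α)) / (x t * (x t ^ (p - 1) + 1)) := by
        rw [pow_add_self_eq_mul (by omega), sub_pow_char, hα', hc2]
        field_simp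
        ring
      rw [e, map_div₀, map_mul, hxt, one_mul, hϖ]
      refine div_le_one_of_le₀ (v.map_sub_le ?_ ?_) zero_le
      · rw [map_mul, hxt, one_mul, map_pow]
        simpa using pow_le_pow_right_of_le_one' ht.le (show 1 ≤ p by omega)
      · rw [map_mul, hα1, one_mul]
    · set y := x (t + j)
      set z := x (t - j)
      have hy : 1 < v y := hpole' j hj
      have hz : v z < 1 := hsmall _ (by omega)
      have hy0 : y ^ (p - 1) + 1 ≠ 0 := hx.den_ne_zero _
      have hz0 : z ≠ 0 := hx.ne_zero _
      have hz1 : z ^ (p - 1) + 1 ≠ 0 := hx.den_ne_zero _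
      have e : y ^ p / (y ^ (p - 1) + 1) - c / (z ^ p + z) =
          (y - c / z) - y / (y ^ (p - 1) + 1) + c * (z ^ (p - 2) / (z ^ (p - 1) + 1)) := by
        obtain ⟨q, rfl⟩ := Nat.exists_eq_add_of_le' hp2
        simp only [Nat.add_sub_cancel, show q + 2 - 1 = q + 1 by omega] at *
        have : z ^ (q + 2) + z = z * (z ^ (q + 1) + 1) := by ring
        rw [this]
        field_simp
        ring
      rw [e]
      refine v.map_add_le (v.map_sub_le (ih hj (by omega)) ?_) ?_
      · rw [map_div₀, v.map_pow_add_one_of_one_lt hp2 hy]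
        refine div_le_one_of_le₀ ?_ zero_le
        exact le_self_pow₀ hy.le (by omega)
      · rw [map_mul, hvc, one_mul, map_div₀, v.map_pow_add_one_of_lt_one hp2 hz, div_one, map_pow]
        exact pow_le_one' hz.le _

end IsTower

/-- An element of the field generated by `x 0, …, x (i - 1)` which cancels the pole of `x i` at
those places over zero where `x i` has a pole and the monomials in the `x j` are too large. -/
noncomputable def towerShift (p N : ℕ) (x : ℕ → Ω) (i : ℕ) : Ω :=
  ∑ t ∈ (Finset.range i).filter (fun t => i ≤ 2 * t),
    (-(x t ^ 2) / (1 + (x t ^ p + x t))) ^ p ^ N / x (2 * t - i)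

namespace IsTower

theorem map_shift_factor_le [CharP Ω p] [Fact p.Prime] (hp : 3 ≤ p) {y r : Ω} {n : ℕ}
    (hr : v r < 1)
    (h : (∃ i, v y = v r ^ p ^ i) ∨ ∃ t j, j ≤ n ∧ 1 < v y ∧ v y ^ p ^ j = (v r ^ p ^ t)⁻¹) :
    v ((-(y ^ 2) / (1 + (y ^ p + y))) ^ p ^ (2 * n)) ≤ v r ^ p ^ n := by
  have hp1 : 1 ≤ p := by omega
  rw [map_pow, map_div₀, v.map_neg, map_pow]
  rcases h with ⟨i, hi⟩ | ⟨t, j, hj, h1, h2⟩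
  · have hy : v y < 1 := by rw [hi]; exact pow_lt_one₀ zero_le hr (by positivity)
    rw [v.map_one_add_of_lt (by rwa [v.map_pow_add_self_of_lt_one (by omega) hy]), div_one, hi,
      ← pow_mul, ← pow_mul]
    refine pow_le_pow_right_of_le_one' hr.le ?_
    calc p ^ n ≤ p ^ (2 * n) := Nat.pow_le_pow_right hp1 (by omega)
      _ ≤ p ^ i * (2 * p ^ (2 * n)) := by
        rw [← mul_assoc]; exact Nat.le_mul_of_pos_left _ (by positivity)
  · have hy0 : v y ≠ 0 := (zero_lt_one.trans h1).ne'
    have h3 := v.map_pow_add_self_of_one_lt (by omega : 2 ≤ p) h1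
    rw [v.map_add_eq_of_lt_right (by
      rw [h3, map_one]; exact one_lt_pow₀ h1 (by omega)), h3]
    have h4 : v y ^ 2 / v y ^ p ≤ (v y)⁻¹ := by
      rw [div_le_iff₀ (pow_pos (zero_lt_iff.2 hy0) _)]
      obtain ⟨q, rfl⟩ := Nat.exists_eq_add_of_le' hp
      rw [show q + 3 = (q + 2) + 1 by ring, pow_succ' _ (q + 2), inv_mul_cancel_left₀ hy0]
      exact pow_le_pow_right₀ h1.le (by omega)
    refine (pow_le_pow_left' h4 _).trans ?_
    rw [show 2 * n = j + (2 * n - j) by omega, pow_add, pow_mul, inv_pow, h2, inv_inv, ← pow_mul]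
    refine pow_le_pow_right_of_le_one' hr.le ?_
    calc p ^ n ≤ p ^ (2 * n - j) := Nat.pow_le_pow_right hp1 (by omega)
      _ ≤ p ^ t * p ^ (2 * n - j) := Nat.le_mul_of_pos_left _ (by positivity)

theorem map_digitMonomial_shift_le [CharP Ω p] [Fact p.Prime] (hx : IsTower p x) (hp : 3 ≤ p)
    {Z : Finset Ω} (hZ : ∀ y : Ω, y ^ p + y = ∏ ω ∈ Z, (y - ω))
    (hZ1 : ∀ ω ∈ Z, ω ≠ 0 → v ω = 1) (h0 : v (x 0) < 1) {n k : ℕ} (hk : k < p ^ n) :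
    v (digitMonomial p (fun i => x i - towerShift p (2 * n) x i) n k) ≤ (v (x 0))⁻¹ := by
  have hr0 : v (x 0) ≠ 0 := by simpa using hx.ne_zero 0
  have hr1 : 1 ≤ (v (x 0))⁻¹ := (one_le_inv₀ (zero_lt_iff.2 hr0)).2 h0.le
  have hp2 : 2 ≤ p := by omega
  have hterm : ∀ i ≤ n, ∀ t < i,
      ((∃ i, v (x t) = v (x 0) ^ p ^ i) ∨
        ∃ s j, j ≤ n ∧ 1 < v (x t) ∧ v (x t) ^ p ^ j = (v (x 0) ^ p ^ s)⁻¹) →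
      v (x 0) ^ p ^ n ≤ v (x (2 * t - i)) →
      v ((-(x t ^ 2) / (1 + (x t ^ p + x t))) ^ p ^ (2 * n) / x (2 * t - i)) ≤ 1 := by
    intro i hi t ht h h'
    rw [map_div₀]
    exact div_le_one_of_le₀ ((map_shift_factor_le v hp h0 h).trans h') zero_le
  rcases hx.exists_pattern hp2 hZ h0 n with hA | ⟨t, ht1, htn, hA, α, hαZ, hα0, hαt⟩
  · have hsmall : ∀ i ≤ n, v (x i) ≤ 1 := fun i hi => by
      rw [hA i hi]; exact pow_le_one' h0.le _
    have := map_digitMonomial_le v (y := fun i => x i - towerShift p (2 * n) x i)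
      (u := fun _ => 1) (w := fun _ => 1)
      (by omega : 1 ≤ p) (fun i _ => le_rfl) (fun i _ => by simp)
      (fun i hi => v.map_sub_le (hsmall _ (by omega)) (v.map_sum_le fun t ht => ?_)) hk
    · exact (by simpa using this : _ ≤ (1 : Γ)).trans hr1
    · simp only [Finset.mem_filter, Finset.mem_range] at ht
      refine hterm _ (by omega) t ht.1 (Or.inl ⟨t, hA t (by omega)⟩) ?_
      rw [hA (2 * t - (i + 1)) (by omega)]
      exact pow_le_pow_right_of_le_one' h0.le (Nat.pow_le_pow_right (by omega) (by omega))
  have hα : α ^ p + α = 0 := by rw [hZ]; exact Finset.prod_eq_zero hαZ (sub_self α)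
  have hα1 := hZ1 α hαZ hα0
  have hαt1 : v (x t - α) < 1 := by rw [hαt]; exact pow_lt_one₀ zero_le h0 (by positivity)
  have hsmall : ∀ i < t, v (x i) < 1 := fun i hi => by
    rw [hA i hi]; exact pow_lt_one₀ zero_le h0 (by positivity)
  obtain ⟨hxt, hϖ, hne, hpole1, hpole⟩ := hx.map_succ_of_sub_lt_one hp2 hα hα1 hαt1
  have hpoles : ∀ j, 1 ≤ j → v (x (t + j)) ^ p ^ j = (v (x 0) ^ p ^ t)⁻¹ ∧
      1 < v (x (t + j)) := fun j hj => by
    have := hx.map_add_of_one_lt hp2 hpole (j - 1)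
    rw [show t + 1 + (j - 1) = t + j by omega] at this
    refine ⟨?_, this.2⟩
    obtain ⟨j, rfl⟩ := Nat.exists_eq_add_of_le' hj
    rw [pow_succ, pow_mul, Nat.add_sub_cancel] at *
    rw [this.1, hpole1, hαt]
  have hlow : ∀ l ≤ n, v (x 0) ^ p ^ n ≤ v (x l) := fun l hl => by
    have h1 : v (x 0) ^ p ^ n ≤ 1 := pow_le_one' h0.le _
    rcases lt_trichotomy l t with h | rfl | h
    · rw [hA l h]
      exact pow_le_pow_right_of_le_one' h0.le (Nat.pow_le_pow_right (by omega) hl)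
    · rwa [hxt]
    · have := (hpoles (l - t) (by omega)).2
      rw [show t + (l - t) = l by omega] at this
      exact h1.trans this.le
  have hother : ∀ i ≤ n, ∀ s < i, s ≠ t →
      v ((-(x s ^ 2) / (1 + (x s ^ p + x s))) ^ p ^ (2 * n) / x (2 * s - i)) ≤ 1 := by
    intro i hi s hs hst
    refine hterm i hi s hs ?_ (hlow _ (by omega))
    rcases lt_or_gt_of_ne hst with h | h
    · exact Or.inl ⟨s, hA s h⟩
    · have := hpoles (s - t) (by omega)
      rw [show t + (s - t) = s by omega] at this
      exact Or.inr ⟨t, s - t, by omega, this.2, this.1⟩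
  have hone : ∀ i, 1 ≤ i → i ≤ n → i ≤ 2 * t → v (x i - towerShift p (2 * n) x i) ≤ 1 := by
    intro i hi1 hin hit
    rcases Nat.lt_or_ge t i with hti | hti
    · rw [towerShift, ← Finset.add_sum_erase (a := t) _ _ (by simp [hti, hit]), ← sub_sub]
      refine v.map_sub_le ?_ (v.map_sum_le fun s hs => ?_)
      · have h1 := hx.map_sub_div_le_one hp hα hα1 hsmall hαt1 (j := i - t) (by omega) (by omega)
        rw [show t + (i - t) = i by omega, show t - (i - t) = 2 * t - i by omega] at h1
        have hα' : α ^ p = -α := by linear_combination hα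
        set c := α ^ (p + 1) with hc
        have hc2 : c = -α ^ 2 := by rw [hc, pow_succ, hα']; ring
        have hcp : c ^ p ^ (2 * n) = c := by
          have hcp' : c ^ p = c := by
            rw [hc, ← pow_mul, mul_comm, pow_mul, hα', neg_pow]
            rcases (Fact.out : p.Prime).eq_two_or_odd' with h | h
            · omega
            · rw [h.add_one.neg_one_pow, one_mul]
          induction 2 * n with
          | zero => simp
          | succ m ih => rw [pow_succ, pow_mul, ih, hcp']
        set R := -(x t ^ 2) / (1 + (x t ^ p + x t)) with hR
        have e : x i - R ^ p ^ (2 * n) / x (2 * t - i) =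
            (x i - c / x (2 * t - i)) - (R - c) ^ p ^ (2 * n) / x (2 * t - i) := by
          rw [sub_pow_char_pow, hcp]; ring
        rw [e]
        refine v.map_sub_le h1 ?_
        rw [map_div₀, map_pow]
        refine div_le_one_of_le₀ (le_trans ?_ (hlow _ (by omega))) zero_le
        have hf : v (x t ^ p + x t) = v (x t - α) := by
          rw [pow_add_self_eq_mul (by omega), map_mul, hxt, hϖ, one_mul]
        have hd : v (1 + (x t ^ p + x t)) = 1 := v.map_one_add_of_lt (by rwa [hf])
        have hd0 : 1 + (x t ^ p + x t) ≠ 0 := by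
          intro h; rw [h, map_zero] at hd; exact zero_ne_one hd
        have hRc : v (R - c) ≤ v (x t - α) := by
          have : R - c = (-((x t - α) * (x t + α)) + α ^ 2 * (x t ^ p + x t)) /
              (1 + (x t ^ p + x t)) := by
            rw [hR, hc2]
            field_simp
            ring
          rw [this, map_div₀, hd, div_one]
          refine v.map_add_le ?_ ?_
          · rw [v.map_neg, map_mul]
            exact mul_le_of_le_one_right' (v.map_add_le hxt.le hα1.le)
          · rw [map_mul, map_pow, hα1, one_pow, one_mul, hf]
        refine (pow_le_pow_left' hRc _).trans ?_
        rw [hαt, ← pow_mul]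
        refine pow_le_pow_right_of_le_one' h0.le ?_
        calc p ^ n ≤ p ^ (2 * n) := Nat.pow_le_pow_right (by omega) (by omega)
          _ ≤ p ^ t * p ^ (2 * n) := Nat.le_mul_of_pos_left _ (by positivity)
      · simp only [Finset.mem_erase, Finset.mem_filter, Finset.mem_range] at hs
        exact hother i hin s hs.2.1 hs.1
    · refine v.map_sub_le ?_ (v.map_sum_le fun s hs => ?_)
      · rcases Nat.lt_or_eq_of_le hti with h | rfl
        · exact (hsmall i h).le
        · exact hxt.le
      · simp only [Finset.mem_filter, Finset.mem_range] at hs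
        exact hother i hin s hs.1 (by omega)
  have hbig : ∀ i, i ≤ n → 2 * t < i → v (x i - towerShift p (2 * n) x i) ≤ v (x i) := by
    intro i hin hit
    have := (hpoles (i - t) (by omega)).2
    rw [show t + (i - t) = i by omega] at this
    refine v.map_sub_le le_rfl ((v.map_sum_le fun s hs => ?_).trans this.le)
    simp only [Finset.mem_filter, Finset.mem_range] at hs
    exact hother i hin s hs.1 (by omega)
  have h2t : v (x (2 * t)) = (v (x 0))⁻¹ := by
    have := (hpoles t ht1).1
    rw [← two_mul, ← inv_pow] at this
    exact (pow_left_inj₀ zero_le zero_le (by positivity)).1 this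
  have hp_big : ∀ i, 2 * t ≤ i → 1 < v (x i) := fun i hi => by
    have := (hpoles (i - t) (by omega)).2
    rwa [show t + (i - t) = i by omega] at this
  have := map_digitMonomial_le v (y := fun i => x i - towerShift p (2 * n) x i)
    (u := fun i => if i ≤ 2 * t then 1 else v (x i))
    (w := fun i => if i < 2 * t then (v (x 0))⁻¹ else v (x i))
    (by omega : 1 ≤ p) (fun i _ => ?_) (fun i hi => ?_) (fun i hi => ?_) hk
  · simp only [show 0 < 2 * t by omega, if_true] at this
    refine (le_mul_of_one_le_right' ?_).trans this
    split_ifs with h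
    · exact hr1
    · exact (hp_big _ (by omega)).le
  · split_ifs with h
    · exact le_rfl
    · exact (hp_big _ (by omega)).le
  · rcases lt_trichotomy (i + 1) (2 * t) with h | h | h
    · simp [h, h.le, show i < 2 * t by omega]
    · simp [h, show i < 2 * t by omega, h2t]
    · simp only [show ¬ i + 1 < 2 * t by omega, show ¬ i + 1 ≤ 2 * t by omega,
        show ¬ i < 2 * t by omega, if_false]
      rw [← pow_succ', Nat.sub_add_cancel (by omega),
        (hx.map_succ_of_one_lt hp2 (hp_big i (by omega))).1]
  · split_ifs with h
    · exact hone _ (by omega) (by omega) h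
    · exact hbig _ (by omega) (by omega)

theorem map_digitMonomial_le_inv_pow [CharP Ω p] [Fact p.Prime] (hx : IsTower p x) (hp : 2 ≤ p)
    {Z : Finset Ω} (hZ : ∀ y : Ω, y ^ p + y = ∏ ω ∈ Z, (y - ω))
    (hZ1 : ∀ ω ∈ Z, ω ≠ 0 → v ω = 1) (h0 : v (x 0) < 1) {n k : ℕ} (hk : k < p ^ n) :
    v (digitMonomial p x n k) ≤ (v (x 0))⁻¹ ^ (p ^ n * ((p - 1) * n)) := by
  have hr0 : v (x 0) ≠ 0 := by simpa using hx.ne_zero 0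
  have hr1 : 1 ≤ (v (x 0))⁻¹ := (one_le_inv₀ (zero_lt_iff.2 hr0)).2 h0.le
  have hu1 : 1 ≤ (v (x 0))⁻¹ ^ p ^ n := one_le_pow_of_one_le' hr1 _
  have hu : ∀ i ≤ n, v (x i) ≤ (v (x 0))⁻¹ ^ p ^ n := by
    intro i hi
    rcases hx.exists_pattern hp hZ h0 n with hA | ⟨t, ht1, htn, hA, α, hαZ, hα0, hαt⟩
    · rw [hA i hi]; exact (pow_le_one' h0.le _).trans hu1
    · have hα : α ^ p + α = 0 := by rw [hZ]; exact Finset.prod_eq_zero hαZ (sub_self α)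
      obtain ⟨hxt, -, -, hpole1, hpole⟩ := hx.map_succ_of_sub_lt_one hp hα (hZ1 α hαZ hα0)
        (by rw [hαt]; exact pow_lt_one₀ zero_le h0 (by positivity))
      rcases lt_trichotomy i t with h | rfl | h
      · rw [hA i h]; exact (pow_le_one' h0.le _).trans hu1
      · rwa [hxt]
      · obtain ⟨j, rfl⟩ := Nat.exists_eq_add_of_le (show t + 1 ≤ i from h)
        obtain ⟨h1, h2⟩ := hx.map_add_of_one_lt hp hpole j
        calc v (x (t + 1 + j)) ≤ v (x (t + 1 + j)) ^ p ^ j :=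
              le_self_pow₀ h2.le (by positivity)
          _ ≤ v (x (t + 1)) ^ p := by rw [h1]; exact le_self_pow₀ hpole.le (by omega)
          _ = (v (x 0))⁻¹ ^ p ^ t := by rw [hpole1, hαt, inv_pow]
          _ ≤ _ := pow_le_pow_right₀ hr1 (Nat.pow_le_pow_right (by omega) htn)
  have := map_digitMonomial_le v (y := x) (u := fun _ => (v (x 0))⁻¹ ^ p ^ n)
    (w := fun i => ((v (x 0))⁻¹ ^ p ^ n) ^ ((p - 1) * (n - i)))
    (by omega : 1 ≤ p) (fun i _ => hu1) (fun i hi => ?_) (fun i hi => hu _ (by omega)) hk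
  · simpa [← pow_mul] using this
  · rw [← pow_add, ← Nat.mul_succ, show (n - (i + 1)).succ = n - i by omega]

end IsTower
end Valuation

/-! ### The tower at infinity -/

/-- The number whose `n` base `p` digits are those of `k` in reverse order. -/
def digitReverse (p : ℕ) : ℕ → ℕ → ℕ
  | 0, _ => 0
  | n + 1, k => p * digitReverse p n (k % p ^ n) + k / p ^ n

theorem digitReverse_lt {p : ℕ} (hp : 0 < p) {n k : ℕ} (hk : k < p ^ n) :
    digitReverse p n k < p ^ n := by
  induction n generalizing k with
  | zero => simp [digitReverse]
  | succ n ih =>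
    have h1 := ih (Nat.mod_lt k (by positivity : 0 < p ^ n))
    have h2 : k / p ^ n < p := Nat.div_lt_of_lt_mul (by rwa [← pow_succ])
    calc digitReverse p (n + 1) k < p * digitReverse p n (k % p ^ n) + p := by
          rw [digitReverse]; omega
      _ = p * (digitReverse p n (k % p ^ n) + 1) := by ring
      _ ≤ p * p ^ n := Nat.mul_le_mul_left _ h1
      _ = p ^ (n + 1) := by ring

theorem digitReverse_injOn {p : ℕ} (hp : 0 < p) (n : ℕ) :
    Set.InjOn (digitReverse p n) (Set.Iio (p ^ n)) := by
  induction n with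
  | zero => intro a ha b hb _; simp at ha hb; omega
  | succ n ih =>
    intro a ha b hb h
    have h2 : ∀ k ∈ Set.Iio (p ^ (n + 1)), k / p ^ n < p := fun k hk =>
      Nat.div_lt_of_lt_mul (by rwa [← pow_succ])
    have ha2 := h2 a ha
    have hb2 := h2 b hb
    simp only [digitReverse] at h
    have h3 := congrArg (· % p) h
    have h4 := congrArg (· / p) h
    simp only [Nat.mul_add_mod, Nat.mod_eq_of_lt ha2, Nat.mod_eq_of_lt hb2] at h3
    simp only [Nat.mul_add_div hp, Nat.div_eq_of_lt ha2, Nat.div_eq_of_lt hb2, add_zero] at h4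
    have h5 := ih (Nat.mod_lt a (by positivity)) (Nat.mod_lt b (by positivity)) h4
    rw [← Nat.div_add_mod a (p ^ n), ← Nat.div_add_mod b (p ^ n), h3, h5]

section Infinity

variable {Ω Γ : Type*} [Field Ω] [LinearOrderedCommGroupWithZero Γ] {v : Valuation Ω Γ} {p : ℕ}
  {x : ℕ → Ω}

theorem IsTower.map_digitMonomial_pow (hx : IsTower p x) (hp : 2 ≤ p) (h0 : 1 < v (x 0))
    (n k : ℕ) : v (digitMonomial p x n k) ^ p ^ n = v (x 0) ^ digitReverse p n k := by
  induction n generalizing k with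
  | zero => simp [digitMonomial, digitReverse]
  | succ n ih =>
    have h1 := (hx.map_add_of_one_lt hp h0 (n + 1)).1
    rw [zero_add] at h1
    rw [digitMonomial, digitReverse, map_mul, mul_pow, pow_succ, pow_mul, ih, ← pow_succ, map_pow,
      pow_right_comm _ (k / p ^ n), h1, ← pow_mul, ← pow_add, mul_comm p]

theorem Valuation.map_le_map_sum_of_injOn {ι : Type*} (s : Finset ι) (f : ι → Ω)
    (h : ∀ i ∈ s, ∀ j ∈ s, f i ≠ 0 → f j ≠ 0 → v (f i) = v (f j) → i = j) {i : ι} (hi : i ∈ s) :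
    v (f i) ≤ v (∑ j ∈ s, f j) := by
  classical
  obtain ⟨a, ha, hmax⟩ := s.exists_max_image (fun i => v (f i)) ⟨i, hi⟩
  by_cases hfa : f a = 0
  · have := hmax i hi
    rw [hfa, map_zero] at this
    exact this.trans zero_le
  · rw [v.map_sum_eq_of_lt ha fun j hj => ?_]
    · exact hmax i hi
    · simp only [Finset.mem_sdiff, Finset.mem_singleton] at hj
      refine lt_of_le_of_ne (hmax j hj.1) fun heq => ?_
      by_cases hfj : f j = 0
      · rw [hfj, map_zero] at heq
        exact hfa ((map_eq_zero v).1 heq.symm)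
      · exact hj.2 (h j hj.1 a ha hfj hfa heq)

/-- The monomials have valuations in distinct classes modulo the value group of the base field,
so that the valuation of a combination is that of its largest term. -/
theorem IsTower.map_mul_digitMonomial_le (hx : IsTower p x) (hp : 2 ≤ p) (h0 : 1 < v (x 0))
    {n : ℕ} (c : ℕ → Ω) (hc : ∀ k < p ^ n, c k ≠ 0 → ∃ z : ℤ, v (c k) = v (x 0) ^ z)
    {k : ℕ} (hk : k < p ^ n) :
    v (c k * digitMonomial p x n k) ≤
      v (∑ l ∈ Finset.range (p ^ n), c l * digitMonomial p x n l) := by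
  refine Valuation.map_le_map_sum_of_injOn _ (fun l => c l * digitMonomial p x n l) ?_
    (Finset.mem_range.2 hk)
  intro i hi j hj hi0 hj0 h
  rw [Finset.mem_range] at hi hj
  obtain ⟨a, ha⟩ := hc i hi (left_ne_zero_of_mul hi0)
  obtain ⟨b, hb⟩ := hc j hj (left_ne_zero_of_mul hj0)
  have h1 := congrArg (· ^ p ^ n) h
  have hz : v (x 0) ≠ 0 := (zero_lt_one.trans h0).ne'
  simp only [map_mul, mul_pow, hx.map_digitMonomial_pow hp h0, ha, hb] at h1
  simp only [← zpow_natCast, ← zpow_mul, ← zpow_add₀ hz] at h1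
  have h2 := zpow_right_injective₀ (zero_lt_one.trans h0) h0.ne' h1
  have h3 := congrArg (· % (p ^ n : ℕ) : ℤ → ℤ) h2
  have hpn := digitReverse_lt (by omega : 0 < p) hi
  have hpn' := digitReverse_lt (by omega : 0 < p) hj
  simp only [add_comm (_ * _) (_ : ℤ), Int.add_mul_emod_self_right] at h3
  rw [Int.emod_eq_of_lt (by positivity) (by exact_mod_cast hpn),
    Int.emod_eq_of_lt (by positivity) (by exact_mod_cast hpn')] at h3
  exact digitReverse_injOn (by omega) n hi hj (by exact_mod_cast h3)

end Infinity

/-! ### The fields of the tower -/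

section Field

variable {K Ω : Type*} [Field K] [Field Ω] [Algebra K Ω]

/-- The `n`-th field `K(x 1, …, x n)` of a tower. -/
def towerField (K : Type*) {Ω : Type*} [Field K] [Field Ω] [Algebra K Ω] (x : ℕ → Ω) :
    ℕ → IntermediateField K Ω
  | 0 => ⊥
  | n + 1 => (IntermediateField.adjoin (towerField K x n) {x (n + 1)}).restrictScalars K

/-- The span of the first `k` monomials. -/
def monomialSpan (K : Type*) {Ω : Type*} [Field K] [Field Ω] [Algebra K Ω] (p : ℕ) (x : ℕ → Ω)
    (n k : ℕ) : Submodule K Ω :=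
  Submodule.span K (digitMonomial p x n '' Set.Iio k)

variable {p : ℕ} {x : ℕ → Ω}

theorem towerField_le_succ (n : ℕ) : towerField K x n ≤ towerField K x (n + 1) := by
  intro f hf
  exact (IntermediateField.adjoin (towerField K x n) {x (n + 1)}).algebraMap_mem ⟨f, hf⟩

theorem towerField_mono : Monotone (towerField K x) :=
  monotone_nat_of_le_succ towerField_le_succ

theorem mem_towerField (h0 : x 0 ∈ (⊥ : IntermediateField K Ω)) {i n : ℕ} (hi : i ≤ n) :
    x i ∈ towerField K x n := by
  refine towerField_mono hi ?_
  rcases i with _ | i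
  · exact h0
  · change x (i + 1) ∈ (IntermediateField.adjoin (towerField K x i) {x (i + 1)}).restrictScalars K
    rw [IntermediateField.mem_restrictScalars]
    exact IntermediateField.mem_adjoin_simple_self (towerField K x i) (x (i + 1))

theorem digitMonomial_mem_towerField {y : ℕ → Ω} {n : ℕ}
    (hy : ∀ i ≤ n, y i ∈ towerField K x n) (k : ℕ) :
    digitMonomial p y n k ∈ towerField K x n := by
  suffices ∀ m ≤ n, ∀ k, digitMonomial p y m k ∈ towerField K x n from this n le_rfl k
  intro m hm
  induction m with
  | zero => intro k; exact one_mem _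
  | succ m ih => intro k; exact mul_mem (ih (by omega) _) (pow_mem (hy _ hm) _)

theorem monomialSpan_mono {n : ℕ} : Monotone (monomialSpan K p x n) :=
  fun _ _ h => Submodule.span_mono (Set.image_mono (Set.Iio_subset_Iio h))

theorem mul_pow_mem_monomialSpan {n k a : ℕ} (hk : k ≤ p ^ n) {f : Ω}
    (hf : f ∈ monomialSpan K p x n k) :
    f * x (n + 1) ^ a ∈ monomialSpan K p x (n + 1) (k + a * p ^ n) := by
  rw [monomialSpan] at hf
  induction hf using Submodule.span_induction with
  | mem y hy =>
    obtain ⟨l, hl, rfl⟩ := hy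
    rw [Set.mem_Iio] at hl
    refine Submodule.subset_span ⟨l + a * p ^ n, by simpa using hl, ?_⟩
    have h0 : 0 < p ^ n := by omega
    simp only [digitMonomial]
    rw [Nat.add_mul_mod_self_right, Nat.mod_eq_of_lt (by omega), Nat.add_mul_div_right _ _ h0,
      Nat.div_eq_of_lt (by omega), zero_add]
  | zero => simp
  | add y z _ _ hy hz => rw [add_mul]; exact add_mem hy hz
  | smul c y _ hy => rw [smul_mul_assoc]; exact Submodule.smul_mem _ _ hy

theorem IsTower.isIntegral (hx : IsTower p x) (hp : 2 ≤ p) (h0 : x 0 ∈ (⊥ : IntermediateField K Ω))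
    (n : ℕ) : ∃ c : towerField K x n, algebraMap _ Ω c = x n ^ p / (x n ^ (p - 1) + 1) ∧
      (Polynomial.X ^ p + (Polynomial.X - Polynomial.C c)).Monic ∧
      (Polynomial.X ^ p + (Polynomial.X - Polynomial.C c)).natDegree = p ∧
      Polynomial.aeval (x (n + 1)) (Polynomial.X ^ p + (Polynomial.X - Polynomial.C c)) = 0 := by
  have hxn := mem_towerField h0 le_rfl (n := n)
  have hm : x n ^ p / (x n ^ (p - 1) + 1) ∈ towerField K x n :=
    div_mem (pow_mem hxn _) (add_mem (pow_mem hxn _) (one_mem _))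
  refine ⟨⟨_, hm⟩, rfl, ?_, ?_, ?_⟩
  · exact Polynomial.monic_X_pow_add ((Polynomial.degree_X_sub_C_le _).trans_lt (by exact_mod_cast hp))
  · rw [Polynomial.natDegree_add_eq_left_of_natDegree_lt] <;> simp; omega
  · simp only [map_add, map_sub, map_pow, Polynomial.aeval_X, Polynomial.aeval_C]
    rw [← add_sub_assoc, hx.step, sub_eq_zero]; rfl

theorem IsTower.mem_monomialSpan (hx : IsTower p x) (hp : 2 ≤ p)
    (h0 : x 0 ∈ (⊥ : IntermediateField K Ω)) (n : ℕ) {f : Ω} (hf : f ∈ towerField K x n) :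
    f ∈ monomialSpan K p x n (p ^ n) := by
  induction n generalizing f with
  | zero =>
    obtain ⟨c, rfl⟩ := IntermediateField.mem_bot.1 hf
    rw [Algebra.algebraMap_eq_smul_one]
    exact Submodule.smul_mem _ _ (Submodule.subset_span ⟨0, by simp, rfl⟩)
  | succ n ih =>
    obtain ⟨c, -, hmon, hdeg, hroot⟩ := hx.isIntegral hp h0 n
    set P : Polynomial (towerField K x n) := Polynomial.X ^ p + (Polynomial.X - Polynomial.C c)
    have h_int : IsIntegral (towerField K x n) (x (n + 1)) := ⟨P, hmon, hroot⟩
    have hf' : f ∈ (IntermediateField.adjoin (towerField K x n) {x (n + 1)}).toSubalgebra := hf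
    rw [IntermediateField.adjoin_simple_toSubalgebra_of_isAlgebraic h_int.isAlgebraic,
      Algebra.adjoin_singleton_eq_range_aeval] at hf'
    obtain ⟨q, rfl⟩ := hf'
    have : Polynomial.aeval (x (n + 1)) q = Polynomial.aeval (x (n + 1)) (q %ₘ P) := by
      conv_lhs => rw [← Polynomial.modByMonic_add_div q P]
      rw [map_add, map_mul, hroot, zero_mul, add_zero]
    change (Polynomial.aeval (x (n + 1)) q : Ω) ∈ _
    rw [this, Polynomial.aeval_eq_sum_range' (n := p)]
    · refine sum_mem fun i hi => ?_
      rw [Finset.mem_range] at hi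
      have := mul_pow_mem_monomialSpan le_rfl (a := i) (ih ((q %ₘ P).coeff i).2)
      refine monomialSpan_mono ?_ this
      calc p ^ n + i * p ^ n = (i + 1) * p ^ n := by ring
        _ ≤ p * p ^ n := Nat.mul_le_mul_right _ hi
        _ = p ^ (n + 1) := by ring
    · rw [← hdeg]
      refine Polynomial.natDegree_modByMonic_lt _ hmon fun h => ?_
      rw [h, Polynomial.natDegree_one] at hdeg; omega

theorem IsTower.isSeparable_towerField [CharP Ω p] (hx : IsTower p x) (hp : 2 ≤ p)
    (h0 : x 0 ∈ (⊥ : IntermediateField K Ω)) (n : ℕ) :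
    Algebra.IsSeparable K (towerField K x n) := by
  induction n with
  | zero => exact inferInstanceAs (Algebra.IsSeparable K (⊥ : IntermediateField K Ω))
  | succ n ih =>
    obtain ⟨c, -, hmon, hdeg, hroot⟩ := hx.isIntegral hp h0 n
    have hsep : (Polynomial.X ^ p + (Polynomial.X - Polynomial.C c)).Separable := by
      rw [Polynomial.separable_def]
      have : CharP (towerField K x n) p :=
        (algebraMap (towerField K x n) Ω).charP_iff (algebraMap (towerField K x n) Ω).injective p |>.2 inferInstance
      simp [Polynomial.derivative_X_pow, isCoprime_one_right]
    have h1 : IsSeparable (towerField K x n) (x (n + 1)) :=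
      hsep.of_dvd (minpoly.dvd _ _ hroot)
    have h2 : Algebra.IsSeparable (towerField K x n)
        (IntermediateField.adjoin (towerField K x n) {x (n + 1)}) :=
      (IntermediateField.isSeparable_adjoin_simple_iff_isSeparable _ _).2 h1
    exact Algebra.IsSeparable.trans K (towerField K x n)
      (IntermediateField.adjoin (towerField K x n) {x (n + 1)})

theorem digitMonomial_sub_mem_monomialSpan (hx : IsTower p x) (hp : 2 ≤ p)
    (h0 : x 0 ∈ (⊥ : IntermediateField K Ω)) {g : ℕ → Ω} (hg : ∀ i, g (i + 1) ∈ towerField K x i)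
    {n k : ℕ} (hk : k < p ^ n) :
    digitMonomial p (fun i => x i - g i) n k - digitMonomial p x n k ∈ monomialSpan K p x n k := by
  induction n generalizing k with
  | zero => simp [digitMonomial]
  | succ n ih =>
    have hpn : 0 < p ^ n := by positivity
    have hmod := Nat.mod_lt k hpn
    have hg' : ∀ i, i ≤ n → g i ∈ towerField K x n ∨ i = 0 := fun i hi => by
      rcases i with _ | i
      · exact Or.inr rfl
      · exact Or.inl (towerField_mono (by omega) (hg i))
    set m := digitMonomial p x n (k % p ^ n)
    set m' := digitMonomial p (fun i => x i - g i) n (k % p ^ n)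
    set a := k / p ^ n
    have hka : k = k % p ^ n + a * p ^ n := by rw [mul_comm]; exact (Nat.mod_add_div _ _).symm
    have hm' : m' ∈ towerField K x n := by
      suffices m' - m ∈ towerField K x n by
        have h2 : m ∈ towerField K x n :=
          digitMonomial_mem_towerField (fun i hi => mem_towerField h0 hi) _
        simpa using add_mem this h2
      have hle : monomialSpan K p x n (k % p ^ n) ≤
          Subalgebra.toSubmodule (towerField K x n).toSubalgebra := by
        rw [monomialSpan, Submodule.span_le]
        rintro _ ⟨l, -, rfl⟩
        exact digitMonomial_mem_towerField (fun i hi => mem_towerField h0 hi) _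
      exact hle (ih hmod)
    have e : m' * (x (n + 1) - g (n + 1)) ^ a - m * x (n + 1) ^ a = (m' - m) * x (n + 1) ^ a +
        ∑ j ∈ Finset.range a, (m' * ((-g (n + 1)) ^ (a - j) * (a.choose j : Ω))) * x (n + 1) ^ j := by
      rw [sub_eq_add_neg (x (n + 1)), add_pow, Finset.sum_range_succ, mul_add, Finset.mul_sum]
      simp only [Nat.sub_self, pow_zero, Nat.choose_self, Nat.cast_one, mul_one]
      rw [sub_mul, add_comm (m' * x (n + 1) ^ a - _), add_sub_assoc]
      congr 1
      exact Finset.sum_congr rfl fun j _ => by ring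
    change m' * (x (n + 1) - g (n + 1)) ^ a - m * x (n + 1) ^ a ∈ _
    rw [e]
    refine add_mem ?_ (sum_mem fun j hj => ?_)
    · have := mul_pow_mem_monomialSpan hmod.le (a := a) (ih hmod)
      rwa [← hka] at this
    · rw [Finset.mem_range] at hj
      have hin : m' * ((-g (n + 1)) ^ (a - j) * (a.choose j : Ω)) ∈ towerField K x n :=
        mul_mem hm' (mul_mem (pow_mem (neg_mem (hg n)) _) (natCast_mem _ _))
      refine monomialSpan_mono ?_ (mul_pow_mem_monomialSpan le_rfl (a := j)
        (hx.mem_monomialSpan hp h0 n hin))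
      calc p ^ n + j * p ^ n = (j + 1) * p ^ n := by ring
        _ ≤ a * p ^ n := Nat.mul_le_mul_right _ hj
        _ ≤ k := Nat.div_mul_le_self k _

end Field

section FunctionField

open Polynomial

/-! ### Integral elements with few poles -/

section Integral

variable {F Ω : Type*} [Field F] [Field Ω] [Algebra F Ω]

namespace Polynomial

variable {Γ : Type*} [LinearOrderedCommGroupWithZero Γ] (v : Valuation Ω Γ) [v.IsTrivialOn F]

theorem valuation_aeval_le_one {w : Ω} (hw : v w ≤ 1) (q : F[X]) : v (aeval w q) ≤ 1 := by
  rw [aeval_eq_sum_range]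
  refine v.map_sum_le fun i _ => ?_
  rw [Algebra.smul_def, map_mul, map_pow]
  refine mul_le_one' ?_ (pow_le_one' hw _)
  by_cases h : q.coeff i = 0
  · simp [h]
  · exact (Valuation.IsTrivialOn.eq_one _ h).le

theorem valuation_aeval_eq_one {w : Ω} (hw : v w < 1) {q : F[X]} (hq : q.coeff 0 ≠ 0) :
    v (aeval w q) = 1 := by
  have h0 : v (algebraMap F Ω (q.coeff 0)) = 1 := Valuation.IsTrivialOn.eq_one _ hq
  rw [← divX_mul_X_add q, map_add, map_mul, aeval_X, aeval_C, v.map_add_eq_of_lt_right, h0]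
  rw [h0, map_mul]
  exact (mul_le_of_le_one_left' (valuation_aeval_le_one v hw.le _)).trans_lt hw

end Polynomial

open Polynomial

theorem exists_valuationSubring_map_lt_one {t : Ω} (ht : Transcendental F t) :
    ∃ B : ValuationSubring Ω, B.valuation t < 1 := by
  set A := Algebra.adjoin F {t}
  have htA : t ∈ A := Algebra.self_mem_adjoin_singleton F t
  have hI : Ideal.span {(⟨t, htA⟩ : A.toSubring)} ≠ ⊤ := by
    rw [Ne, Ideal.span_singleton_eq_top]
    intro hu
    obtain ⟨⟨u, hu⟩, h1⟩ := isUnit_iff_exists_inv.1 hu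
    have h2 : t * u = 1 := congrArg Subtype.val h1
    obtain ⟨q, rfl⟩ : u ∈ (aeval t : F[X] →ₐ[F] Ω).range := by
      rw [← Algebra.adjoin_singleton_eq_range_aeval]; exact hu
    refine ht ⟨X * q - 1, fun h => ?_, by simpa [sub_eq_zero] using h2⟩
    have := congrArg (coeff · 0) h
    simp at this
  obtain ⟨B, -, hB⟩ := Ideal.image_subset_nonunits_valuationSubring _ hI
  refine ⟨B, ?_⟩
  have := hB ⟨_, Ideal.mem_span_singleton_self _, rfl⟩
  rwa [SetLike.mem_coe, ValuationSubring.mem_nonunits_iff] at this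

theorem isIntegral_of_forall_valuationSubring {R Ω : Type*} [CommRing R] [Field Ω] [Algebra R Ω]
    (a : R) {f : Ω}
    (hf : ∀ B : ValuationSubring Ω, B.valuation (algebraMap R Ω a) ≤ 1 → B.valuation f ≤ 1) :
    IsIntegral R f := by
  have : IsIntegrallyClosedIn (integralClosure R Ω).toSubring Ω :=
    inferInstanceAs (IsIntegrallyClosedIn (integralClosure R Ω) Ω)
  have h := Subring.eq_iInf_of_isIntegrallyClosedIn (R := (integralClosure R Ω).toSubring)
  change f ∈ (integralClosure R Ω).toSubring
  rw [h]
  simp only [Subring.mem_iInf]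
  rintro ⟨B, hB⟩
  exact (B.valuation_le_one_iff f).1 (hf B ((B.valuation_le_one_iff _).2
    (hB (isIntegral_algebraMap (x := a)))))

/-- Laurent polynomials in `t`. -/
def IsLaurent (F : Type*) {Ω : Type*} [Field F] [Field Ω] [Algebra F Ω] (t y : Ω) : Prop :=
  ∃ (q : F[X]) (e : ℕ), y = aeval t q / t ^ e

variable {t : Ω}

theorem IsLaurent.sub_aeval_mul (ht : t ≠ 0) {y z : Ω} (hy : IsLaurent F t y)
    (hz : IsLaurent F t z) (P : F[X]) : IsLaurent F t (y - aeval t P * z) := by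
  obtain ⟨q, e, rfl⟩ := hy
  obtain ⟨r, d, rfl⟩ := hz
  refine ⟨q * X ^ d - P * r * X ^ e, e + d, ?_⟩
  simp only [map_sub, map_mul, map_pow, aeval_X, pow_add]
  field_simp

theorem IsLaurent.aeval_mul {z : Ω} (hz : IsLaurent F t z) (P : F[X]) :
    IsLaurent F t (aeval t P * z) := by
  obtain ⟨q, e, rfl⟩ := hz
  exact ⟨P * q, e, by rw [map_mul, mul_div_assoc]⟩

theorem IsLaurent.exists_low [Finite F] (ht : t ≠ 0) {y : Ω} (hy : IsLaurent F t y) :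
    ∃ P : F[X], IsLaurent F t (y - aeval t P) ∧
      ∀ B : ValuationSubring Ω, 1 < B.valuation t → B.valuation (y - aeval t P) ≤ 1 := by
  obtain ⟨q, e, rfl⟩ := hy
  have hm : (X ^ e : F[X]).Monic := monic_X_pow e
  have e1 : aeval t q / t ^ e - aeval t (q /ₘ X ^ e) = aeval t (q %ₘ X ^ e) / t ^ e := by
    conv_lhs => rw [← modByMonic_add_div q (X ^ e)]
    rw [map_add, map_mul, map_pow, aeval_X, modByMonic_add_div]
    field_simp
    ring
  refine ⟨q /ₘ X ^ e, ?_, fun B hB => ?_⟩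
  · rw [e1]; exact ⟨_, _, rfl⟩
  · rw [e1, map_div₀]
    by_cases h0 : q %ₘ X ^ e = 0
    · simp [h0]
    rw [valuation_aeval_eq_valuation_X_pow_natDegree_of_one_lt_valuation_X _ hB h0, map_pow]
    refine div_le_one_of_le₀ (pow_le_pow_right₀ hB.le ?_) zero_le
    have := natDegree_modByMonic_le q hm
    rwa [natDegree_X_pow] at this

theorem IsLaurent.map_le_one [Finite F] {y : Ω} (hy : IsLaurent F t y) (B : ValuationSubring Ω)
    (hB : B.valuation t = 1) : B.valuation y ≤ 1 := by
  obtain ⟨q, e, rfl⟩ := hy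
  rw [map_div₀, map_pow, hB, one_pow, div_one]
  exact valuation_aeval_le_one _ hB.le q

theorem algebraMap_X_ne_zero (F K Ω : Type*) [Field F] [Field K] [Field Ω] [Algebra K Ω]
    [Algebra F[X] K] [IsFractionRing F[X] K] [Algebra F[X] Ω] [IsScalarTower F[X] K Ω] :
    algebraMap F[X] Ω X ≠ 0 := by
  rw [IsScalarTower.algebraMap_apply F[X] K Ω, Ne, map_eq_zero, map_eq_zero_iff _
    (IsFractionRing.injective F[X] K)]
  exact X_ne_zero

variable [Algebra F[X] Ω] [IsScalarTower F F[X] Ω]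

theorem algebraMap_eq_aeval (q : F[X]) :
    algebraMap F[X] Ω q = aeval (algebraMap F[X] Ω X) q := by
  rw [aeval_algebraMap_apply, aeval_X_left_apply]

variable {K : Type*} [Field K] [Algebra K Ω] [Algebra F[X] K] [IsScalarTower F[X] K Ω]

theorem IsLaurent.mem_range {y : Ω} (hy : IsLaurent F (algebraMap F[X] Ω X) y) :
    ∃ c : K, y = algebraMap K Ω c := by
  obtain ⟨q, e, rfl⟩ := hy
  refine ⟨algebraMap F[X] K q / algebraMap F[X] K X ^ e, ?_⟩
  rw [← algebraMap_eq_aeval, map_div₀, map_pow, ← IsScalarTower.algebraMap_apply,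
    ← IsScalarTower.algebraMap_apply]

theorem exists_isLaurent_map_sub_le [IsFractionRing F[X] K] [Finite F] (τ : K) (N : ℕ) :
    ∃ y, IsLaurent F (algebraMap F[X] Ω X) y ∧
      ∀ B : ValuationSubring Ω, B.valuation (algebraMap F[X] Ω X) < 1 →
        B.valuation (y - algebraMap K Ω τ) ≤ B.valuation (algebraMap F[X] Ω X) ^ N := by
  obtain ⟨a, b, hb, rfl⟩ := IsFractionRing.div_surjective (A := F[X]) τ
  have hb0 : b ≠ 0 := nonZeroDivisors.ne_zero hb
  obtain ⟨b', hbb, hb'⟩ := exists_eq_pow_rootMultiplicity_mul_and_not_dvd b hb0 0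
  generalize rootMultiplicity 0 b = r at hbb
  rw [C_0, sub_zero] at hbb hb'
  subst hbb
  obtain ⟨u, w, huw⟩ : IsCoprime (X ^ (N + r)) b' :=
    (irreducible_X.coprime_iff_not_dvd.2 hb').pow_left
  set t := algebraMap F[X] Ω X with ht
  have ht0 : t ≠ 0 := algebraMap_X_ne_zero F K Ω
  refine ⟨aeval t (a * w) / t ^ r, ⟨_, _, rfl⟩, fun B hB => ?_⟩
  have hv : B.valuation (aeval t b') = 1 :=
    valuation_aeval_eq_one _ hB (by rwa [X_dvd_iff] at hb')
  have hbne : aeval t b' ≠ 0 := by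
    intro h; rw [h, map_zero] at hv; exact zero_ne_one hv
  have e : aeval t (a * w) / t ^ r -
      algebraMap K Ω (algebraMap F[X] K a / algebraMap F[X] K (X ^ r * b')) =
      - (aeval t (a * u) * t ^ N / aeval t b') := by
    rw [map_div₀, ← IsScalarTower.algebraMap_apply, ← IsScalarTower.algebraMap_apply,
      algebraMap_eq_aeval a, algebraMap_eq_aeval (X ^ r * b'), ← ht]
    have h1 := congrArg (aeval t) huw
    simp only [map_add, map_mul, map_pow, aeval_X, map_one, pow_add] at h1 ⊢
    field_simp
    linear_combination aeval t a * h1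
  rw [e, Valuation.map_neg, map_div₀, map_mul, hv, div_one, map_pow]
  exact mul_le_of_le_one_left' (valuation_aeval_le_one _ hB.le _)

end Integral

section LowElements

variable {F K Ω : Type*} [Field F] [Field K] [Field Ω] [Algebra F Ω] [Algebra K Ω] [Algebra F[X] K]
  [IsFractionRing F[X] K] [Algebra F[X] Ω] [IsScalarTower F[X] K Ω] [IsScalarTower F F[X] Ω]
  {p : ℕ} {x : ℕ → Ω}

/-- The elements which become integral over `F[t]` after multiplication by `t ^ p + t`. -/
def almostIntegral (p : ℕ) (t : Ω) : AddSubgroup Ω where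
  carrier := {f | ∀ B : ValuationSubring Ω, B.valuation t ≤ 1 →
    B.valuation (t * (t ^ (p - 1) + 1) * f) ≤ 1}
  zero_mem' := fun B _ => by simp
  add_mem' := fun hf hg B hB => by
    rw [mul_add]; exact Valuation.map_add_le _ (hf B hB) (hg B hB)
  neg_mem' := fun hf B hB => by
    rw [mul_neg, Valuation.map_neg]; exact hf B hB

omit [Algebra F[X] Ω] [IsScalarTower F F[X] Ω] in
theorem aeval_mul_mem_almostIntegral [Finite F] {t f : Ω} (hf : f ∈ almostIntegral p t) (q : F[X]) :
    aeval t q * f ∈ almostIntegral p t := fun B hB => by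
  rw [mul_left_comm, map_mul]
  exact mul_le_one' (valuation_aeval_le_one _ hB q) (hf B hB)

theorem mem_monomialSpan_iff {n k : ℕ} {f : Ω} : f ∈ monomialSpan K p x n k ↔
    ∃ c : ℕ → K, f = ∑ l ∈ Finset.range k, algebraMap K Ω (c l) * digitMonomial p x n l := by
  rw [monomialSpan, show Set.Iio k = ↑(Finset.range k) by simp]
  constructor
  · intro h
    obtain ⟨c, hc⟩ := (Submodule.mem_span_image_finset_iff_exists_fun K).1 h
    refine ⟨fun l => if h : l ∈ Finset.range k then c ⟨l, h⟩ else 0, ?_⟩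
    rw [← hc, ← Finset.sum_coe_sort (Finset.range k)]
    refine Finset.sum_congr rfl fun l _ => ?_
    simp only [dif_pos l.2, Algebra.smul_def]
  · rintro ⟨c, rfl⟩
    refine sum_mem fun l hl => ?_
    rw [← Algebra.smul_def]
    exact Submodule.smul_mem _ _ (Submodule.subset_span ⟨l, hl, rfl⟩)

theorem towerShift_mem (h0 : x 0 ∈ (⊥ : IntermediateField K Ω)) (N i : ℕ) :
    towerShift p N x (i + 1) ∈ towerField K x i := by
  refine sum_mem fun t ht => ?_
  simp only [Finset.mem_filter, Finset.mem_range] at ht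
  have hm := mem_towerField h0 (show t ≤ i by omega) (K := K)
  exact div_mem (pow_mem (div_mem (neg_mem (pow_mem hm _))
    (add_mem (one_mem _) (add_mem (pow_mem hm _) hm))) _) (mem_towerField h0 (by omega))

omit [Algebra F Ω] [IsFractionRing F[X] K] [IsScalarTower F F[X] Ω] in
theorem mem_bot_of_eq (hx0 : x 0 = algebraMap F[X] Ω X) : x 0 ∈ (⊥ : IntermediateField K Ω) := by
  rw [hx0, IsScalarTower.algebraMap_apply F[X] K Ω]
  exact (⊥ : IntermediateField K Ω).algebraMap_mem _

variable [Finite F] [CharP Ω p] [Fact p.Prime]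

theorem IsTower.exists_isLaurent_mem_almostIntegral (K : Type*) [Field K] [Algebra K Ω]
    [Algebra F[X] K] [IsFractionRing F[X] K] [IsScalarTower F[X] K Ω]
    (hx : IsTower p x) (hp : 3 ≤ p)
    (hx0 : x 0 = algebraMap F[X] Ω X) {Z : Finset Ω}
    (hZ : ∀ y : Ω, y ^ p + y = ∏ ω ∈ Z, (y - ω)) (hZF : ∀ ω ∈ Z, ∃ a : F, ω = algebraMap F Ω a)
    {n k : ℕ} (hk : k < p ^ n) :
    ∃ c : ℕ → Ω, (∀ l, IsLaurent F (x 0) (c l)) ∧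
      digitMonomial p x n k + ∑ l ∈ Finset.range k, c l * digitMonomial p x n l ∈
        almostIntegral p (x 0) := by
  have hp2 : 2 ≤ p := by omega
  have hbot : x 0 ∈ (⊥ : IntermediateField K Ω) := mem_bot_of_eq hx0
  have hZ1 : ∀ B : ValuationSubring Ω, ∀ ω ∈ Z, ω ≠ 0 → B.valuation ω = 1 := by
    intro B ω hω h0
    obtain ⟨a, rfl⟩ := hZF ω hω
    exact Valuation.IsTrivialOn.eq_one a (by rintro rfl; simp at h0)
  obtain ⟨τ, hτ⟩ := mem_monomialSpan_iff.1 (digitMonomial_sub_mem_monomialSpan hx hp2 hbot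
    (g := towerShift p (2 * n) x) (fun i => towerShift_mem hbot (2 * n) i) hk)
  choose c hc1 hc2 using fun l => exists_isLaurent_map_sub_le (F := F) (Ω := Ω) (τ l)
    (p ^ n * ((p - 1) * n))
  rw [← hx0] at hc1 hc2
  refine ⟨c, hc1, fun B hB => ?_⟩
  rw [map_mul, map_mul]
  have hd1 : B.valuation (x 0 ^ (p - 1) + 1) ≤ 1 :=
    Valuation.map_add_le _ (by rw [map_pow]; exact pow_le_one' hB _) (by simp)
  rcases lt_or_eq_of_le hB with hB | hB
  · have hr0 : B.valuation (x 0) ≠ 0 := by simpa using hx.ne_zero 0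
    rw [B.valuation.map_pow_add_one_of_lt_one hp2 hB, mul_one, mul_comm]
    rw [← le_div_iff₀ (zero_lt_iff.2 hr0), one_div]
    have e : digitMonomial p x n k + ∑ l ∈ Finset.range k, c l * digitMonomial p x n l =
        digitMonomial p (fun i => x i - towerShift p (2 * n) x i) n k +
          ∑ l ∈ Finset.range k, (c l - algebraMap K Ω (τ l)) * digitMonomial p x n l := by
      simp_rw [sub_mul, Finset.sum_sub_distrib, ← hτ]
      ring
    rw [e]
    refine Valuation.map_add_le _ (hx.map_digitMonomial_shift_le _ hp hZ (hZ1 B) hB hk)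
      (Valuation.map_sum_le _ fun l hl => ?_)
    rw [Finset.mem_range] at hl
    rw [map_mul]
    refine (mul_le_mul' (hc2 l B hB)
      (hx.map_digitMonomial_le_inv_pow _ hp2 hZ (hZ1 B) hB (hl.trans hk))).trans ?_
    rw [← mul_pow, mul_inv_cancel₀ hr0, one_pow]
    exact (one_le_inv₀ (zero_lt_iff.2 hr0)).2 hB.le
  · rw [hB, one_mul]
    have hsum : ∀ g, (∀ l < p ^ n, B.valuation (digitMonomial p x n l) ≤ g) →
        B.valuation (digitMonomial p x n k + ∑ l ∈ Finset.range k,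
          c l * digitMonomial p x n l) ≤ g := by
      intro g hg
      refine Valuation.map_add_le _ (hg k hk) (Valuation.map_sum_le _ fun l hl => ?_)
      rw [Finset.mem_range] at hl
      rw [map_mul]
      exact (mul_le_of_le_one_left' ((hc1 l).map_le_one B hB)).trans (hg l (hl.trans hk))
    rcases lt_or_eq_of_le hd1 with hd | hd
    · obtain ⟨α, hα, hα1⟩ : ∃ α ∈ Z, B.valuation (x 0 - α) < 1 := by
        by_contra! hcon
        have h1 : B.valuation (x 0 ^ p + x 0) < 1 := by
          rwa [pow_add_self_eq_mul (by omega), map_mul, hB, one_mul]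
        rw [hZ, map_prod] at h1
        exact h1.not_ge (Finset.one_le_prod' hcon)
      have hα2 : α ^ p + α = 0 := by rw [hZ]; exact Finset.prod_eq_zero hα (sub_self α)
      have hα0 : α ≠ 0 := by
        rintro rfl
        rw [sub_zero, hB] at hα1
        exact hα1.false
      obtain ⟨-, h2, h3, -⟩ := hx.map_succ_of_sub_lt_one hp2 hα2 (hZ1 B α hα hα0) hα1
      rw [h2]
      have := hsum _ fun l hl =>
        hx.map_digitMonomial_le_of_sub_lt_one hp2 hα2 (hZ1 B α hα hα0) hα1 hl
      refine (mul_le_mul_right this _).trans ?_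
      rw [mul_inv_cancel₀]
      simpa using h3
    · rw [hd, one_mul]
      exact hsum 1 fun l hl => hx.map_digitMonomial_le_one hp2 hB hd hl

/-- By eliminating poles at infinity, the coefficients of an almost integral combination of
monomials can be prescribed up to bounded terms. -/
theorem IsTower.exists_low_sub_mem (K : Type*) [Field K] [Algebra K Ω]
    [Algebra F[X] K] [IsFractionRing F[X] K] [IsScalarTower F[X] K Ω]
    (hx : IsTower p x) (hp : 3 ≤ p)
    (hx0 : x 0 = algebraMap F[X] Ω X) {Z : Finset Ω}
    (hZ : ∀ y : Ω, y ^ p + y = ∏ ω ∈ Z, (y - ω)) (hZF : ∀ ω ∈ Z, ∃ a : F, ω = algebraMap F Ω a)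
    {n k : ℕ} (hk : k ≤ p ^ n) (c : ℕ → Ω) (hc : ∀ l, IsLaurent F (x 0) (c l)) :
    ∃ d : ℕ → Ω, (∀ l < k, IsLaurent F (x 0) (d l) ∧
      ∀ B : ValuationSubring Ω, 1 < B.valuation (x 0) → B.valuation (d l) ≤ 1) ∧
      ∑ l ∈ Finset.range k, (d l - c l) * digitMonomial p x n l ∈ almostIntegral p (x 0) := by
  induction k generalizing c with
  | zero => exact ⟨0, by simp, by simp⟩
  | succ k ih =>
    obtain ⟨a, ha1, ha2⟩ := hx.exists_isLaurent_mem_almostIntegral K hp hx0 hZ hZF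
      (show k < p ^ n by omega)
    obtain ⟨P, hP1, hP2⟩ := (hc k).exists_low (hx.ne_zero 0)
    obtain ⟨d, hd1, hd2⟩ := ih (by omega) (fun l => c l - aeval (x 0) P * a l)
      (fun l => (hc l).sub_aeval_mul (hx.ne_zero 0) (ha1 l) P)
    refine ⟨fun l => if l = k then c k - aeval (x 0) P else d l, fun l hl => ?_, ?_⟩
    · by_cases h : l = k
      · simp only [if_pos h]
        exact ⟨hP1, hP2⟩
      · simp only [if_neg h]
        exact hd1 l (by omega)
    · have e : ∑ l ∈ Finset.range (k + 1), ((if l = k then c k - aeval (x 0) P else d l) - c l) *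
          digitMonomial p x n l =
          ∑ l ∈ Finset.range k, (d l - (c l - aeval (x 0) P * a l)) * digitMonomial p x n l -
          aeval (x 0) P * (digitMonomial p x n k +
            ∑ l ∈ Finset.range k, a l * digitMonomial p x n l) := by
        have e' : ∑ l ∈ Finset.range k, ((if l = k then c k - aeval (x 0) P else d l) - c l) *
            digitMonomial p x n l =
            ∑ l ∈ Finset.range k, (d l - (c l - aeval (x 0) P * a l)) * digitMonomial p x n l -
              ∑ l ∈ Finset.range k, aeval (x 0) P * (a l * digitMonomial p x n l) := by
          rw [← Finset.sum_sub_distrib]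
          refine Finset.sum_congr rfl fun l hl => ?_
          rw [if_neg (Finset.mem_range.1 hl).ne]
          ring
        rw [Finset.sum_range_succ, mul_add, Finset.mul_sum, if_pos rfl, e']
        ring
      rw [e]
      exact sub_mem hd2 (aeval_mul_mem_almostIntegral ha2 P)

theorem IsTower.exists_low_mem (K : Type*) [Field K] [Algebra K Ω]
    [Algebra F[X] K] [IsFractionRing F[X] K] [IsScalarTower F[X] K Ω]
    (hx : IsTower p x) (hp : 3 ≤ p)
    (hx0 : x 0 = algebraMap F[X] Ω X) {Z : Finset Ω}
    (hZ : ∀ y : Ω, y ^ p + y = ∏ ω ∈ Z, (y - ω)) (hZF : ∀ ω ∈ Z, ∃ a : F, ω = algebraMap F Ω a)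
    {n k : ℕ} (hk : k < p ^ n) (i : ℕ) :
    ∃ d : ℕ → K, (∀ l < k, ∀ B : ValuationSubring Ω, 1 < B.valuation (x 0) →
        B.valuation (algebraMap K Ω (d l)) ≤ 1) ∧
      x 0 ^ i * digitMonomial p x n k +
        ∑ l ∈ Finset.range k, algebraMap K Ω (d l) * digitMonomial p x n l ∈
          almostIntegral p (x 0) := by
  obtain ⟨a, ha1, ha2⟩ := hx.exists_isLaurent_mem_almostIntegral K hp hx0 hZ hZF hk
  obtain ⟨d, hd1, hd2⟩ := hx.exists_low_sub_mem K hp hx0 hZ hZF hk.le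
    (fun l => aeval (x 0) (X ^ i : F[X]) * a l) (fun l => (ha1 l).aeval_mul _)
  have : ∀ l, ∃ c : K, l < k → d l = algebraMap K Ω c := fun l => by
    by_cases h : l < k
    · have := (hd1 l h).1
      rw [hx0] at this
      obtain ⟨c, hc⟩ := this.mem_range (K := K)
      exact ⟨c, fun _ => hc⟩
    · exact ⟨0, fun h' => absurd h' h⟩
  choose c hc using this
  refine ⟨c, fun l hl => by rw [← hc l hl]; exact (hd1 l hl).2, ?_⟩
  have e : x 0 ^ i * digitMonomial p x n k +
      ∑ l ∈ Finset.range k, algebraMap K Ω (c l) * digitMonomial p x n l =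
      ∑ l ∈ Finset.range k, (d l - aeval (x 0) (X ^ i : F[X]) * a l) * digitMonomial p x n l +
      aeval (x 0) (X ^ i : F[X]) * (digitMonomial p x n k +
        ∑ l ∈ Finset.range k, a l * digitMonomial p x n l) := by
    rw [mul_add, Finset.mul_sum, add_left_comm, ← Finset.sum_add_distrib]
    congr 1
    · simp
    · refine Finset.sum_congr rfl fun l hl => ?_
      rw [hc l (Finset.mem_range.1 hl)]
      ring
  rw [e]
  exact add_mem hd2 (aeval_mul_mem_almostIntegral ha2 _)

end LowElements

section Norm

theorem Valuation.map_norm_of_basis {K L Γ ι : Type*} [Field K] [Field L] [Algebra K L]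
    [LinearOrderedCommGroupWithZero Γ] [Fintype ι] [DecidableEq ι] (b : Module.Basis ι K L)
    (v : Valuation L Γ) (h : ∀ f i, v (b.repr f i • b i) ≤ v f) (f : L) :
    v (algebraMap K L (Algebra.norm K f)) = v f ^ Fintype.card ι := by
  have hb : ∀ i, v (b i) ≠ 0 := fun i => v.ne_zero_iff.2 (b.ne_zero i)
  have hle : ∀ f, v (algebraMap K L (Algebra.norm K f)) ≤ v f ^ Fintype.card ι := by
    intro f
    rw [Algebra.norm_eq_matrix_det b, Matrix.det_apply, map_sum]
    refine v.map_sum_le fun σ _ => ?_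
    rw [Units.smul_def, map_zsmul, zsmul_eq_mul, map_mul, map_prod, map_prod]
    have hs : v ((Equiv.Perm.sign σ : ℤ) : L) = 1 := by
      rcases Int.units_eq_one_or (Equiv.Perm.sign σ) with h | h <;> simp [h]
    rw [hs, one_mul]
    have hM : ∀ i j, v (algebraMap K L (Algebra.leftMulMatrix b f i j)) * v (b i) ≤
        v f * v (b j) := by
      intro i j
      rw [Algebra.leftMulMatrix_eq_repr_mul, ← map_mul, ← map_mul, ← Algebra.smul_def]
      exact h _ _
    have hp : ∏ i, v (b i) ≠ 0 := Finset.prod_ne_zero_iff.2 fun i _ => hb i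
    refine le_of_mul_le_mul_right ?_ (zero_lt_iff.2 hp)
    calc _ = ∏ i, v (algebraMap K L (Algebra.leftMulMatrix b f (σ i) i)) * v (b (σ i)) := by
          rw [Finset.prod_mul_distrib, Equiv.prod_comp σ fun i => v (b i)]
      _ ≤ ∏ i, v f * v (b i) := Finset.prod_le_prod' fun i _ => hM _ _
      _ = _ := by rw [Finset.prod_mul_distrib, Finset.prod_const, Finset.card_univ]
  rcases eq_or_ne f 0 with rfl | hf
  · have : Nonempty ι := b.index_nonempty
    have : FiniteDimensional K L := b.finiteDimensional_of_finite
    simp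
  refine le_antisymm (hle f) ?_
  have h1 : v (algebraMap K L (Algebra.norm K f)) * v (algebraMap K L (Algebra.norm K f⁻¹)) = 1 := by
    rw [← map_mul, ← map_mul, ← map_mul, mul_inv_cancel₀ hf, map_one, map_one, map_one]
  have h2 : v f ^ Fintype.card ι * (v f)⁻¹ ^ Fintype.card ι = 1 := by
    rw [← mul_pow, mul_inv_cancel₀ (v.ne_zero_iff.2 hf), one_pow]
  have h3 := hle f⁻¹
  rw [map_inv₀ v] at h3
  refine le_of_mul_le_mul_right ?_ (zero_lt_iff.2 (right_ne_zero_of_mul_eq_one h2))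
  rw [h2, ← h1]
  exact mul_le_mul_right h3 _

theorem linearIndependent_of_triangular {F K L : Type*} [Field F] [Field K] [AddCommGroup L]
    [Algebra F K] [Module K L] [Module F L] [IsScalarTower F K L] {m N : ℕ}
    (b : Module.Basis (Fin m) K L) {s t : K} (hs : s ≠ 0) (ht : Transcendental F t)
    (w : Fin m × Fin N → L) (hw : ∀ k i, b.repr (w (k, i)) k = s * t ^ (i : ℕ))
    (hw0 : ∀ k i, ∀ l > k, b.repr (w (k, i)) l = 0) : LinearIndependent F w := by
  classical
  have hsm : ∀ (a : F) y k, b.repr (a • y) k = a • b.repr y k := fun a y k => by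
    rw [← algebraMap_smul K a y, LinearEquiv.map_smul, Finsupp.smul_apply, smul_eq_mul,
      Algebra.smul_def]
  rw [Fintype.linearIndependent_iff]
  intro g hg
  by_contra! hcon
  obtain ⟨⟨k₀, i₀⟩, h₀⟩ := hcon
  obtain ⟨k, hk, hmax⟩ := (Finset.univ.filter fun k => ∃ i, g (k, i) ≠ 0).exists_max_image id
    ⟨k₀, by simpa using ⟨i₀, h₀⟩⟩
  simp only [Finset.mem_filter, Finset.mem_univ, true_and, id] at hk hmax
  obtain ⟨i, hi⟩ := hk
  have h1 : ∑ j, g (k, j) • (s * t ^ (j : ℕ)) = 0 := by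
    have h2 := congrArg (fun f => b.repr f k) hg
    simp only [map_sum, Finsupp.coe_finsetSum, Finset.sum_apply, map_zero,
      Finsupp.coe_zero, Pi.zero_apply] at h2
    rw [Fintype.sum_prod_type, Finset.sum_eq_single k] at h2
    · rw [← h2]
      refine Finset.sum_congr rfl fun j _ => ?_
      rw [← hw, hsm]
    · intro l _ hl
      refine Finset.sum_eq_zero fun j _ => ?_
      rw [hsm]
      rcases lt_or_gt_of_ne hl with h | h
      · rw [hw0 _ _ _ h, smul_zero]
      · have : g (l, j) = 0 := by
          by_contra h'
          exact (hmax l ⟨j, h'⟩).not_gt h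
        rw [this, zero_smul]
    · simp
  have h3 : aeval t (∑ j : Fin N, C (g (k, j)) * X ^ (j : ℕ)) = 0 := by
    rw [map_sum]
    refine (mul_eq_zero.1 (Eq.trans ?_ h1)).resolve_left hs
    rw [Finset.mul_sum]
    refine Finset.sum_congr rfl fun j _ => ?_
    rw [map_mul, aeval_C, map_pow, aeval_X, Algebra.smul_def]
    ring
  have h4 := (transcendental_iff.1 ht) _ h3
  have h5 := congrArg (fun q => coeff q (i : ℕ)) h4
  simp only [finsetSum_coeff, coeff_C_mul, coeff_X_pow, coeff_zero, Fin.val_inj, mul_ite,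
    mul_one, mul_zero, Finset.sum_ite_eq, Finset.mem_univ, if_true] at h5
  exact hi h5

end Norm

section TowerBasis

variable {F K Ω : Type*} [Field F] [Field K] [Field Ω] [Algebra F Ω] [Algebra K Ω] [Algebra F[X] K]
  [IsFractionRing F[X] K] [Algebra F[X] Ω] [IsScalarTower F[X] K Ω] [IsScalarTower F F[X] Ω]
  {p : ℕ} {x : ℕ → Ω}

theorem IsTower.digitMonomial_ne_zero (hx : IsTower p x) (n k : ℕ) : digitMonomial p x n k ≠ 0 := by
  induction n generalizing k with
  | zero => exact one_ne_zero
  | succ n ih => exact mul_ne_zero (ih _) (pow_ne_zero _ (hx.ne_zero _))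

variable [Finite F]

omit [Algebra F[X] Ω] [IsScalarTower F F[X] Ω] in
theorem valuation_aeval_eq_pow {t : Ω} {B : ValuationSubring Ω} (hB : 1 < B.valuation t)
    {q : F[X]} (hq : q ≠ 0) : B.valuation (aeval t q) = B.valuation t ^ q.natDegree :=
  Polynomial.valuation_aeval_eq_valuation_X_pow_natDegree_of_one_lt_valuation_X _ hB hq

theorem exists_valuation_eq_zpow {B : ValuationSubring Ω}
    (hB : 1 < B.valuation (algebraMap F[X] Ω X)) {c : K} (hc : c ≠ 0) :
    ∃ z : ℤ, B.valuation (algebraMap K Ω c) = B.valuation (algebraMap F[X] Ω X) ^ z := by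
  obtain ⟨a, b, hb, rfl⟩ := IsFractionRing.div_surjective (A := F[X]) c
  have ha : a ≠ 0 := by rintro rfl; simp at hc
  refine ⟨a.natDegree - b.natDegree, ?_⟩
  rw [map_div₀, map_div₀, ← IsScalarTower.algebraMap_apply, ← IsScalarTower.algebraMap_apply,
    algebraMap_eq_aeval a, algebraMap_eq_aeval b, valuation_aeval_eq_pow hB ha,
    valuation_aeval_eq_pow hB (nonZeroDivisors.ne_zero hb),
    zpow_sub₀ (zero_lt_one.trans hB).ne', zpow_natCast, zpow_natCast]

variable (F K) in
/-- The monomials form a basis, which is orthogonal at infinity. -/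
theorem IsTower.exists_basis (hx : IsTower p x) (hp : 2 ≤ p) (hx0 : x 0 = algebraMap F[X] Ω X)
    {B : ValuationSubring Ω} (hB : 1 < B.valuation (x 0)) (n : ℕ) :
    ∃ b : Module.Basis (Fin (p ^ n)) K (towerField K x n),
      (∀ k, (b k : Ω) = digitMonomial p x n k) ∧
      ∀ f i, B.valuation ((b.repr f i • b i : towerField K x n) : Ω) ≤ B.valuation (f : Ω) := by
  have hbot : x 0 ∈ (⊥ : IntermediateField K Ω) := mem_bot_of_eq hx0
  set e : Fin (p ^ n) → towerField K x n := fun k =>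
    ⟨digitMonomial p x n k, digitMonomial_mem_towerField (fun i hi => mem_towerField hbot hi) k⟩
  have horth : ∀ (c : Fin (p ^ n) → K) (k : Fin (p ^ n)),
      B.valuation ((c k • e k : towerField K x n) : Ω) ≤
        B.valuation ((∑ l, c l • e l : towerField K x n) : Ω) := by
    intro c k
    have := hx.map_mul_digitMonomial_le hp hB
      (fun l => if h : l < p ^ n then algebraMap K Ω (c ⟨l, h⟩) else 0) (n := n) ?_ k.2
    · rw [Finset.sum_range] at this
      simpa [e, Algebra.smul_def] using this
    · intro l hl hc
      simp only [dif_pos hl] at hc ⊢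
      rw [hx0] at hB ⊢
      exact exists_valuation_eq_zpow hB (by rintro h; simp [h] at hc)
  have hli : LinearIndependent K e := by
    rw [Fintype.linearIndependent_iff]
    intro c hc k
    have := horth c k
    rw [hc, ZeroMemClass.coe_zero, map_zero, le_zero_iff, Valuation.zero_iff,
      ZeroMemClass.coe_eq_zero, smul_eq_zero] at this
    refine this.resolve_right fun h => hx.digitMonomial_ne_zero n k ?_
    exact congrArg Subtype.val h
  have hsp : ⊤ ≤ Submodule.span K (Set.range e) := by
    intro f _
    obtain ⟨c, hc⟩ := mem_monomialSpan_iff.1 (hx.mem_monomialSpan hp hbot n f.2)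
    have : f = ∑ k : Fin (p ^ n), c k • e k := by
      refine Subtype.ext ?_
      rw [hc, Finset.sum_range]
      simp [e, Algebra.smul_def]
    rw [this]
    exact sum_mem fun k _ => Submodule.smul_mem _ _ (Submodule.subset_span ⟨k, rfl⟩)
  have hbe : ∀ k, e k = Module.Basis.mk hli hsp k := fun k => by rw [Module.Basis.mk_apply]
  refine ⟨Module.Basis.mk hli hsp, fun k => by rw [← hbe], fun f i => ?_⟩
  have h := horth (fun k => (Module.Basis.mk hli hsp).repr f k) i
  simp_rw [hbe, Module.Basis.sum_repr] at h
  exact h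

end TowerBasis

section DegreeValuation

variable {F L O Γ : Type*} (K : Type*) [Field F] [Field K] [Field L] [CommRing O]
  [IsDedekindDomain O] [Algebra F[X] K] [IsFractionRing F[X] K] [Algebra K L] [Algebra F[X] L]
  [IsScalarTower F[X] K L] [FiniteDimensional K L] [Algebra F[X] O] [Module.Finite F[X] O]
  [Module.IsTorsionFree F[X] O] [Algebra O L] [IsIntegralClosure O F[X] L]
  [IsScalarTower F[X] O L] [LinearOrderedCommGroupWithZero Γ] {v : Valuation L Γ} {m : ℕ}

theorem valuation_pow_eq_pow_idealDegree
    (hv : ∀ q : F[X], q ≠ 0 → v (algebraMap F[X] L q) = v (algebraMap F[X] L X) ^ q.natDegree)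
    (hN : ∀ f, v (algebraMap K L (Algebra.norm K f)) = v f ^ m) {f : O} (hf : f ≠ 0) :
    v (algebraMap O L f) ^ m = v (algebraMap F[X] L X) ^ idealDegree F (Ideal.span {f}) := by
  rw [idealDegree_span_singleton, ← hv, ← hN, IsScalarTower.algebraMap_apply F[X] K L,
    Algebra.algebraMap_intNorm (L := L)]
  intro h
  have h1 := Algebra.algebraMap_intNorm (A := F[X]) (K := K) (L := L) f
  rw [h, map_zero, eq_comm, Algebra.norm_eq_zero_iff] at h1
  exact hf ((IsIntegralClosure.algebraMap_injective O F[X] L) (by rw [h1, map_zero]))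

include K in
theorem idealDegree_span_le (hX : 1 < v (algebraMap F[X] L X))
    (hv : ∀ q : F[X], q ≠ 0 → v (algebraMap F[X] L q) = v (algebraMap F[X] L X) ^ q.natDegree)
    (hN : ∀ f, v (algebraMap K L (Algebra.norm K f)) = v f ^ m) {f : O} (hf : f ≠ 0) {a : ℕ}
    (h : v (algebraMap O L f) ≤ v (algebraMap F[X] L X) ^ a) :
    idealDegree F (Ideal.span {f}) ≤ m * a := by
  have h1 := valuation_pow_eq_pow_idealDegree K hv hN hf
  have h2 := pow_le_pow_left₀ zero_le h m
  rw [h1, ← pow_mul, mul_comm a] at h2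
  exact (pow_le_pow_iff_right₀ hX).1 h2

include K in
theorem idealDegree_span_add_le (hX : 1 < v (algebraMap F[X] L X))
    (hv : ∀ q : F[X], q ≠ 0 → v (algebraMap F[X] L q) = v (algebraMap F[X] L X) ^ q.natDegree)
    (hN : ∀ f, v (algebraMap K L (Algebra.norm K f)) = v f ^ m) {f g : O} (hf : f ≠ 0) (hg : g ≠ 0)
    (hfg : f + g ≠ 0) : idealDegree F (Ideal.span {f + g}) ≤
      max (idealDegree F (Ideal.span {f})) (idealDegree F (Ideal.span {g})) := by
  rw [le_max_iff, ← pow_le_pow_iff_right₀ hX, ← pow_le_pow_iff_right₀ hX,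
    ← valuation_pow_eq_pow_idealDegree K hv hN hf, ← valuation_pow_eq_pow_idealDegree K hv hN hg,
    ← valuation_pow_eq_pow_idealDegree K hv hN hfg, map_add]
  rcases le_max_iff.1 (v.map_add (algebraMap O L f) (algebraMap O L g)) with h | h
  · exact Or.inl (pow_le_pow_left₀ zero_le h m)
  · exact Or.inr (pow_le_pow_left₀ zero_le h m)

end DegreeValuation

section LowSpace

variable {F K Ω O : Type*} [Field F] [Field K] [Field Ω] [Algebra F Ω] [Algebra K Ω]
  [Algebra F[X] K] [IsFractionRing F[X] K] [Algebra F[X] Ω] [IsScalarTower F[X] K Ω]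
  [IsScalarTower F F[X] Ω] [Algebra F K] [IsScalarTower F F[X] K] [IsScalarTower F K Ω] [Finite F]
  {p : ℕ} [CharP Ω p] [Fact p.Prime] {x : ℕ → Ω} {n : ℕ}
  [CommRing O] [Algebra O (towerField K x n)] [IsIntegralClosure O F[X] (towerField K x n)]
  [Algebra F O] [IsScalarTower F O (towerField K x n)]

variable (O) in
/-- A large space of functions with few poles at infinity. -/
theorem IsTower.exists_submodule (hx : IsTower p x) (hp : 3 ≤ p)
    (hx0 : x 0 = algebraMap F[X] Ω X) {Z : Finset Ω}
    (hZ : ∀ y : Ω, y ^ p + y = ∏ ω ∈ Z, (y - ω)) (hZF : ∀ ω ∈ Z, ∃ a : F, ω = algebraMap F Ω a)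
    {B : ValuationSubring Ω} (hB : 1 < B.valuation (x 0)) (N : ℕ) :
    ∃ V : Submodule F O, Module.finrank F V = p ^ n * N ∧
      ∀ f ∈ V, B.valuation (algebraMap O (towerField K x n) f : Ω) ≤
        B.valuation (x 0) ^ (p + N) := by
  obtain ⟨b, hb, -⟩ := hx.exists_basis F K (by omega) hx0 hB n
  choose d hd1 hd2 using fun (k : Fin (p ^ n)) (i : Fin N) =>
    hx.exists_low_mem K hp hx0 hZ hZF k.2 (i : ℕ)
  set t : K := algebraMap F[X] K X with ht
  have htΩ : algebraMap K Ω t = x 0 := by rw [hx0, ht, ← IsScalarTower.algebraMap_apply]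
  set s : K := t * (t ^ (p - 1) + 1) with hs
  have hsΩ : algebraMap K Ω s = x 0 * (x 0 ^ (p - 1) + 1) := by
    rw [hs, map_mul, map_add, map_pow, map_one, htΩ]
  have hs0 : s ≠ 0 := by
    intro h
    rw [h, map_zero, eq_comm, mul_eq_zero] at hsΩ
    exact hsΩ.elim (hx.ne_zero 0) (hx.den_ne_zero 0)
  set y : Fin (p ^ n) × Fin N → towerField K x n := fun a =>
    s • (t ^ (a.2 : ℕ) • b a.1 + ∑ l : Fin a.1, d a.1 a.2 l • b (l.castLE a.1.2.le)) with hy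
  have hyΩ : ∀ k i, (y (k, i) : Ω) = x 0 * (x 0 ^ (p - 1) + 1) *
      (x 0 ^ (i : ℕ) * digitMonomial p x n k +
        ∑ l ∈ Finset.range k, algebraMap K Ω (d k i l) * digitMonomial p x n l) := by
    intro k i
    rw [Finset.sum_range]
    simp [hy, Algebra.smul_def, hb, ← hsΩ, htΩ]
  have h_int : ∀ a, IsIntegral F[X] (y a) := by
    rintro ⟨k, i⟩
    have : IsIntegral F[X] (y (k, i) : Ω) := by
      refine isIntegral_of_forall_valuationSubring (X : F[X]) fun C hC => ?_
      rw [hyΩ]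
      exact hd2 k i C (by rwa [hx0])
    exact (isIntegral_algHom_iff ((towerField K x n).val.restrictScalars F[X])
      (towerField K x n).val.injective).1 this
  have hval : ∀ a, B.valuation (y a : Ω) ≤ B.valuation (x 0) ^ (p + N) := by
    rintro ⟨k, i⟩
    have hmon := fun l hl => hx.map_digitMonomial_le_of_one_lt (by omega : 2 ≤ p) hB (n := n)
      (k := l) hl
    rw [hyΩ, ← pow_add_self_eq_mul (by omega), map_mul,
      B.valuation.map_pow_add_self_of_one_lt (by omega) hB, pow_add]
    refine mul_le_mul_right (Valuation.map_add_le _ ?_ (Valuation.map_sum_le _ fun l hl => ?_)) _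
    · rw [map_mul, map_pow]
      refine (mul_le_mul_right (hmon _ k.2) _).trans ?_
      rw [← pow_succ]
      exact pow_le_pow_right₀ hB.le i.2
    · rw [Finset.mem_range] at hl
      rw [map_mul]
      refine (mul_le_mul' (hd1 k i l hl B hB) (hmon l (hl.trans k.2))).trans ?_
      rw [one_mul]
      exact le_self_pow₀ hB.le i.pos.ne'
  set w : Fin (p ^ n) × Fin N → O := fun a => IsIntegralClosure.mk' O (y a) (h_int a) with hw
  have hwy : ∀ a, algebraMap O (towerField K x n) (w a) = y a := fun a =>
    IsIntegralClosure.algebraMap_mk' O (y a) (h_int a)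
  have hli : LinearIndependent F w := by
    refine LinearIndependent.of_comp (IsScalarTower.toAlgHom F O (towerField K x n)).toLinearMap ?_
    have : (IsScalarTower.toAlgHom F O (towerField K x n)).toLinearMap ∘ w = y := funext hwy
    rw [this]
    have htr : Transcendental F t :=
      (transcendental_algebraMap_iff (IsFractionRing.injective F[X] K)).2 (transcendental_X F)
    have hsum : ∀ (k : Fin (p ^ n)) i, ∀ j ≥ k,
        (∑ l : Fin k, d k i l • Finsupp.single (l.castLE k.2.le) (1 : K)) j = 0 := by
      intro k i j hj
      rw [Finsupp.coe_finsetSum, Finset.sum_apply]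
      refine Finset.sum_eq_zero fun l _ => ?_
      rw [Finsupp.smul_apply, Finsupp.single_apply, if_neg, smul_zero]
      rintro rfl
      exact absurd hj (not_le.2 l.2)
    refine linearIndependent_of_triangular b hs0 htr y (fun k i => ?_) fun k i l hl => ?_
    · simp only [hy, map_smul, map_add, map_sum, Finsupp.smul_apply, Finsupp.add_apply,
        hsum k i k le_rfl, b.repr_self, Finsupp.single_apply, smul_eq_mul, if_true, mul_one, add_zero]
    · simp only [hy, map_smul, map_add, map_sum, Finsupp.smul_apply, Finsupp.add_apply,
        hsum k i l hl.le, b.repr_self, Finsupp.single_apply, smul_eq_mul, if_neg hl.ne, mul_zero,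
        add_zero]
  refine ⟨Submodule.span F (Set.range w), by simp [finrank_span_eq_card hli], fun f hf => ?_⟩
  induction hf using Submodule.span_induction with
  | mem f hf =>
    obtain ⟨a, rfl⟩ := hf
    rw [hwy]
    exact hval a
  | zero => simp
  | add f g _ _ hf hg =>
    rw [map_add, IntermediateField.coe_add]
    exact Valuation.map_add_le _ hf hg
  | smul c f _ hf =>
    rw [← IsScalarTower.coe_toAlgHom' F O, map_smul, IntermediateField.coe_smul, Algebra.smul_def,
      map_mul]
    refine (mul_le_of_le_one_left' ?_).trans hf
    by_cases h : c = 0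
    · simp [h]
    · exact (Valuation.IsTrivialOn.eq_one c h).le

end LowSpace

section SplitPrimes

variable {F : Type*} [Field F] {O : Type*} [CommRing O]
    [Algebra F[X] O] [Module.Finite F[X] O] [Module.IsTorsionFree F[X] O]

/-- The primes above a completely split linear place have degree one. -/
theorem idealDegree_eq_one_of_split [IsDedekindDomain O] {κ : Type*} [Fintype κ] {P : κ → Ideal O} {s : F}
    (hinj : Function.Injective P) (hP : ∀ i, (P i).IsPrime) (hP0 : ∀ i, P i ≠ ⊥)
    (hs : ∀ i, algebraMap F[X] O (X - C s) ∈ P i) (hκ : Fintype.card κ = Module.finrank F[X] O)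
    (i : κ) : idealDegree F (P i) = 1 := by
  classical
  obtain ⟨J, hJ⟩ := prod_primes_dvd_of_dvd (Finset.univ.image P)
    (J := Ideal.span {algebraMap F[X] O (X - C s)}) (by simp [hP, hP0]) (by
      simpa [Ideal.dvd_iff_le, Ideal.span_singleton_le_iff_mem] using hs)
  rw [Finset.prod_image fun _ _ _ _ h => hinj h] at hJ
  have hne : Ideal.span {algebraMap F[X] O (X - C s)} ≠ ⊥ := by
    rw [Ne, Ideal.span_singleton_eq_bot]
    exact fun h => X_sub_C_ne_zero s (FaithfulSMul.algebraMap_injective F[X] O (by rw [h, map_zero]))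
  have h1 : ∏ i, P i ≠ ⊥ := by
    intro h; rw [h, Ideal.bot_mul] at hJ; exact hne hJ
  have h2 : J ≠ ⊥ := by
    intro h; rw [h, Ideal.mul_bot] at hJ; exact hne hJ
  have h3 := idealDegree_map (F := F) (O := O) (X - C s)
  rw [hJ, idealDegree_mul _ _ h1 h2, idealDegree_prod _ _ fun i _ => hP0 i, natDegree_X_sub_C,
    mul_one, ← hκ, ← Finset.card_univ, Finset.card_eq_sum_ones] at h3
  have h4 := fun i => one_le_idealDegree (F := F) (hP i) (hP0 i)
  refine ((Finset.sum_eq_sum_iff_of_le fun i _ => h4 i).1 ?_ i (Finset.mem_univ i)).symm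
  have := Finset.sum_le_sum fun i (_ : i ∈ Finset.univ) => h4 i
  omega

/-- The primes above a completely split linear place have residue field equal to the base field. -/
theorem exists_sub_algebraMap_mem_of_split {κ : Type*} [Fintype κ] {P : κ → Ideal O} {s : F}
    (hinj : Function.Injective P) (hP : ∀ i, (P i).IsPrime)
    (hs : ∀ i, algebraMap F[X] O (X - C s) ∈ P i) (hκ : Fintype.card κ = Module.finrank F[X] O)
    (i : κ) (f : O) : ∃ c : F, f - algebraMap F[X] O (C c) ∈ P i := by
  classical
  set 𝔭 : Ideal F[X] := Ideal.span {X - C s} with h𝔭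
  have hmax : 𝔭.IsMaximal :=
    PrincipalIdealRing.isMaximal_of_irreducible (irreducible_X_sub_C s)
  have hover : ∀ i, (P i).LiesOver 𝔭 := fun i => ⟨hmax.eq_of_le ((hP i).comap (algebraMap F[X] O)).ne_top (by
    rw [h𝔭, Ideal.span_singleton_le_iff_mem]; exact hs i)⟩
  have hfin := Algebra.QuasiFinite.finite_primesOver (S := O) 𝔭
  let := hfin.fintype
  have hsum := Ideal.sum_ramification_inertia_eq_finrank (p := 𝔭) (S := O)
  set Q : κ → 𝔭.primesOver O := fun i => ⟨P i, hP i, hover i⟩ with hQ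
  have hQinj : Function.Injective Q := fun i j h => hinj congr(($h).1)
  have hpos : ∀ q : 𝔭.primesOver O, 0 < q.1.ramificationIdx F[X] * q.1.inertiaDeg F[X] :=
    fun q => by
      have := q.2.1
      exact Nat.mul_pos (Ideal.ramificationIdx_pos _ _) (Ideal.inertiaDeg_pos _ _)
  have h1 : ∑ i : κ, (1 : ℕ) = ∑ i, (Q i).1.ramificationIdx F[X] * (Q i).1.inertiaDeg F[X] := by
    refine le_antisymm (Finset.sum_le_sum fun i _ => hpos _) ?_
    rw [← Finset.sum_image (f := fun q : 𝔭.primesOver O =>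
      q.1.ramificationIdx F[X] * q.1.inertiaDeg F[X]) fun _ _ _ _ h => hQinj h]
    refine (Finset.sum_le_sum_of_subset (Finset.subset_univ _)).trans ?_
    rw [hsum, ← hκ]
    simp
  have h2 := (Finset.sum_eq_sum_iff_of_le fun i _ => hpos (Q i)).1 h1 i (Finset.mem_univ i)
  have h3 : (P i).inertiaDeg F[X] = 1 := Nat.eq_one_of_mul_eq_one_left h2.symm
  have := hP i
  have := hover i
  have hPm : (P i).IsMaximal := Ideal.isMaximal_of_isIntegral_of_isMaximal_comap (P i)
    (R := F[X]) (by
      have h := (hover i).over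
      rw [Ideal.under] at h
      rwa [← h])
  let : Field (F[X] ⧸ 𝔭) := Ideal.Quotient.field 𝔭
  rw [Ideal.inertiaDeg_eq_of_isMaximal 𝔭 (P i)] at h3
  obtain ⟨g, hg⟩ := (Module.Free.bijective_algebraMap_of_finrank_eq_one h3).2
    (Ideal.Quotient.mk (P i) f)
  obtain ⟨g, rfl⟩ := Ideal.Quotient.mk_surjective g
  refine ⟨g.eval s, ?_⟩
  have h4 : f - algebraMap F[X] O g ∈ P i := by
    rw [← Ideal.Quotient.eq, ← hg]; rfl
  have h5 : algebraMap F[X] O (g - C (g.eval s)) ∈ P i := by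
    obtain ⟨q, hq⟩ := X_sub_C_dvd_sub_C_eval (p := g) (a := s)
    rw [hq, map_mul]
    exact Ideal.mul_mem_right _ _ (hs i)
  simpa using (P i).add_mem h4 h5

end SplitPrimes

section Residue

variable {F Ω : Type*} [Field F] [Field Ω] [Algebra F Ω] {Γ : Type*}
  [LinearOrderedCommGroupWithZero Γ] {v : Valuation Ω Γ} [v.IsTrivialOn F] {p : ℕ}

theorem Valuation.map_algebraMap_eq_one {c : F} (hc : c ≠ 0) : v (algebraMap F Ω c) = 1 :=
  Valuation.IsTrivialOn.eq_one c hc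

/-- Reduction of a quotient. -/
theorem Valuation.map_div_sub_div_lt_one {a b a' b' : Ω} (ha' : v a' ≤ 1) (hb' : v b' = 1)
    (ha : v (a - a') < 1) (hb : v (b - b') < 1) : v (a / b - a' / b') < 1 := by
  have hvb : v b = 1 := by
    have : b = b' + (b - b') := by ring
    rw [this, v.map_add_eq_of_lt_left (by rwa [hb']), hb']
  have hb0 : b ≠ 0 := by rintro rfl; simp at hvb
  have hb0' : b' ≠ 0 := by rintro rfl; simp at hb'
  have : a / b - a' / b' = ((a - a') * b' - a' * (b - b')) / (b * b') := by
    field_simp; ring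
  rw [this, map_div₀, map_mul, hvb, hb', mul_one, div_one]
  refine v.map_sub_lt (by rwa [map_mul, hb', mul_one]) ?_
  rw [map_mul]
  exact mul_lt_one_of_nonneg_of_lt_one_right ha' zero_le hb

variable [CharP Ω p] [Fact p.Prime]

/-- Along a tower starting at a split point, all residues lie in the base field. -/
theorem IsTower.exists_residue {x : ℕ → Ω} (hx : IsTower p x) (hp : 3 ≤ p)
    (hF : ∀ a : F, a ^ (p ^ 2) = a) {Z : Finset Ω}
    (hZ : ∀ y : Ω, y ^ p + y = ∏ ω ∈ Z, (y - ω)) (hZF : ∀ ω ∈ Z, ∃ a : F, ω = algebraMap F Ω a)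
    {s : F} (hs : s ^ p + s ≠ 0) (h0 : v (x 0 - algebraMap F Ω s) < 1) (i : ℕ) :
    ∃ c : F, v (x i - algebraMap F Ω c) < 1 ∧ c ^ p + c ≠ 0 := by
  have : CharP F p := (algebraMap F Ω).charP (algebraMap F Ω).injective p
  induction i with
  | zero => exact ⟨s, h0, hs⟩
  | succ i ih =>
    obtain ⟨c, hc, hc0⟩ := ih
    have hcne : c ≠ 0 := by
      rintro rfl
      simp [(Fact.out : p.Prime).ne_zero] at hc0
    have h2 : (2 : F) ≠ 0 := by
      intro h
      have := (CharP.cast_eq_zero_iff F p 2).1 (by exact_mod_cast h)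
      exact absurd (Nat.le_of_dvd two_pos this) (by omega)
    have h2p : (2 : F) ^ p = 2 := by
      simpa [frobenius_def] using map_ofNat (frobenius F p) 2
    set e : F := c ^ (p + 1) / (c ^ p + c) with he
    have he0 : e ≠ 0 := div_ne_zero (pow_ne_zero _ hcne) hc0
    have hep : e ^ p = e := by
      rw [he, div_pow, add_pow_char, ← pow_mul, ← pow_mul, add_mul, one_mul, ← sq, pow_add, hF,
        pow_succ, add_comm, mul_comm c]
    have hroot : (e / 2) ^ p + e / 2 = e := by
      rw [div_pow, h2p, hep]
      field_simp
      ring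
    have hstep : x (i + 1) ^ p + x (i + 1) = x i ^ (p + 1) / (x i ^ p + x i) := by
      rw [hx.step, pow_add_self_eq_mul (by omega), pow_succ, mul_comm (x i ^ p),
        mul_div_mul_left _ _ (hx.ne_zero i)]
    have hxc : x i ^ p - algebraMap F Ω c ^ p = (x i - algebraMap F Ω c) ^ p :=
      (sub_pow_char _ _).symm
    have hcp : v ((x i - algebraMap F Ω c) ^ p) < 1 := by
      rw [map_pow]; exact pow_lt_one₀ zero_le hc (by omega)
    have hvc : v (algebraMap F Ω c) = 1 := Valuation.map_algebraMap_eq_one hcne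
    have hvx : v (x i) = 1 := by
      have : x i = algebraMap F Ω c + (x i - algebraMap F Ω c) := by ring
      rw [this, v.map_add_eq_of_lt_left (by rwa [hvc]), hvc]
    have hlt : v ((x (i + 1) - algebraMap F Ω (e / 2)) ^ p +
        (x (i + 1) - algebraMap F Ω (e / 2))) < 1 := by
      have h1 : (x (i + 1) - algebraMap F Ω (e / 2)) ^ p + (x (i + 1) - algebraMap F Ω (e / 2)) =
          x i ^ (p + 1) / (x i ^ p + x i) -
            algebraMap F Ω c ^ (p + 1) / (algebraMap F Ω c ^ p + algebraMap F Ω c) := by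
        rw [← hstep, ← map_pow, ← map_pow, ← map_add, ← map_div₀, ← he, sub_pow_char,
          ← map_pow]
        nth_rw 3 [← hroot]
        rw [map_add]
        ring
      rw [h1]
      refine Valuation.map_div_sub_div_lt_one ?_ ?_ ?_ ?_
      · rw [map_pow, hvc, one_pow]
      · rw [← map_pow, ← map_add]; exact Valuation.map_algebraMap_eq_one hc0
      · have : x i ^ (p + 1) - algebraMap F Ω c ^ (p + 1) = x i ^ p * (x i - algebraMap F Ω c) +
            algebraMap F Ω c * (x i - algebraMap F Ω c) ^ p := by
          rw [← hxc]; ring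
        rw [this]
        refine v.map_add_lt ?_ ?_
        · rwa [map_mul, map_pow, hvx, one_pow, one_mul]
        · rwa [map_mul, hvc, one_mul]
      · have : x i ^ p + x i - (algebraMap F Ω c ^ p + algebraMap F Ω c) =
            (x i - algebraMap F Ω c) ^ p + (x i - algebraMap F Ω c) := by
          rw [← hxc]; ring
        rw [this]
        exact v.map_add_lt hcp hc
    rw [hZ, map_prod] at hlt
    obtain ⟨ω, hω, hωlt⟩ : ∃ ω ∈ Z, v (x (i + 1) - algebraMap F Ω (e / 2) - ω) < 1 := by
      by_contra! h
      refine hlt.not_ge ?_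
      rw [← Finset.prod_const_one (s := Z)]
      exact Finset.prod_le_prod (fun _ _ => zero_le) h
    obtain ⟨a, rfl⟩ := hZF ω hω
    have ha : a ^ p + a = 0 := by
      apply (algebraMap F Ω).injective
      rw [map_add, map_pow, hZ, map_zero]
      exact Finset.prod_eq_zero hω (sub_self _)
    refine ⟨e / 2 + a, by rwa [map_add, ← sub_sub], ?_⟩
    rw [add_pow_char, add_add_add_comm, hroot, ha, add_zero]
    exact he0

end Residue

section PlaceIdeal

/-- The ideal of elements of positive valuation. -/
def Valuation.ltOneIdeal {R Γ : Type*} [CommRing R] [LinearOrderedCommGroupWithZero Γ]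
    (w : Valuation R Γ) (hw : ∀ f, w f ≤ 1) : Ideal R where
  carrier := {f | w f < 1}
  zero_mem' := by simp
  add_mem' := fun hf hg => w.map_add_lt hf hg
  smul_mem' := fun f g hg => by
    change w (f * g) < 1
    rw [map_mul]
    exact mul_lt_one_of_nonneg_of_lt_one_right (hw f) zero_le hg

theorem Valuation.isPrime_ltOneIdeal {R Γ : Type*} [CommRing R] [LinearOrderedCommGroupWithZero Γ]
    (w : Valuation R Γ) (hw : ∀ f, w f ≤ 1) : (w.ltOneIdeal hw).IsPrime where
  ne_top' := fun h => by
    have : (1 : R) ∈ w.ltOneIdeal hw := h ▸ Submodule.mem_top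
    exact absurd (show w 1 < 1 from this) (by simp)
  mem_or_mem' := by
    intro f g h
    change w (f * g) < 1 at h
    change w f < 1 ∨ w g < 1
    by_contra! h'
    rw [map_mul, le_antisymm (hw f) h'.1, le_antisymm (hw g) h'.2, one_mul] at h
    exact h.false

theorem ValuationSubring.valuation_le_one_of_isIntegral {R Ω : Type*} [CommRing R] [Field Ω]
    [Algebra R Ω] (B : ValuationSubring Ω) (hB : ∀ a : R, B.valuation (algebraMap R Ω a) ≤ 1)
    {f : Ω} (hf : IsIntegral R f) : B.valuation f ≤ 1 := by
  obtain ⟨q, hq, hqf⟩ := hf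
  have hfB : IsIntegral B f := by
    refine ⟨q.map ((algebraMap R Ω).codRestrict B.toSubring fun a =>
      (B.valuation_le_one_iff _).1 (hB a)), hq.map _, ?_⟩
    rw [eval₂_map]
    exact hqf
  obtain ⟨b, rfl⟩ := IsIntegrallyClosed.isIntegral_iff.1 hfB
  exact B.valuation_le_one b

theorem algHom_eq_of_mem_towerField {K Ω : Type*} [Field K] [Field Ω] [Algebra K Ω] {x : ℕ → Ω}
    {σ σ' : Ω →ₐ[K] Ω} {n : ℕ} (h : ∀ i ≤ n, σ (x i) = σ' (x i)) {f : Ω}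
    (hf : f ∈ towerField K x n) : σ f = σ' f := by
  induction n generalizing f with
  | zero =>
    obtain ⟨a, rfl⟩ := IntermediateField.mem_bot.1 hf
    rw [σ.commutes, σ'.commutes]
  | succ n ih =>
    replace hf : f ∈ IntermediateField.adjoin (towerField K x n) {x (n + 1)} := hf
    induction hf using IntermediateField.adjoin_induction with
    | mem y hy => rw [Set.mem_singleton_iff.1 hy]; exact h _ le_rfl
    | algebraMap y => exact ih (fun i hi => h i (by omega)) y.2
    | add y z _ _ hy hz => rw [map_add, map_add, hy, hz]
    | inv y _ hy => rw [map_inv₀, map_inv₀, hy]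
    | mul y z _ _ hy hz => rw [map_mul, map_mul, hy, hz]

theorem digitMonomial_zero_right {Ω : Type*} [Monoid Ω] (p : ℕ) (y : ℕ → Ω) (n : ℕ) :
    digitMonomial p y n 0 = 1 := by
  induction n with
  | zero => rfl
  | succ n ih => simp [digitMonomial, ih]

theorem digitMonomial_pow_right {Ω : Type*} [Monoid Ω] {p : ℕ} (hp : 0 < p) (y : ℕ → Ω) (n : ℕ) :
    digitMonomial p y (n + 1) (p ^ n) = y (n + 1) := by
  simp [digitMonomial, digitMonomial_zero_right, Nat.div_self (pow_pos hp n)]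

variable {F K Ω O : Type*} [Field F] [Field K] [Field Ω] [Algebra F Ω] [Algebra K Ω]
  [Algebra F[X] K] [Algebra F[X] Ω] [IsScalarTower F[X] K Ω] [Finite F]
  {p : ℕ} [CharP Ω p] [Fact p.Prime] {x : ℕ → Ω} {n : ℕ}

theorem IsTower.exists_isIntegral_mul (hx : IsTower p x) (hp : 2 ≤ p)
    (hx0 : x 0 = algebraMap F[X] Ω X) {Z : Finset Ω}
    (hZ : ∀ y : Ω, y ^ p + y = ∏ ω ∈ Z, (y - ω)) (hZF : ∀ ω ∈ Z, ∃ a : F, ω = algebraMap F Ω a)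
    (i : ℕ) : ∃ M : ℕ, IsIntegral F[X] ((x 0 ^ p + x 0) ^ M * x (i + 1)) := by
  refine ⟨p ^ (i + 1) * ((p - 1) * (i + 1)) + 1,
    isIntegral_of_forall_valuationSubring (X : F[X]) fun B hB => ?_⟩
  rw [← hx0] at hB
  have hZ1 : ∀ ω ∈ Z, ω ≠ 0 → B.valuation ω = 1 := by
    rintro ω hω h0
    obtain ⟨a, rfl⟩ := hZF ω hω
    exact Valuation.map_algebraMap_eq_one (by rintro rfl; simp at h0)
  have hk : p ^ i < p ^ (i + 1) := Nat.pow_lt_pow_right (by omega) (by omega)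
  have hv0 : B.valuation (x 0) ≠ 0 := by simpa using hx.ne_zero 0
  rw [map_mul, map_pow, ← digitMonomial_pow_right (by omega : 0 < p) x i]
  rcases hB.lt_or_eq with h | h
  · rw [B.valuation.map_pow_add_self_of_lt_one hp h, pow_succ', mul_assoc]
    refine mul_le_one' hB ((mul_le_mul_right
      (hx.map_digitMonomial_le_inv_pow _ hp hZ hZ1 h hk) _).trans ?_)
    rw [inv_pow, mul_inv_cancel₀ (pow_ne_zero _ hv0)]
  have hD : B.valuation (x 0 ^ p + x 0) = B.valuation (x 0 ^ (p - 1) + 1) := by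
    rw [pow_add_self_eq_mul (by omega), map_mul, h, one_mul]
  have hden : B.valuation (x 0 ^ (p - 1) + 1) ≤ 1 :=
    Valuation.map_add_le _ (by rw [map_pow, h, one_pow]) (map_one _).le
  rcases hden.lt_or_eq with h1 | h1
  · have hlt := h1
    rw [← hD, hZ, map_prod] at hlt
    obtain ⟨ω, hω, hωlt⟩ : ∃ ω ∈ Z, B.valuation (x 0 - ω) < 1 := by
      by_contra! h
      refine hlt.not_ge ?_
      rw [← Finset.prod_const_one (s := Z)]
      exact Finset.prod_le_prod (fun _ _ => zero_le) h
    have hω0 : ω ≠ 0 := by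
      rintro rfl
      rw [sub_zero, h] at hωlt
      exact hωlt.false
    have hroot : ω ^ p + ω = 0 := by
      rw [hZ]; exact Finset.prod_eq_zero hω (sub_self _)
    have h2 := hx.map_succ_of_sub_lt_one hp hroot (hZ1 ω hω hω0) hωlt
    rw [hD, pow_succ, mul_assoc]
    refine mul_le_one' (pow_le_one' h1.le _) ?_
    refine (mul_le_mul_right
      (hx.map_digitMonomial_le_of_sub_lt_one hp hroot (hZ1 ω hω hω0) hωlt hk) _).trans ?_
    rw [h2.2.1, mul_inv_cancel₀]
    simpa using h2.2.2.1
  · exact mul_le_one' (pow_le_one' (hD.trans h1).le _)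
      (hx.map_digitMonomial_le_one hp h h1 hk)

variable [IsScalarTower F F[X] Ω] [Algebra.IsAlgebraic K Ω] [IsAlgClosed Ω]
  [CommRing O] [Algebra O (towerField K x n)] [Algebra F[X] O]
  [IsIntegralClosure O F[X] (towerField K x n)] [IsScalarTower F[X] O (towerField K x n)]

variable (K O n) in
/-- Over a place of `F(X)` at which all residues of the tower are split, there are as many primes
as embeddings. -/
theorem IsTower.exists_primes (hx : IsTower p x) (hp : 3 ≤ p)
    (hF : ∀ a : F, a ^ (p ^ 2) = a)
    (hx0 : x 0 = algebraMap F[X] Ω X) {Z : Finset Ω}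
    (hZ : ∀ y : Ω, y ^ p + y = ∏ ω ∈ Z, (y - ω)) (hZF : ∀ ω ∈ Z, ∃ a : F, ω = algebraMap F Ω a)
    {s : F} (hs : s ^ p + s ≠ 0) {B : ValuationSubring Ω}
    (hB : B.valuation (x 0 - algebraMap F Ω s) < 1) :
    ∃ P : (towerField K x n →ₐ[K] Ω) → Ideal O, Function.Injective P ∧
      ∀ τ, (P τ).IsPrime ∧ algebraMap F[X] O (X - C s) ∈ P τ := by
  have hbot : x 0 ∈ (⊥ : IntermediateField K Ω) := mem_bot_of_eq hx0
  set φ : (towerField K x n →ₐ[K] Ω) → O →+* Ω := fun τ =>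
    (τ : towerField K x n →+* Ω).comp (algebraMap O (towerField K x n)) with hφ
  have hφX : ∀ τ q, φ τ (algebraMap F[X] O q) = algebraMap F[X] Ω q := by
    intro τ q
    simp only [hφ, RingHom.comp_apply, ← IsScalarTower.algebraMap_apply F[X] O (towerField K x n)]
    rw [IsScalarTower.algebraMap_apply F[X] K (towerField K x n)]
    simp [← IsScalarTower.algebraMap_apply F[X] K Ω]
  have hx0s : x 0 - algebraMap F Ω s = algebraMap F[X] Ω (X - C s) := by
    rw [map_sub, hx0, ← Polynomial.algebraMap_eq, ← IsScalarTower.algebraMap_apply F F[X] Ω]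
  have hvx0 : B.valuation (x 0) ≤ 1 := by
    have : x 0 = (x 0 - algebraMap F Ω s) + algebraMap F Ω s := by ring
    rw [this]
    refine Valuation.map_add_le _ hB.le ?_
    rcases eq_or_ne s 0 with rfl | h
    · simp
    · exact (Valuation.map_algebraMap_eq_one h).le
  have hpoly : ∀ q : F[X], B.valuation (algebraMap F[X] Ω q) ≤ 1 := by
    intro q
    rw [algebraMap_eq_aeval, ← hx0]
    exact valuation_aeval_le_one _ hvx0 q
  have hw : ∀ τ f, (B.valuation.comap (φ τ)) f ≤ 1 := by
    intro τ f
    refine B.valuation_le_one_of_isIntegral hpoly ?_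
    obtain ⟨q, hq, hqf⟩ := IsIntegralClosure.isIntegral F[X] (towerField K x n) f
    refine ⟨q, hq, ?_⟩
    have := congr(φ τ $hqf)
    rwa [hom_eval₂, map_zero, show (φ τ).comp (algebraMap F[X] O) = algebraMap F[X] Ω from
      RingHom.ext (hφX τ)] at this
  refine ⟨fun τ => (B.valuation.comap (φ τ)).ltOneIdeal (hw τ), ?_, fun τ =>
    ⟨Valuation.isPrime_ltOneIdeal _ _, ?_⟩⟩
  · intro τ τ' hττ'
    have hmem : ∀ f, B.valuation (φ τ f) < 1 ↔ B.valuation (φ τ' f) < 1 := by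
      intro f
      have := congr(f ∈ $hττ')
      exact iff_of_eq this
    obtain ⟨σ, hσ⟩ : ∃ σ : Ω →ₐ[K] Ω, ∀ f : towerField K x n, σ f = τ f := by
      obtain ⟨σ, hσ⟩ := IsAlgClosed.surjective_domRestrict_of_isAlgebraic (E := Ω) τ
      exact ⟨σ, fun f => congr($hσ f)⟩
    obtain ⟨σ', hσ'⟩ : ∃ σ : Ω →ₐ[K] Ω, ∀ f : towerField K x n, σ f = τ' f := by
      obtain ⟨σ, hσ⟩ := IsAlgClosed.surjective_domRestrict_of_isAlgebraic (E := Ω) τ'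
      exact ⟨σ, fun f => congr($hσ f)⟩
    have htower : IsTower p fun i => σ (x i) :=
      ⟨fun i => by simpa using congr(σ $(hx.step i)), fun i => by simpa using hx.ne_zero i,
        fun i => by simpa using (map_ne_zero σ).2 (hx.den_ne_zero i)⟩
    have hfix : ∀ ρ : Ω →ₐ[K] Ω, ρ (x 0) = x 0 := by
      intro ρ
      obtain ⟨a, ha⟩ := IntermediateField.mem_bot.1 hbot
      rw [← ha, ρ.commutes]
    have halg : ∀ c : F, algebraMap F Ω c = algebraMap K Ω (algebraMap F[X] K (C c)) := by
      intro c
      rw [← IsScalarTower.algebraMap_apply F[X] K Ω, ← Polynomial.algebraMap_eq,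
        ← IsScalarTower.algebraMap_apply F F[X] Ω]
    have hD : B.valuation (x 0 ^ p + x 0) = 1 := by
      have h1 : x 0 ^ p + x 0 = algebraMap F Ω (s ^ p + s) +
          ((x 0 - algebraMap F Ω s) ^ p + (x 0 - algebraMap F Ω s)) := by
        rw [sub_pow_char, map_add, map_pow]; ring
      have h2 : B.valuation (algebraMap F Ω (s ^ p + s)) = 1 :=
        Valuation.map_algebraMap_eq_one hs
      rw [h1, B.valuation.map_add_eq_of_lt_left, h2]
      rw [h2]
      exact B.valuation.map_add_lt (by rw [map_pow]; exact pow_lt_one₀ zero_le hB (by omega)) hB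
    have key : ∀ i ≤ n, σ (x i) = σ' (x i) := by
      intro i
      induction i with
      | zero => intro _; rw [hfix, hfix]
      | succ i ih =>
        intro hi
        specialize ih (by omega)
        obtain ⟨c, hc, -⟩ := htower.exists_residue (v := B.valuation) hp hF hZ hZF hs
          (by rwa [hfix]) (i + 1)
        obtain ⟨M, hM⟩ := hx.exists_isIntegral_mul (by omega : 2 ≤ p) hx0 hZ hZF i
        set g : Ω := (x 0 ^ p + x 0) ^ M * (x (i + 1) - algebraMap F Ω c) with hg
        have hgint : IsIntegral F[X] g := by
          rw [hg, mul_sub]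
          refine hM.sub ?_
          have : (x 0 ^ p + x 0) ^ M * algebraMap F Ω c =
              algebraMap F[X] Ω ((X ^ p + X) ^ M * C c) := by
            rw [map_mul, map_pow, map_add, map_pow, ← hx0, ← Polynomial.algebraMap_eq,
              ← IsScalarTower.algebraMap_apply F F[X] Ω]
          rw [this]
          exact isIntegral_algebraMap
        have hgL : g ∈ towerField K x n := by
          have h0 := mem_towerField hbot n.zero_le
          refine mul_mem (pow_mem (add_mem (pow_mem h0 _) h0) _)
            (sub_mem (mem_towerField hbot hi) ?_)
          rw [halg]
          exact (towerField K x n).algebraMap_mem _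
        obtain ⟨f, hf⟩ : ∃ f : O, algebraMap O (towerField K x n) f = ⟨g, hgL⟩ := by
          refine (IsIntegralClosure.isIntegral_iff (R := F[X])).1 ?_
          exact (isIntegral_algHom_iff ((towerField K x n).val.restrictScalars F[X])
            (towerField K x n).val.injective).1 hgint
        have hval : ∀ ρ : Ω →ₐ[K] Ω, B.valuation (ρ g) =
            B.valuation (ρ (x (i + 1)) - algebraMap F Ω c) := by
          intro ρ
          rw [hg, map_mul, map_pow, map_add, map_pow, hfix, map_mul, map_pow, hD, one_pow, one_mul,
            map_sub, halg, ρ.commutes]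
        have h1 : B.valuation (σ' (x (i + 1)) - algebraMap F Ω c) < 1 := by
          rw [← hval, show σ' g = φ τ' f by simp [hφ, hf, ← hσ'], ← hmem,
            show φ τ f = σ g by simp [hφ, hf, ← hσ], hval]
          exact hc
        set ω := σ (x (i + 1)) - σ' (x (i + 1)) with hω
        have hω1 : B.valuation ω < 1 := by
          rw [hω, ← sub_sub_sub_cancel_right _ _ (algebraMap F Ω c)]
          exact B.valuation.map_sub_lt hc h1
        have hω0 : ω ^ p + ω = 0 := by
          have e1 := congr(σ $(hx.step i))
          have e2 := congr(σ' $(hx.step i))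
          simp only [map_add, map_pow, map_div₀, map_one, ih] at e1 e2
          rw [hω, sub_pow_char, sub_add_sub_comm, e1, e2, sub_self]
        rw [hZ, Finset.prod_eq_zero_iff] at hω0
        obtain ⟨ω', hω', hωω'⟩ := hω0
        obtain ⟨a, rfl⟩ := hZF ω' hω'
        rw [sub_eq_zero] at hωω'
        rcases eq_or_ne a 0 with rfl | ha
        · rw [map_zero] at hωω'
          exact sub_eq_zero.1 hωω'
        · rw [hωω', Valuation.map_algebraMap_eq_one ha] at hω1
          exact absurd hω1 (lt_irrefl _)
    ext f
    rw [← hσ, ← hσ']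
    exact algHom_eq_of_mem_towerField key f.2
  · change B.valuation (φ τ _) < 1
    rwa [hφX, ← hx0s]

end PlaceIdeal

section TowerCode

variable {F K Ω : Type*} [Field F] [Field K] [Field Ω] [Algebra F Ω] [Algebra K Ω]
  [Algebra F[X] K] [IsFractionRing F[X] K] [Algebra F[X] Ω] [IsScalarTower F[X] K Ω]
  [IsScalarTower F F[X] Ω]

variable (F K) in
include K in
theorem transcendental_algebraMap_X : Transcendental F (algebraMap F[X] Ω X) := by
  rw [transcendental_iff]
  intro q hq
  rw [← algebraMap_eq_aeval, IsScalarTower.algebraMap_apply F[X] K Ω, map_eq_zero] at hq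
  exact IsFractionRing.injective F[X] K (by rw [hq, map_zero])

theorem exists_isTower [IsAlgClosed Ω] {p : ℕ} (hp : 2 ≤ p) {t : Ω} {B : ValuationSubring Ω}
    (hB : 1 < B.valuation t) : ∃ x : ℕ → Ω, x 0 = t ∧ IsTower p x := by
  have hroot : ∀ c : Ω, ∃ y : Ω, y ^ p + y = c := by
    intro c
    obtain ⟨y, hy⟩ := IsAlgClosed.exists_root (X ^ p + X - C c) (by
      have hp' : (X ^ p + X - C c : Polynomial Ω).natDegree = p := by
        rw [natDegree_sub_C, natDegree_add_eq_left_of_natDegree_lt (by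
          rw [natDegree_X, natDegree_X_pow]; omega), natDegree_X_pow]
      intro h
      have := natDegree_eq_zero_iff_degree_le_zero.2 h.le
      omega)
    exact ⟨y, by simpa [sub_eq_zero] using hy⟩
  choose g hg using hroot
  let x : ℕ → Ω := fun i => Nat.rec t (fun _ y => g (y ^ p / (y ^ (p - 1) + 1))) i
  have hstep : ∀ i, x (i + 1) ^ p + x (i + 1) = x i ^ p / (x i ^ (p - 1) + 1) := fun i => hg _
  have hval : ∀ i, 1 < B.valuation (x i) := by
    intro i
    induction i with
    | zero => exact hB
    | succ i ih =>
      refine (B.valuation.map_pow_of_one_lt_pow_add_self hp ?_ (hstep i)).2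
      rw [B.valuation.map_div_pow_add_one_of_one_lt hp ih]
      exact ih
  refine ⟨x, rfl, hstep, fun i h => ?_, fun i h => ?_⟩
  · have := hval i
    simp [h] at this
  · have h1 := B.valuation.map_pow_add_one_of_one_lt hp (hval i)
    rw [h, map_zero, eq_comm, pow_eq_zero_iff (by omega)] at h1
    exact absurd (h1 ▸ hval i) (by simp)

variable [Algebra F K] [IsScalarTower F F[X] K] [IsScalarTower F K Ω]
  [Fintype F] {p : ℕ} [CharP Ω p] [Fact p.Prime] {x : ℕ → Ω} {n : ℕ}
  {O : Type*} [Algebra.IsAlgebraic K Ω] [IsAlgClosed Ω]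
  [CommRing O] [IsDedekindDomain O] [Algebra F[X] O] [Module.Finite F[X] O]
  [Module.IsTorsionFree F[X] O] [Algebra O (towerField K x n)]
  [IsIntegralClosure O F[X] (towerField K x n)] [IsScalarTower F[X] O (towerField K x n)]
  [Algebra F O] [IsScalarTower F F[X] O] [IsScalarTower F O (towerField K x n)]

variable (K O n) in
include K O in
/-- The evaluation code at the completely split places of a tower. -/
theorem IsTower.exists_code [DecidableEq F] (hx : IsTower p x) (hp : 3 ≤ p)
    (hF : ∀ a : F, a ^ (p ^ 2) = a)
    (hx0 : x 0 = algebraMap F[X] Ω X) {Z : Finset Ω}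
    (hZ : ∀ y : Ω, y ^ p + y = ∏ ω ∈ Z, (y - ω)) (hZF : ∀ ω ∈ Z, ∃ a : F, ω = algebraMap F Ω a)
    {ι : Type*} [Fintype ι] [DecidableEq ι]
    (hι : Fintype.card ι = p ^ n * (Finset.univ.filter fun s : F => s ^ p + s ≠ 0).card)
    (j : ℕ) (T : Finset ι) :
    ∃ W : Submodule F (ι → F),
      (∀ w ∈ W, w ≠ 0 → (Finset.univ.filter fun i => w i = 0).card ≤ p ^ n * (p * j)) ∧
      T.card.choose (p ^ n * (p * j)) ≤
        (Fintype.card F ^ (p ^ n * (p + 1)) * 2 ^ (p ^ n + p ^ n * (p + 1))) *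
        {w | w ∈ W ∧ (T.filter fun i => w i = 0).card = p ^ n * (p * j)}.ncard := by
  have htr : Transcendental F (x 0) := hx0 ▸ transcendental_algebraMap_X F K
  obtain ⟨B, hB⟩ : ∃ B : ValuationSubring Ω, 1 < B.valuation (x 0) := by
    obtain ⟨B, hB⟩ := exists_valuationSubring_map_lt_one (F := F) (t := (x 0)⁻¹) (by
      rwa [Transcendental, IsAlgebraic.inv_iff])
    refine ⟨B, ?_⟩
    rw [map_inv₀] at hB
    exact (inv_lt_one₀ (zero_lt_iff.2 (by simpa using hx.ne_zero 0))).1 hB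
  obtain ⟨b, -, hb⟩ := hx.exists_basis F K (by omega) hx0 hB n
  have hfd : FiniteDimensional K (towerField K x n) := b.finiteDimensional_of_finite
  have hrank : Module.finrank K (towerField K x n) = p ^ n := by
    rw [Module.finrank_eq_card_basis b, Fintype.card_fin]
  have hsep := hx.isSeparable_towerField (by omega : 2 ≤ p) (mem_bot_of_eq (K := K) hx0) n
  have hfrac : IsFractionRing O (towerField K x n) :=
    IsIntegralClosure.isFractionRing_of_finite_extension F[X] K _ _
  have hrankO : Module.finrank F[X] O = p ^ n := by
    rw [← hrank, IsFractionRing.finrank_eq F[X] K O (towerField K x n)]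
  have halg : ∀ q : F[X], algebraMap (towerField K x n) Ω (algebraMap F[X] (towerField K x n) q) =
      algebraMap F[X] Ω q := by
    intro q
    rw [IsScalarTower.algebraMap_apply F[X] K (towerField K x n),
      ← IsScalarTower.algebraMap_apply K (towerField K x n) Ω,
      ← IsScalarTower.algebraMap_apply F[X] K Ω]
  set v := B.valuation.comap (algebraMap (towerField K x n) Ω) with hvdef
  have hvX : v (algebraMap F[X] (towerField K x n) X) = B.valuation (x 0) := by
    rw [hvdef, Valuation.comap_apply, halg, hx0]
  have hX : 1 < v (algebraMap F[X] (towerField K x n) X) := hvX ▸ hB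
  have hv : ∀ q : F[X], q ≠ 0 → v (algebraMap F[X] (towerField K x n) q) =
      v (algebraMap F[X] (towerField K x n) X) ^ q.natDegree := by
    intro q hq
    rw [hvX, hvdef, Valuation.comap_apply, halg, algebraMap_eq_aeval, ← hx0,
      valuation_aeval_eq_pow hB hq]
  have hN : ∀ f, v (algebraMap K (towerField K x n) (Algebra.norm K f)) = v f ^ p ^ n := by
    intro f
    rw [← Fintype.card_fin (p ^ n)]
    exact v.map_norm_of_basis b hb f
  obtain ⟨V, hV, hVv⟩ := hx.exists_submodule (F := F) (K := K) (n := n) O hp hx0 hZ hZF hB (p * j + 1)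
  have hplace : ∀ s : F, ∃ B : ValuationSubring Ω, B.valuation (x 0 - algebraMap F Ω s) < 1 :=
    fun s => exists_valuationSubring_map_lt_one (F := F) fun h => htr (by
      simpa using h.add (isAlgebraic_algebraMap s))
  choose B' hB' using hplace
  choose P hPinj hP using fun s : {s : F // s ^ p + s ≠ 0} =>
    hx.exists_primes K O n hp hF hx0 hZ hZF s.2 (hB' s)
  have hcardτ : Fintype.card (towerField K x n →ₐ[K] Ω) = Module.finrank F[X] O := by
    rw [hrankO, ← hrank, AlgHom.card]
  have hP0 : ∀ s τ, P s τ ≠ ⊥ := by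
    intro s τ h
    have := (hP s τ).2
    rw [h, Ideal.mem_bot] at this
    exact X_sub_C_ne_zero s.1 (FaithfulSMul.algebraMap_injective F[X] O (by rw [this, map_zero]))
  obtain ⟨e⟩ : Nonempty (ι ≃ {s : F // s ^ p + s ≠ 0} × (towerField K x n →ₐ[K] Ω)) := by
    refine Fintype.card_eq.1 ?_
    rw [hι, Fintype.card_prod, hcardτ, hrankO, mul_comm, Fintype.card_subtype]
  refine exists_code_of_divisors (idealDegree F) idealDegree_mul
    (fun f g hf hg hfg => idealDegree_span_add_le K hX hv hN hf hg hfg)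
    (fun i => P (e i).1 (e i).2) ?_ (fun i => (hP _ _).1) (fun i => hP0 _ _)
    (fun i => idealDegree_eq_one_of_split (hPinj (e i).1) (fun τ => (hP _ τ).1) (hP0 _)
      (fun τ => (hP _ τ).2) hcardτ (e i).2) (fun i f => ?_) V (p ^ n * (p * j)) (p ^ n * (p + 1)) _
    ?_ (fun f hf hf0 => ?_) (card_ideals_idealDegree_le _).1 ?_ T
  · intro i i' h
    replace h : P (e i).1 (e i).2 = P (e i').1 (e i').2 := h
    have hs : (e i).1 = (e i').1 := by
      by_contra hne
      have h1 := (hP (e i).1 (e i).2).2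
      have h2 := (hP (e i').1 (e i').2).2
      rw [← h] at h2
      refine (hP (e i).1 (e i).2).1.ne_top ((Ideal.eq_top_iff_one _).2 ?_)
      have h3 := Ideal.sub_mem _ h1 h2
      rw [← map_sub, sub_sub_sub_cancel_left, ← C_sub] at h3
      have h4 := Ideal.mul_mem_left _
        (algebraMap F[X] O (C ((e i').1.1 - (e i).1.1)⁻¹)) h3
      rwa [← map_mul, ← C_mul, inv_mul_cancel₀ (sub_ne_zero.2 fun h => hne (Subtype.ext h.symm)),
        C_1, map_one] at h4
    rw [hs] at h
    exact e.injective (Prod.ext hs (hPinj _ h))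
  · obtain ⟨c, hc⟩ := exists_sub_algebraMap_mem_of_split (hPinj (e i).1) (fun τ => (hP _ τ).1)
      (fun τ => (hP _ τ).2) hcardτ (e i).2 f
    refine ⟨c, ?_⟩
    rwa [← Polynomial.algebraMap_eq, ← IsScalarTower.algebraMap_apply F F[X] O] at hc
  · rw [hV]
    have : 0 < p ^ n := by positivity
    nlinarith
  · refine (idealDegree_span_le K hX hv hN hf0 (a := p + (p * j + 1)) ?_).trans_eq (by ring)
    rw [hvX]
    exact hVv f hf
  · rw [← hrankO]
    exact (card_ideals_idealDegree_le _).2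

end TowerCode

section AGCode

theorem exists_finset_X_pow_add_X_eq_prod (p : ℕ) [Fact p.Prime] :
    ∃ Z : Finset (GaloisField p 2), Z.card = p ∧
      (X ^ p + X : (GaloisField p 2)[X]) = ∏ a ∈ Z, (X - C a) := by
  have hp := (Fact.out : p.Prime).two_le
  have : Fintype (GaloisField p 2) := Fintype.ofFinite _
  have hcard : Fintype.card (GaloisField p 2) = p ^ 2 := by
    rw [Fintype.card_eq_nat_card, GaloisField.card p 2 two_ne_zero]
  have hdvd : (X ^ p + X : (GaloisField p 2)[X]) ∣ X ^ p ^ 2 - X := by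
    refine ⟨(X ^ p + X) ^ (p - 1) - 1, ?_⟩
    rw [mul_sub_one, mul_pow_sub_one (by omega), add_pow_char, ← pow_mul, sq]
    ring
  have hsplit : (X ^ p + X : (GaloisField p 2)[X]).Splits := by
    refine Splits.of_dvd ?_ ?_ hdvd
    · rw [← hcard]
      simpa using FiniteField.splits_X_pow_card_sub_X (K := GaloisField p 2) p
    · exact FiniteField.X_pow_card_pow_sub_X_ne_zero _ two_ne_zero (by omega)
  have hnd : (X ^ p + X : (GaloisField p 2)[X]).natDegree = p := by
    rw [natDegree_add_eq_left_of_natDegree_lt (by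
      rw [natDegree_X, natDegree_X_pow]; omega), natDegree_X_pow]
  have hmonic : (X ^ p + X : (GaloisField p 2)[X]).Monic :=
    monic_X_pow_add (by rw [degree_X]; exact_mod_cast hp)
  have hsep : (X ^ p + X : (GaloisField p 2)[X]).Separable := by
    have h : derivative (X ^ p + X : (GaloisField p 2)[X]) = 1 := by
      simp [derivative_X_pow]
    rw [separable_def, h]
    exact isCoprime_one_right
  have hroots := nodup_roots hsep
  refine ⟨⟨_, hroots⟩, ?_, ?_⟩
  · exact hsplit.natDegree_eq_card_roots.symm.trans hnd
  · exact hsplit.eq_prod_roots_of_monic hmonic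

theorem card_filter_pow_add_self_ne_zero (p : ℕ) [Fact p.Prime] [Fintype (GaloisField p 2)]
    [DecidableEq (GaloisField p 2)] :
    (Finset.univ.filter fun s : GaloisField p 2 => s ^ p + s ≠ 0).card = p * (p - 1) := by
  obtain ⟨Z, hZ, hprod⟩ := exists_finset_X_pow_add_X_eq_prod p
  have h : (Finset.univ.filter fun s : GaloisField p 2 => s ^ p + s ≠ 0) = Zᶜ := by
    ext s
    have hs := congrArg (eval s) hprod
    simp only [eval_add, eval_pow, eval_X, eval_prod, eval_sub, eval_C] at hs
    simp [hs, Finset.prod_eq_zero_iff, sub_eq_zero]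
  rw [h, Finset.card_compl, hZ, Fintype.card_eq_nat_card, GaloisField.card p 2 two_ne_zero,
    Nat.mul_sub_one, sq]

theorem exists_ag_code (p : ℕ) [Fact p.Prime] (hp : 7 ≤ p) (j : ℕ) (n : ℕ) :
    ∃ (ι : Type) (_ : Fintype ι) (_ : DecidableEq ι) (_ : DecidableEq (GaloisField p 2))
      (W : Submodule (GaloisField p 2) (ι → GaloisField p 2)) (T : Finset ι),
      T.card = p ^ n * (p * (p - 2)) ∧ (Tᶜ).card = p ^ n * p ∧
      (∀ w ∈ W, w ≠ 0 → (Finset.univ.filter fun i => w i = 0).card ≤ p ^ n * p * j) ∧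
      T.card.choose (p ^ n * p * j) ≤ p ^ (10 * (p ^ n * p)) *
        {w | w ∈ W ∧ (T.filter fun i => w i = 0).card = p ^ n * p * j}.ncard := by
  classical
  let F := GaloisField p 2
  let K := RatFunc F
  let Ω := AlgebraicClosure K
  have : Fintype F := Fintype.ofFinite _
  have hcard : Fintype.card F = p ^ 2 := by
    rw [Fintype.card_eq_nat_card, GaloisField.card p 2 two_ne_zero]
  have hF : ∀ a : F, a ^ p ^ 2 = a := fun a => by rw [← hcard, FiniteField.pow_card]
  have : CharP Ω p := charP_of_injective_algebraMap (algebraMap F Ω).injective p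
  obtain ⟨Z, hZcard, hprod⟩ := exists_finset_X_pow_add_X_eq_prod p
  have hZ : ∀ y : Ω, y ^ p + y = ∏ ω ∈ Z.image (algebraMap F Ω), (y - ω) := by
    intro y
    rw [Finset.prod_image fun a _ b _ h => (algebraMap F Ω).injective h]
    simpa using congrArg (aeval y) hprod
  have hZF : ∀ ω ∈ Z.image (algebraMap F Ω), ∃ a : F, ω = algebraMap F Ω a := by
    intro ω hω
    obtain ⟨a, -, ha⟩ := Finset.mem_image.1 hω
    exact ⟨a, ha.symm⟩
  have htr := transcendental_algebraMap_X (Ω := Ω) F K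
  obtain ⟨B, hB⟩ := exists_valuationSubring_map_lt_one (F := F)
    (t := (algebraMap F[X] Ω X)⁻¹) (by rwa [Transcendental, IsAlgebraic.inv_iff])
  have hB1 : 1 < B.valuation (algebraMap F[X] Ω X) := by
    rw [map_inv₀] at hB
    refine (inv_lt_one₀ (zero_lt_iff.2 ?_)).1 hB
    rw [Ne, map_eq_zero]
    exact fun h => htr (h ▸ isAlgebraic_zero)
  obtain ⟨x, hx0, hx⟩ := exists_isTower (p := p) (by omega) hB1
  obtain ⟨b, -, -⟩ := hx.exists_basis F K (by omega) hx0 (hx0 ▸ hB1) n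
  have : FiniteDimensional K (towerField K x n) := b.finiteDimensional_of_finite
  have := hx.isSeparable_towerField (by omega : 2 ≤ p) (mem_bot_of_eq (K := K) hx0) n
  have : IsDedekindDomain (integralClosure F[X] (towerField K x n)) :=
    integralClosure.isDedekindDomain F[X] K _
  have : Module.Finite F[X] (integralClosure F[X] (towerField K x n)) :=
    IsIntegralClosure.finite F[X] K (towerField K x n) _
  have : Module.IsTorsionFree F[X] (towerField K x n) := by
    exact Module.IsTorsionFree.trans K
  let _ : Algebra F (integralClosure F[X] (towerField K x n)) :=
    ((algebraMap F[X] (integralClosure F[X] (towerField K x n))).comp C).toAlgebra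
  have : IsScalarTower F F[X] (integralClosure F[X] (towerField K x n)) :=
    IsScalarTower.of_algebraMap_eq fun _ => rfl
  have : IsScalarTower F (integralClosure F[X] (towerField K x n)) (towerField K x n) := by
    refine IsScalarTower.of_algebraMap_eq fun a => ?_
    rw [IsScalarTower.algebraMap_apply F F[X] (integralClosure F[X] (towerField K x n)),
      ← IsScalarTower.algebraMap_apply F[X] _ (towerField K x n),
      IsScalarTower.algebraMap_apply F[X] K (towerField K x n),
      ← IsScalarTower.algebraMap_apply F F[X] K, ← IsScalarTower.algebraMap_apply F K]
  obtain ⟨T, -, hT⟩ := Finset.exists_subset_card_eq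
    (s := (Finset.univ : Finset (Fin (p ^ n * (p * (p - 1)))))) (n := p ^ n * (p * (p - 2)))
    (by rw [Finset.card_univ, Fintype.card_fin]; gcongr; omega)
  obtain ⟨W, hW, hWT⟩ := IsTower.exists_code K n (integralClosure F[X] (towerField K x n)) hx
    (by omega) hF hx0 hZ hZF (ι := Fin (p ^ n * (p * (p - 1))))
    (by rw [Fintype.card_fin, card_filter_pow_add_self_ne_zero]) j T
  refine ⟨_, inferInstance, inferInstance, inferInstance, W, T, hT, ?_, ?_, ?_⟩
  · rw [Finset.card_compl, hT, Fintype.card_fin, ← Nat.mul_sub, ← Nat.mul_sub,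
      show p - 1 - (p - 2) = 1 by omega, mul_one]
  · simpa only [mul_assoc] using hW
  · rw [mul_assoc]
    refine hWT.trans (Nat.mul_le_mul_right _ ?_)
    rw [hcard, ← pow_mul]
    calc p ^ (2 * (p ^ n * (p + 1))) * 2 ^ (p ^ n + p ^ n * (p + 1))
        ≤ p ^ (2 * (p ^ n * (p + 1))) * p ^ (p ^ n + p ^ n * (p + 1)) := by gcongr; omega
      _ = p ^ (p ^ n * (3 * p + 4)) := by rw [← pow_add]; ring_nf
      _ ≤ p ^ (p ^ n * (10 * p)) := by gcongr <;> omega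
      _ = _ := by ring_nf

end AGCode

end FunctionField

theorem pow_le_choose_of_mul_le {a : ℝ} (ha : 1 ≤ a) (r : ℕ) :
    ∀ n : ℕ, a * r ≤ n → a ^ r ≤ n.choose r := by
  induction r with
  | zero => intro n _; simp
  | succ r ih =>
    intro n hn
    cases n with
    | zero =>
      push_cast at hn
      nlinarith [mul_nonneg (by linarith : (0 : ℝ) ≤ a) (Nat.cast_nonneg r : (0 : ℝ) ≤ r)]
    | succ n =>
      push_cast at hn
      have h1 := ih n (by linarith)
      have h2 : ((n + 1 : ℕ) : ℝ) * (n.choose r : ℝ)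
          = ((n + 1).choose (r + 1) : ℝ) * ((r + 1 : ℕ) : ℝ) := by
        exact_mod_cast Nat.add_one_mul_choose_eq n r
      push_cast at h2
      have h3 : (0 : ℝ) < (r : ℝ) + 1 := by positivity
      have h4 : a ^ r * (a * (r + 1)) ≤ (n.choose r : ℝ) * (n + 1) :=
        mul_le_mul h1 hn (by positivity) (by positivity)
      rw [pow_succ]
      refine le_of_mul_le_mul_right ?_ h3
      calc a ^ r * a * (r + 1) = a ^ r * (a * (r + 1)) := by ring
        _ ≤ _ := by linarith

/-- The gadget at level `n` of the tower, with its size controlled. -/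
theorem exists_gap_realization_level {δ : ℝ} (hδ0 : 0 < δ) (hδ1 : δ ≤ 1 / 4) (p : ℕ)
    [Fact p.Prime] (hp : 7 ≤ p)
    (j : ℕ) (hj : 13 ≤ δ * j) (hjp : j < p - 2) (hpj : (p : ℝ) ^ (1 - δ) * j ≤ p - 2) (m : ℕ)
    (hm : ∃ n, m = p ^ n) :
    ∃ (n d : ℕ) (A B : Finset (Fin d → Bool)) (E : Finset ((Fin d → Bool) × (Fin d → Bool)))
      (β : ℕ), 
      (m * p * j : ℝ) / 2 * Real.log p ≤ Real.log n ∧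
      Real.log n ≤ 2 * (m * p * j + 1) * Real.log p ∧ 0 < n ∧ (d : ℝ) ≤ m * p ^ 4 ∧
      A.card = n ∧ B.card = n ∧ E ⊆ A ×ˢ B ∧
      (n : ℝ) ^ (1.5 - δ) ≤ E.card ∧ 0 < β ∧
      (∀ ab ∈ E, hammingDist ab.1 ab.2 = β) ∧
      (∀ a ∈ A, ∀ b ∈ B, (a, b) ∉ E → β < hammingDist a b) ∧
      (∀ a ∈ A, ∀ a' ∈ A, a ≠ a' → (1 + 1 / p) * (β : ℝ) < (hammingDist a a' : ℝ)) ∧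
      (∀ b ∈ B, ∀ b' ∈ B, b ≠ b' → (1 + 1 / p) * (β : ℝ) < (hammingDist b b' : ℝ)) := by
  obtain ⟨k, hk⟩ := hm
  have hj1 : 1 ≤ j := by
    rcases Nat.eq_zero_or_pos j with h | h
    · rw [h] at hj; norm_num at hj
    · exact h
  obtain ⟨ι, _, _, _, W, T, hTcard, hUcard, hW, hchoose⟩ := exists_ag_code p hp j k
  rw [← hk] at hTcard hUcard hW hchoose
  have hm1 : 1 ≤ m := hk ▸ Nat.one_le_pow _ _ (by omega)
  let _ := Fintype.ofFinite (GaloisField p 2)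
  have hQ : Fintype.card (GaloisField p 2) = p ^ 2 := by
    rw [← Nat.card_eq_fintype_card, GaloisField.card p 2 (by norm_num)]
  have hp0 : (0 : ℝ) < p := by positivity
  have hp1 : (1 : ℝ) ≤ p := by exact_mod_cast (by omega : 1 ≤ p)
  have hlogp : 0 < Real.log p := Real.log_pos (by exact_mod_cast (by omega : 1 < p))
  set h := m * p * j with hh
  set x : ℝ := m * p with hx
  have hx7 : 7 ≤ x := by
    rw [hx]
    exact_mod_cast (le_trans hp (Nat.le_mul_of_pos_left p hm1))
  have hhx : (h : ℝ) = x * j := by rw [hh, hx]; push_cast; ring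
  set M := {w | w ∈ W ∧ (T.filter fun i => w i = 0).card = h}.ncard with hM
  have hTh : h < T.card := by
    rw [hTcard, hh, mul_assoc]
    exact Nat.mul_lt_mul_of_pos_left (Nat.mul_lt_mul_of_pos_left hjp (by omega)) (by omega)
  have hcast : ((p - 2 : ℕ) : ℝ) = p - 2 := by
    rw [Nat.cast_sub (by omega)]; norm_num
  have hchoose_ge : ((p : ℝ) ^ (1 - δ)) ^ h ≤ (T.card.choose h : ℝ) := by
    apply pow_le_choose_of_mul_le (Real.one_le_rpow hp1 (by linarith))
    rw [hTcard, hhx]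
    push_cast
    rw [hcast]
    calc (p : ℝ) ^ (1 - δ) * (x * j) = x * ((p : ℝ) ^ (1 - δ) * j) := by ring
      _ ≤ x * (p - 2) := by gcongr
      _ = _ := by rw [hx]; ring
  have hMpos : 0 < M := by
    rcases Nat.eq_zero_or_pos M with h0 | h0
    · rw [h0, mul_zero] at hchoose
      exact absurd hchoose (not_le.2 (Nat.choose_pos hTh.le))
    · exact h0
  have hUpos : 0 < (Tᶜ).card := by
    rw [hUcard]; exact Nat.mul_pos hm1 (by omega)
  obtain ⟨n, D, d, A, B, E, hn, hMD, hDn, hd, hA, hB, hEs, hEc, h1, h2, h3, h4⟩ :=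
    exists_gap_realization_of_code W T h M hW hTh hUpos hMpos le_rfl
  rw [hQ] at hn hMD hd
  have hDpos : 0 < D := by
    rcases Nat.eq_zero_or_pos D with h0 | h0
    · rw [h0, zero_mul] at hMD; omega
    · exact h0
  have hnpos : 0 < n := by omega
  have hlogD : (x * j * (1 - δ) - 12 * x) * Real.log p ≤ Real.log D := by
    have h5 : T.card.choose h ≤ p ^ (10 * (m * p)) * (D * (p ^ 2) ^ (m * p)) := by
      refine hchoose.trans (Nat.mul_le_mul_left _ ?_)
      rwa [hUcard] at hMD
    have h6 : ((p : ℝ) ^ (1 - δ)) ^ h ≤ (p : ℝ) ^ (10 * (m * p)) * (D * ((p : ℝ) ^ 2) ^ (m * p)) :=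
      hchoose_ge.trans (by exact_mod_cast h5)
    have hD0 : (D : ℝ) ≠ 0 := by positivity
    have h7 := Real.log_le_log (by positivity) h6
    rw [Real.log_pow, Real.log_rpow hp0, Real.log_mul (by positivity) (by positivity),
      Real.log_mul hD0 (by positivity), Real.log_pow, Real.log_pow, Real.log_pow, hhx] at h7
    push_cast at h7
    have e : (m : ℝ) * p = x := hx.symm
    rw [e] at h7
    linarith
  have hxj : 13 * x ≤ δ * (x * j) := by nlinarith
  have hxj1 : 0 ≤ x * j := by positivity
  have hlognD : Real.log D ≤ Real.log n :=
    Real.log_le_log (by positivity) (by exact_mod_cast hDn)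
  have hlogn : Real.log n ≤ 2 * (x * j + 1) * Real.log p := by
    have h5 : (n : ℝ) ≤ ((p : ℝ) ^ 2) ^ (h + 1) := by exact_mod_cast hn
    have h7 := Real.log_le_log (by positivity) h5
    rw [Real.log_pow, Real.log_pow] at h7
    push_cast at h7
    rw [hhx] at h7
    linarith
  have hβ : ∀ e : ℕ, 2 * (T.card - h) + 2 * (Tᶜ).card ≤ e →
      (1 + 1 / (p : ℝ)) * ((2 * (T.card - h) : ℕ) : ℝ) < e := by
    intro e he
    have he' : ((2 * (T.card - h) + 2 * (Tᶜ).card : ℕ) : ℝ) ≤ e := by exact_mod_cast he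
    refine lt_of_lt_of_le ?_ he'
    rw [Nat.cast_add, add_mul, one_mul, hUcard]
    gcongr
    have h5 : 2 * (T.card - h) < 2 * (m * p) * p := by
      have : T.card ≤ m * p * p := by
        rw [hTcard, ← mul_assoc]; exact Nat.mul_le_mul_left _ (by omega)
      have : 0 < h := by rw [hh]; exact Nat.mul_pos (Nat.mul_pos hm1 (by omega)) hj1
      rw [mul_assoc]
      have : T.card - h < m * p * p := by omega
      omega
    rw [one_div, inv_mul_lt_iff₀ hp0]
    calc ((2 * (T.card - h) : ℕ) : ℝ) < ((2 * (m * p) * p : ℕ) : ℝ) := by exact_mod_cast h5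
      _ = _ := by push_cast; ring
  refine ⟨n, d, A, B, E, 2 * (T.card - h), ?_, hlogn, hnpos, ?_, hA, hB, hEs, ?_, by omega, h1, h2,
    fun a ha b hb hab => hβ _ (h3 a ha b hb hab), fun a ha b hb hab => hβ _ (h4 a ha b hb hab)⟩
  · refine le_trans ?_ (hlogD.trans hlognD)
    gcongr
    nlinarith
  · rw [hd, hTcard]
    have : m * (p * (p - 2)) * p ^ 2 ≤ m * p ^ 4 := by
      calc m * (p * (p - 2)) * p ^ 2 ≤ m * (p * p) * p ^ 2 := by gcongr; omega
        _ = _ := by ring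
    exact_mod_cast this
  · rw [hEc]
    have hn0 : (0 : ℝ) < n := by exact_mod_cast hnpos
    have hD0 : (0 : ℝ) < D := by exact_mod_cast hDpos
    have : (1.5 - δ : ℝ) = 1 + (1 / 2 - δ) := by norm_num; ring
    rw [this, Real.rpow_add hn0, Real.rpow_one, Nat.cast_mul]
    gcongr
    rw [← Real.log_le_log_iff (by positivity) hD0, Real.log_rpow hn0]
    refine le_trans ?_ hlogD
    calc (1 / 2 - δ) * Real.log n ≤ (1 / 2 - δ) * (2 * (x * j + 1) * Real.log p) := by
          gcongr; linarith
      _ = ((1 - 2 * δ) * (x * j + 1)) * Real.log p := by ring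
      _ ≤ _ := by
        gcongr
        nlinarith

theorem stmt_11 (δ : ℝ) (hδ0 : 0 < δ) (hδ1 : δ < 1) :
    ∃ (μ C c c' : ℝ) (n : ℕ → ℕ),
      0 < μ ∧ 1 ≤ C ∧ 0 < c ∧ 0 < c' ∧
      StrictMono n ∧ (∀ i, 2 ≤ n i) ∧
      (∀ i, Real.log (n (i + 1)) ≤ C * Real.log (n i)) ∧
      (∀ i, ∃ (d : ℕ) (A B : Finset (Fin d → Bool))
          (E : Finset ((Fin d → Bool) × (Fin d → Bool))) (β : ℕ),
        (d : ℝ) ≤ c' * Real.log (n i) ∧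
        A.card = n i ∧ B.card = n i ∧
        E ⊆ A ×ˢ B ∧
        c * (n i : ℝ) ^ (1.5 - δ) ≤ (E.card : ℝ) ∧
        0 < β ∧
        (∀ ab ∈ E, hammingDist ab.1 ab.2 = β) ∧
        (∀ a ∈ A, ∀ b ∈ B, (a, b) ∉ E → β < hammingDist a b) ∧
        (∀ a ∈ A, ∀ a' ∈ A, a ≠ a' →
          (1 + μ) * (β : ℝ) < (hammingDist a a' : ℝ)) ∧
        (∀ b ∈ B, ∀ b' ∈ B, b ≠ b' →
          (1 + μ) * (β : ℝ) < (hammingDist b b' : ℝ))) := by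
  set ε := min δ (1 / 4) with hε
  have hε0 : 0 < ε := lt_min hδ0 (by norm_num)
  have hε1 : ε ≤ 1 / 4 := min_le_right _ _
  obtain ⟨j, hj⟩ := exists_nat_ge (13 / ε)
  have hj' : 13 ≤ ε * j := by rw [div_le_iff₀ hε0] at hj; linarith
  have hj1 : (1 : ℝ) ≤ j := by nlinarith
  have hlarge : ∀ᶠ p : ℕ in Filter.atTop, (2 * j : ℝ) ≤ (p : ℝ) ^ ε :=
    ((tendsto_rpow_atTop hε0).comp tendsto_natCast_atTop_atTop).eventually_ge_atTop _
  obtain ⟨P0, hP0⟩ := Filter.eventually_atTop.1 hlarge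
  obtain ⟨p, hpge, hp⟩ := Nat.exists_infinite_primes (max P0 (j + 7))
  have : Fact p.Prime := ⟨hp⟩
  have hpj0 : j + 7 ≤ p := (le_max_right _ _).trans hpge
  have hp7 : 7 ≤ p := by omega
  have hpR : (7 : ℝ) ≤ p := by exact_mod_cast hp7
  have hp0 : (0 : ℝ) < p := by linarith
  have hpj : (p : ℝ) ^ (1 - ε) * j ≤ p - 2 := by
    have h1 := hP0 p ((le_max_left _ _).trans hpge)
    have h2 : (p : ℝ) ^ (1 - ε) * (p : ℝ) ^ ε = p := by
      rw [← Real.rpow_add hp0]; simp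
    have h3 : 0 < (p : ℝ) ^ (1 - ε) := Real.rpow_pos_of_pos hp0 _
    nlinarith
  have hlog : 1 ≤ Real.log p := by
    rw [Real.le_log_iff_exp_le hp0]
    have := Real.exp_one_lt_d9
    linarith
  choose n d A B E β hn1 hn2 hn0 hd hA hB hEs hE hβ h1 h2 h3 h4 using fun i : ℕ =>
    exists_gap_realization_level hε0 hε1 p hp7 j hj' (by omega) hpj (p ^ i) ⟨i, rfl⟩
  have hy : ∀ i : ℕ, 7 ≤ ((p ^ i : ℕ) : ℝ) * p * j := by
    intro i
    have : (1 : ℝ) ≤ ((p ^ i : ℕ) : ℝ) := by exact_mod_cast Nat.one_le_pow _ _ (by omega)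
    have h5 : 7 ≤ ((p ^ i : ℕ) : ℝ) * p := by nlinarith
    nlinarith
  have hsucc : ∀ i : ℕ, ((p ^ (i + 1) : ℕ) : ℝ) * p * j = p * (((p ^ i : ℕ) : ℝ) * p * j) := by
    intro i; push_cast; ring
  refine ⟨1 / p, 6 * p, 1, 2 * p ^ 3, n, by positivity, by linarith, one_pos, by positivity,
    ?_, ?_, ?_, ?_⟩
  · refine strictMono_nat_of_lt_succ fun i => ?_
    have : Real.log (n i) < Real.log (n (i + 1)) := by
      refine lt_of_le_of_lt (hn2 i) (lt_of_lt_of_le ?_ (hn1 (i + 1)))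
      refine mul_lt_mul_of_pos_right ?_ (by linarith)
      rw [hsucc]
      nlinarith [hy i]
    exact_mod_cast (Real.log_lt_log_iff (by exact_mod_cast hn0 i) (by exact_mod_cast hn0 _)).1 this
  · intro i
    by_contra! hlt
    have h5 : n i = 1 := by have := hn0 i; omega
    have h6 := hn1 i
    rw [h5, Nat.cast_one, Real.log_one] at h6
    nlinarith [hy i]
  · intro i
    calc Real.log (n (i + 1)) ≤ _ := hn2 (i + 1)
      _ ≤ 6 * p * ((((p ^ i : ℕ) : ℝ) * p * j) / 2 * Real.log p) := by
        rw [hsucc]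
        have : 2 * ((p : ℝ) * (((p ^ i : ℕ) : ℝ) * p * j) + 1)
            ≤ 6 * p * ((((p ^ i : ℕ) : ℝ) * p * j) / 2) := by nlinarith [hy i]
        nlinarith
      _ ≤ _ := by gcongr; exact hn1 i
  · intro i
    refine ⟨d i, A i, B i, E i, β i, ?_, hA i, hB i, hEs i, ?_, hβ i, h1 i, h2 i, h3 i, h4 i⟩
    · calc (d i : ℝ) ≤ _ := hd i
        _ ≤ 2 * p ^ 3 * ((((p ^ i : ℕ) : ℝ) * p * j) / 2 * Real.log p) := by
          have h5 : (1 : ℝ) ≤ j * Real.log p := by nlinarith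
          have h6 : (0 : ℝ) ≤ ((p ^ i : ℕ) : ℝ) * p ^ 4 := by positivity
          calc _ = ((p ^ i : ℕ) : ℝ) * p ^ 4 * 1 := by ring
            _ ≤ ((p ^ i : ℕ) : ℝ) * p ^ 4 * (j * Real.log p) := by gcongr
            _ = _ := by ring
        _ ≤ _ := by gcongr; exact hn1 i
    · rw [one_mul]
      refine le_trans (Real.rpow_le_rpow_of_exponent_le ?_ ?_) (hE i)
      · exact_mod_cast hn0 i
      · have := min_le_left δ (1 / 4)
        linarith
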